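/- Let k ≥ 1 and n ∈ ℕ with 2n ≥ (k/2)² + 3. Fix bounded intervals (a_{ij}, b_{ij}) ⊆ ℝ for 1 ≤ i < j ≤ k, and let g ∈ SL_{2n}(ℝ). Then there exist constants C > 0 and T_0 > 0 depending on g, n, k and the intervals such that for all T ≥ T_0, | ∫_{X_{2n}} χ̂_{E_{g,T}} dμ − (1/ζ(2n)^k) · vol_{2nk}(E_{g,T}) | ≤ C · T^{2n(k−1) − (k−1)(k−2)}, where χ̂_{E_{g,T}} denotes the rank-k primitive Siegel transform of the characteristic function of E_{g,T}, ζ is the Riemann zeta function, and vol_{2nk} is Lebesgue measure on (ℝ^{2n})^k. -/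

import Mathlib

open Matrix MeasureTheory

noncomputable section

instance (m : ℕ) : MeasurableSpace (Matrix (Fin m) (Fin m) ℝ) := MeasurableSpace.pi

noncomputable instance (m : ℕ) : TopologicalSpace (Matrix.SpecialLinearGroup (Fin m) ℝ) :=
  instTopologicalSpaceSubtype

instance (m : ℕ) : MeasurableSpace (Matrix.SpecialLinearGroup (Fin m) ℝ) :=
  Subtype.instMeasurableSpace

abbrev SLR (m : ℕ) := Matrix.SpecialLinearGroup (Fin m) ℝ

/-- `SL_m(ℤ)`, viewed as a subgroup of `SL_m(ℝ)`. -/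
def SLZ (m : ℕ) : Subgroup (SLR m) :=
  (Matrix.SpecialLinearGroup.map (n := Fin m) (Int.castRingHom ℝ)).range

/-- The space `X_m = SL_m(ℝ)/SL_m(ℤ)`. -/
abbrev Xspace (m : ℕ) := SLR m ⧸ SLZ m

/-- Jordan measurability: bounded with null topological boundary. -/
def JordanMeasurable {k d : ℕ} (S : Set (Fin k → Fin d → ℝ)) : Prop :=
  Bornology.IsBounded S ∧ volume (frontier S) = 0

/-- `vol_r`, with the convention `vol_0 = 1`. -/
def jvol (d r : ℕ) (S : Set (Fin r → Fin d → ℝ)) : ℝ :=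
  if r = 0 then 1 else (volume S).toReal

abbrev Pairs (k : ℕ) := {p : Fin k × Fin k // p.1 < p.2}

/-- The standard symplectic matrix `J_n` with block form `(0 Iₙ; -Iₙ 0)`. -/
def Jmat (n : ℕ) : Matrix (Fin (2*n)) (Fin (2*n)) ℝ :=
  fun i j => if (i : ℕ) + n = (j : ℕ) then 1 else if (j : ℕ) + n = (i : ℕ) then -1 else 0

/-- The standard symplectic form `⟨v,w⟩ = vᵀ Jₙ w` on `ℝ^{2n}`. -/
def symp (n : ℕ) (v w : Fin (2*n) → ℝ) : ℝ := v ⬝ᵥ (Jmat n).mulVec w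

/-- Euclidean norm on `ℝ^d` (presented as `Fin d → ℝ`). -/
def enorm2 {d : ℕ} (v : Fin d → ℝ) : ℝ := Real.sqrt (∑ i, (v i)^2)

/-- The set `E_{g,T}` of tuples `(v_1,…,v_k)` with `⟨v_i,v_j⟩ ∈ (a_{ij},b_{ij})` for
`i < j` and `‖g v_ℓ‖ < T`. -/
def EgT (n k : ℕ) (g : SLR (2*n)) (a b : Pairs k → ℝ) (T : ℝ) :
    Set (Fin k → Fin (2*n) → ℝ) :=
  {v | (∀ p : Pairs k, symp n (v p.1.1) (v p.1.2) ∈ Set.Ioo (a p) (b p)) ∧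
       ∀ l, enorm2 ((g : Matrix (Fin (2*n)) (Fin (2*n)) ℝ).mulVec (v l)) < T}

/-- A primitive integer vector: nonzero with coprime coordinates. -/
def IsPrimitiveVec {d : ℕ} (v : Fin d → ℤ) : Prop := v ≠ 0 ∧ Finset.univ.gcd v = 1

/-- The value `ζ(s)` of the Riemann zeta function at a natural number `s`. -/
def zetaval (s : ℕ) : ℝ := ∑' m : ℕ, (1:ℝ) / ((m+1 : ℝ) ^ s)

/-- cast of integer vectors -/
def cv {d : ℕ} : (Fin d → ℤ) →+ (Fin d → ℝ) := (Int.castAddHom ℝ).compLeft (Fin d)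

lemma cv_apply {d : ℕ} (z : Fin d → ℤ) (i : Fin d) : cv z i = (z i : ℝ) := rfl

lemma cv_inj {d : ℕ} : Function.Injective (cv (d := d)) := by
  intro a b h
  funext i
  have := congrFun h i
  simpa [cv_apply] using this

abbrev Tup (d k : ℕ) := Fin k → Fin d → ℝ
abbrev ZTup (d k : ℕ) := Fin k → Fin d → ℤ

def zc {d k : ℕ} (v : ZTup d k) : Tup d k := fun i => cv (v i)

lemma zc_inj {d k : ℕ} : Function.Injective (zc (d := d) (k := k)) := by
  intro a b h
  funext i
  exact cv_inj (congrFun h i)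

/-- the action on tuples -/
def act {d k : ℕ} (h : SLR d) (y : Tup d k) : Tup d k :=
  fun i => (h : Matrix (Fin d) (Fin d) ℝ).mulVec (y i)

lemma act_mul {d k : ℕ} (g h : SLR d) (y : Tup d k) : act (g * h) y = act g (act h y) := by
  funext i
  simp [act, Matrix.mulVec_mulVec]

lemma act_one {d k : ℕ} (y : Tup d k) : act 1 y = y := by
  funext i
  simp [act]

lemma act_inv_act {d k : ℕ} (g : SLR d) (y : Tup d k) : act g⁻¹ (act g y) = y := by
  rw [← act_mul, inv_mul_cancel, act_one]

lemma act_act_inv {d k : ℕ} (g : SLR d) (y : Tup d k) : act g (act g⁻¹ y) = y := by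
  rw [← act_mul, mul_inv_cancel, act_one]

/-- integer action -/
def zact {d k : ℕ} (γ : Matrix.SpecialLinearGroup (Fin d) ℤ) (v : ZTup d k) : ZTup d k :=
  fun i => (γ : Matrix (Fin d) (Fin d) ℤ).mulVec (v i)

lemma zact_mul {d k : ℕ} (g h : Matrix.SpecialLinearGroup (Fin d) ℤ) (y : ZTup d k) :
    zact (g * h) y = zact g (zact h y) := by
  funext i
  simp [zact, Matrix.mulVec_mulVec]

lemma zact_one {d k : ℕ} (y : ZTup d k) : zact 1 y = y := by
  funext i
  simp [zact]

def zemb {d : ℕ} (γ : Matrix.SpecialLinearGroup (Fin d) ℤ) : SLR d :=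
  Matrix.SpecialLinearGroup.map (n := Fin d) (Int.castRingHom ℝ) γ

lemma cv_mulVec {d : ℕ} (γ : Matrix.SpecialLinearGroup (Fin d) ℤ) (z : Fin d → ℤ) :
    cv ((γ : Matrix (Fin d) (Fin d) ℤ).mulVec z)
      = (zemb γ : Matrix (Fin d) (Fin d) ℝ).mulVec (cv z) := by
  funext i
  simp [cv_apply, zemb, Matrix.mulVec, dotProduct]

lemma zc_zact {d k : ℕ} (γ : Matrix.SpecialLinearGroup (Fin d) ℤ) (v : ZTup d k) :
    zc (zact γ v) = act (zemb γ) (zc v) := by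
  funext i
  exact cv_mulVec γ (v i)

def GInv {d k : ℕ} (S : Set (ZTup d k)) : Prop :=
  ∀ γ : Matrix.SpecialLinearGroup (Fin d) ℤ, ∀ v ∈ S, zact γ v ∈ S

/-- the bijection of an invariant set given by an integer matrix -/
def gequiv {d k : ℕ} {S : Set (ZTup d k)} (hS : GInv S)
    (γ : Matrix.SpecialLinearGroup (Fin d) ℤ) : S ≃ S where
  toFun v := ⟨zact γ v.1, hS γ _ v.2⟩
  invFun v := ⟨zact γ⁻¹ v.1, hS γ⁻¹ _ v.2⟩
  left_inv v := by
    apply Subtype.ext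
    simp only
    rw [← zact_mul, inv_mul_cancel, zact_one]
  right_inv v := by
    apply Subtype.ext
    simp only
    rw [← zact_mul, mul_inv_cancel, zact_one]

def sieg {d k : ℕ} (S : Set (ZTup d k)) (f : Tup d k → ENNReal) (h : SLR d) : ENNReal :=
  ∑' v : S, f (act h (zc v.1))

lemma sieg_mul {d k : ℕ} {S : Set (ZTup d k)} (hS : GInv S) (f : Tup d k → ENNReal)
    (h : SLR d) (γ : Matrix.SpecialLinearGroup (Fin d) ℤ) :
    sieg S f (h * zemb γ) = sieg S f h := by
  unfold sieg
  rw [← (gequiv hS γ).tsum_eq (fun v : S => f (act h (zc v.1)))]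
  refine tsum_congr fun v => ?_
  simp only [gequiv, Equiv.coe_fn_mk]
  rw [zc_zact, act_mul]

lemma sieg_out {d k : ℕ} {S : Set (ZTup d k)} (hS : GInv S) (f : Tup d k → ENNReal)
    (h : SLR d) : sieg S f (Quotient.out (QuotientGroup.mk h : Xspace d)) = sieg S f h := by
  obtain ⟨γ, hγ⟩ := QuotientGroup.mk_out_eq_mul (SLZ d) h
  obtain ⟨γ', h'⟩ := γ.2
  have : Quotient.out (QuotientGroup.mk h : Xspace d) = h * zemb γ' := by
    rw [show zemb γ' = γ.1 from h']; exact hγ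
  rw [this, sieg_mul hS]

lemma continuous_act {d k : ℕ} (h : SLR d) : Continuous (act (d := d) (k := k) h) := by
  unfold act
  fun_prop

lemma measurable_act {d k : ℕ} (h : SLR d) : Measurable (act (d := d) (k := k) h) :=
  (continuous_act h).measurable

lemma measurable_coeff {d : ℕ} (i j : Fin d) :
    Measurable (fun h : SLR d => (h : Matrix (Fin d) (Fin d) ℝ) i j) := by
  have h1 : Measurable (fun h : SLR d => (h : Matrix (Fin d) (Fin d) ℝ)) := measurable_subtype_coe
  have h2 : Measurable (fun M : Matrix (Fin d) (Fin d) ℝ => M i) := measurable_pi_apply i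
  exact (measurable_pi_apply j).comp (h2.comp h1)

lemma measurable_act_left {d k : ℕ} (y : Tup d k) : Measurable (fun h : SLR d => act h y) := by
  refine measurable_pi_lambda _ fun i => measurable_pi_lambda _ fun j => ?_
  simp only [act, Matrix.mulVec, dotProduct]
  exact Finset.measurable_sum _ fun l _ => (measurable_coeff j l).mul_const _

lemma measurable_sieg {d k : ℕ} (S : Set (ZTup d k)) {f : Tup d k → ENNReal}
    (hf : Measurable f) : Measurable (sieg S f) := by
  unfold sieg
  exact Measurable.tsum fun v => hf.comp (measurable_act_left _)

lemma measurable_sieg_out {d k : ℕ} {S : Set (ZTup d k)} (hS : GInv S) {f : Tup d k → ENNReal}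
    (hf : Measurable f) : Measurable (fun x : Xspace d => sieg S f (Quotient.out x)) := by
  apply measurable_from_quotient.2
  have : ((fun x : Xspace d => sieg S f (Quotient.out x)) ∘ Quotient.mk'') = sieg S f := by
    funext h
    exact sieg_out hS f h
  rw [this]
  exact measurable_sieg S hf

def kap {d k : ℕ} (S : Set (ZTup d k)) (x : Xspace d) : Measure (Tup d k) :=
  Measure.sum (fun v : S => Measure.dirac (act (Quotient.out x) (zc v.1)))

lemma lintegral_kap {d k : ℕ} (S : Set (ZTup d k)) (x : Xspace d) {f : Tup d k → ENNReal}
    (hf : Measurable f) : ∫⁻ y, f y ∂(kap S x) = sieg S f (Quotient.out x) := by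
  unfold kap sieg
  rw [lintegral_sum_measure]
  exact tsum_congr fun v => lintegral_dirac' _ hf

lemma measurable_kap {d k : ℕ} {S : Set (ZTup d k)} (hS : GInv S) : Measurable (kap S) := by
  refine Measure.measurable_of_measurable_coe _ fun A hA => ?_
  have : (fun x => kap S x A) = fun x => sieg S (A.indicator 1) (Quotient.out x) := by
    funext x
    rw [← lintegral_kap S x (measurable_one.indicator hA), lintegral_indicator_one hA]
  rw [this]
  exact measurable_sieg_out hS (measurable_one.indicator hA)

def mS {d k : ℕ} (μ : Measure (Xspace d)) (S : Set (ZTup d k)) : Measure (Tup d k) :=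
  μ.bind (kap S)

lemma lintegral_mS {d k : ℕ} (μ : Measure (Xspace d)) {S : Set (ZTup d k)} (hS : GInv S)
    {f : Tup d k → ENNReal} (hf : Measurable f) :
    ∫⁻ y, f y ∂(mS μ S) = ∫⁻ x, sieg S f (Quotient.out x) ∂μ := by
  unfold mS
  rw [Measure.lintegral_bind (measurable_kap hS).aemeasurable hf.aemeasurable]
  exact lintegral_congr fun x => lintegral_kap S x hf

lemma mS_apply {d k : ℕ} (μ : Measure (Xspace d)) {S : Set (ZTup d k)} (hS : GInv S)
    {A : Set (Tup d k)} (hA : MeasurableSet A) :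
    mS μ S A = ∫⁻ x, sieg S (A.indicator 1) (Quotient.out x) ∂μ := by
  rw [← lintegral_mS μ hS (measurable_one.indicator hA), lintegral_indicator_one hA]

def XInv {d : ℕ} (μ : Measure (Xspace d)) : Prop :=
  ∀ γ : SLR d, Measure.map (fun x => γ • x) μ = μ

lemma measurable_mul_left_SL {d : ℕ} (γ : SLR d) : Measurable (fun h : SLR d => γ * h) := by
  refine Measurable.subtype_mk ?_
  refine measurable_pi_lambda _ fun i => measurable_pi_lambda _ fun j => ?_
  simp only [Matrix.mul_apply]
  exact Finset.measurable_sum _ fun l _ => (measurable_coeff l j).const_mul _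

lemma measurable_smul_X {d : ℕ} (γ : SLR d) : Measurable (fun x : Xspace d => γ • x) := by
  apply measurable_from_quotient.2
  have h : ((fun x : Xspace d => γ • x) ∘ Quotient.mk'') =
      fun h => (Quotient.mk'' (γ * h) : Xspace d) := by
    funext h; rfl
  rw [h]
  exact measurable_quotient_mk''.comp (measurable_mul_left_SL γ)

lemma map_act_mS {d k : ℕ} {μ : Measure (Xspace d)} (hμ : XInv μ) {S : Set (ZTup d k)}
    (hS : GInv S) (γ : SLR d) : Measure.map (act γ) (mS μ S) = mS μ S := by
  ext A hA
  rw [Measure.map_apply (measurable_act γ) hA, mS_apply μ hS (measurable_act γ hA), mS_apply μ hS hA]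
  conv_rhs => rw [← hμ γ]
  rw [lintegral_map (measurable_sieg_out hS (measurable_one.indicator hA)) (measurable_smul_X γ)]
  refine lintegral_congr fun x => ?_
  induction x using Quotient.inductionOn' with
  | h h =>
  have h1 : sieg S (A.indicator 1) (Quotient.out (γ • (QuotientGroup.mk h : Xspace d)))
      = sieg S (A.indicator 1) (γ * h) := sieg_out hS _ (γ * h)
  refine Eq.trans ?_ h1.symm
  have h2 := sieg_out hS ((act γ ⁻¹' A).indicator 1) h
  refine Eq.trans h2 ?_
  unfold sieg
  refine tsum_congr fun v => ?_
  rw [act_mul]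
  rfl

/-- comparison principle -/
lemma lintegral_out_mono {d : ℕ} (μ : Measure (Xspace d)) (F G : SLR d → ENNReal)
    (h : ∀ g, F g ≤ G g) :
    ∫⁻ x : Xspace d, F (Quotient.out x) ∂μ ≤ ∫⁻ x : Xspace d, G (Quotient.out x) ∂μ :=
  lintegral_mono fun _ => h _

/-- covering lemma -/
lemma sieg_cover {d k : ℕ} {ι : Type*} {r : ι → ℕ} (S : Set (ZTup d k))
    (S' : ∀ i, Set (ZTup d (r i))) (f : Tup d k → ENNReal) (f' : ∀ i, Tup d (r i) → ENNReal)
    (h : SLR d)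
    (R : ∀ i, ZTup d (r i) → ZTup d k)
    (hc : ∀ v ∈ S, f (act h (zc v)) ≠ 0 → ∃ i, ∃ w ∈ S' i, R i w = v ∧
        f (act h (zc v)) ≤ f' i (act h (zc w))) :
    sieg S f h ≤ ∑' i, sieg (S' i) (f' i) h := by
  classical
  unfold sieg
  rw [← ENNReal.tsum_sigma (f := fun (i : ι) (w : S' i) => f' i (act h (zc w.1)))]
  set T : Set S := {v | f (act h (zc v.1)) ≠ 0} with hT
  have h1 : ∑' v : S, f (act h (zc v.1)) = ∑' v : T, f (act h (zc v.1.1)) := by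
    refine (tsum_subtype_eq_of_support_subset (s := T) ?_).symm
    intro v hv
    exact hv
  rw [h1]
  have hc' : ∀ v : T, ∃ p : (Σ i, S' i), R p.1 p.2.1 = v.1.1 ∧
      f (act h (zc v.1.1)) ≤ f' p.1 (act h (zc p.2.1)) := by
    intro v
    obtain ⟨i, w, hw, h1, h2⟩ := hc v.1.1 v.1.2 v.2
    exact ⟨⟨i, w, hw⟩, h1, h2⟩
  choose p hp1 hp2 using hc'
  have hinj : Function.Injective p := by
    intro a b hab
    apply Subtype.ext
    apply Subtype.ext
    rw [← hp1 a, ← hp1 b, hab]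
  refine le_trans (ENNReal.tsum_le_tsum hp2) ?_
  exact ENNReal.tsum_comp_le_tsum_of_injective hinj (fun q : (Σ i, S' i) => f' q.1 (act h (zc q.2.1)))

instance haarTup (d k : ℕ) : (volume : Measure (Tup d k)).IsAddHaarMeasure :=
  { lt_top_of_isCompact := fun _ hK => hK.measure_lt_top
    map_add_left_eq_self := fun g => (inferInstance : Measure.IsAddLeftInvariant (volume : Measure (Fin k → Fin d → ℝ))).map_add_left_eq_self g
    open_pos := fun U hU hne => hU.measure_ne_zero _ hne }

instance borelMat (d : ℕ) : BorelSpace (Matrix (Fin d) (Fin d) ℝ) :=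
  inferInstanceAs (BorelSpace (Fin d → Fin d → ℝ))

instance mm2 (d : ℕ) : MeasurableMul₂ (SLR d) where
  measurable_mul := by
    refine Measurable.subtype_mk ?_
    refine measurable_pi_lambda _ fun i => measurable_pi_lambda _ fun j => ?_
    simp only [Matrix.mul_apply]
    exact Finset.measurable_sum _ fun l _ =>
      ((measurable_coeff i l).comp measurable_fst).mul ((measurable_coeff l j).comp measurable_snd)

instance mInv (d : ℕ) : MeasurableInv (SLR d) where
  measurable_inv := by
    have h : Continuous (fun M : Matrix (Fin d) (Fin d) ℝ => M.adjugate) :=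
      continuous_id.matrix_adjugate
    exact Measurable.subtype_mk (h.measurable.comp measurable_subtype_coe)

def actL {d k : ℕ} (h : SLR d) : Tup d k →ₗ[ℝ] Tup d k :=
  LinearMap.pi fun i => (Matrix.toLin' (h : Matrix (Fin d) (Fin d) ℝ)) ∘ₗ LinearMap.proj i

lemma map_act_volume {d k : ℕ} (h : SLR d) :
    Measure.map (act (k := k) h) volume = volume := by
  have h1 : LinearMap.det (actL (k := k) h) = 1 := by
    unfold actL
    rw [LinearMap.det_pi]
    simp
  have h2 := Measure.map_linearMap_addHaar_eq_smul_addHaar (volume : Measure (Tup d k))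
    (f := actL h) (by rw [h1]; exact one_ne_zero)
  rw [h1] at h2
  have h3 : (⇑(actL (k := k) h)) = act h := by
    funext y i
    simp [actL, act]
  rw [h3] at h2
  simpa using h2

lemma measurableSet_LI (d k : ℕ) : MeasurableSet {y : Tup d k | LinearIndependent ℝ y} :=
  (isOpen_setOfPred_linearIndependent (𝕜 := ℝ) (E := Fin d → ℝ) (ι := Fin k)).measurableSet

lemma ae_LI {d k : ℕ} (hk : k ≤ d) : ∀ᵐ y : Tup d k, LinearIndependent ℝ y := by
  induction k with
  | zero => exact Filter.Eventually.of_forall fun y => linearIndependent_empty_type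
  | succ k ih =>
    have ih := ih (by omega)
    have mp := volume_preserving_piFinSuccAbove (fun _ : Fin (k+1) => Fin d → ℝ) (Fin.last k)
    have hmeas : MeasurableSet {p : (Fin d → ℝ) × Tup d k |
        LinearIndependent ℝ (Fin.snoc p.2 p.1 : Fin (k+1) → Fin d → ℝ)} := by
      have hc : Continuous (fun p : (Fin d → ℝ) × Tup d k =>
          (Fin.snoc p.2 p.1 : Fin (k+1) → Fin d → ℝ)) := by
        refine continuous_pi fun i => ?_
        refine Fin.lastCases ?_ (fun j => ?_) i
        · simp only [Fin.snoc_last]; exact continuous_fst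
        · simp only [Fin.snoc_castSucc]; fun_prop
      exact hc.measurable (measurableSet_LI d (k+1))
    have key : ∀ᵐ p : (Fin d → ℝ) × Tup d k,
        LinearIndependent ℝ (Fin.snoc p.2 p.1 : Fin (k+1) → Fin d → ℝ) := by
      have hsw : Measure.map Prod.swap ((volume : Measure (Tup d k)).prod (volume : Measure (Fin d → ℝ)))
          = (volume : Measure ((Fin d → ℝ) × Tup d k)) := Measure.prod_swap
      rw [← hsw, ae_map_iff measurable_swap.aemeasurable hmeas]
      refine (Measure.ae_prod_mem_iff_ae_ae_mem (measurable_swap hmeas)).2 ?_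
      filter_upwards [ih] with y hy
      have hne : Submodule.span ℝ (Set.range y) ≠ ⊤ := by
        intro h
        have h1 := finrank_span_eq_card hy
        rw [h] at h1
        simp at h1
        omega
      have h0 := Measure.addHaar_submodule (volume : Measure (Fin d → ℝ)) _ hne
      have : ∀ᵐ x : Fin d → ℝ, x ∉ Submodule.span ℝ (Set.range y) := by
        rw [ae_iff]; simpa using h0
      filter_upwards [this] with x hx
      exact linearIndependent_finSnoc.2 ⟨hy, hx⟩
    have := mp.quasiMeasurePreserving.ae key
    filter_upwards [this] with y hy
    convert hy using 1
    funext i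
    refine Fin.lastCases ?_ (fun j => ?_) i
    · simp [MeasurableEquiv.piFinSuccAbove]
    · simp [MeasurableEquiv.piFinSuccAbove, Fin.insertNthEquiv]; rfl

/-- quantitatively nondegenerate tuples -/
def Kset (d k : ℕ) (N : ℝ) : Set (Tup d k) :=
  {y | ∃ M : Matrix (Fin d) (Fin d) ℝ, M.det = 1 ∧ (∀ i j, |M i j| ≤ N) ∧
    ∀ (i : Fin k) (j : Fin d), (j : ℕ) = i → ∀ l, M l j = y i l}

lemma Kset_mono {d k : ℕ} {N N' : ℝ} (h : N ≤ N') : Kset d k N ⊆ Kset d k N' := by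
  rintro y ⟨M, h1, h2, h3⟩
  exact ⟨M, h1, fun i j => (h2 i j).trans h, h3⟩

lemma measurableSet_Kset {d k : ℕ} (hk : k ≤ d) (N : ℝ) : MeasurableSet (Kset d k N) := by
  have hc : IsCompact {M : Matrix (Fin d) (Fin d) ℝ | M.det = 1 ∧ (∀ i j, |M i j| ≤ N)} := by
    have h1 : IsCompact (Set.univ.pi fun _ : Fin d => Set.univ.pi fun _ : Fin d => Set.Icc (-N) N) :=
      isCompact_univ_pi fun _ => isCompact_univ_pi fun _ => isCompact_Icc
    have h2 : IsClosed {M : Matrix (Fin d) (Fin d) ℝ | M.det = 1} :=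
      isClosed_eq (continuous_id.matrix_det) continuous_const
    have h3 := h1.inter_right h2
    have h4 : {M : Matrix (Fin d) (Fin d) ℝ | M.det = 1 ∧ (∀ i j, |M i j| ≤ N)} =
        (Set.univ.pi fun _ : Fin d => Set.univ.pi fun _ : Fin d => Set.Icc (-N) N) ∩
          {M : Matrix (Fin d) (Fin d) ℝ | M.det = 1} := by
      apply Set.ext
      intro M
      constructor
      · rintro ⟨ha, hb⟩
        exact ⟨fun i _ j _ => abs_le.1 (hb i j), ha⟩
      · rintro ⟨ha, hb⟩
        exact ⟨hb, fun i j => abs_le.2 (ha i trivial j trivial)⟩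
    rw [h4]
    exact h3
  have himg : Kset d k N = (fun (M : Matrix (Fin d) (Fin d) ℝ) (i : Fin k) (l : Fin d) =>
      M l (Fin.castLE hk i)) '' {M | M.det = 1 ∧ (∀ i j, |M i j| ≤ N)} := by
    ext y
    constructor
    · rintro ⟨M, h1, h2, h3⟩
      refine ⟨M, ⟨h1, h2⟩, ?_⟩
      funext i l
      exact h3 i _ (by simp) l
    · rintro ⟨M, ⟨h1, h2⟩, rfl⟩
      refine ⟨M, h1, h2, ?_⟩
      intro i j hij l
      have : j = Fin.castLE hk i := by apply Fin.ext; simpa using hij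
      rw [this]
  rw [himg]
  refine (hc.image ?_).measurableSet
  refine continuous_pi fun i => continuous_pi fun l => ?_
  exact (continuous_apply (Fin.castLE hk i)).comp (continuous_apply (A := fun _ => Fin d → ℝ) l)

section uniq
variable {k e : ℕ}

abbrev PP (k e : ℕ) := Tup (k+(e+1)) k × Tup (k+(e+1)) (e+1)

def mat (p : PP k e) : Matrix (Fin (k+(e+1))) (Fin (k+(e+1))) ℝ :=
  fun i j => (Fin.append p.1 p.2 : Fin (k+(e+1)) → Fin (k+(e+1)) → ℝ) j i

def lastI (k e : ℕ) : Fin (k+(e+1)) := Fin.natAdd k (Fin.last e)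

lemma continuous_mat : Continuous (mat (k := k) (e := e)) := by
  refine continuous_pi fun i => continuous_pi fun j => ?_
  unfold mat
  refine Fin.addCases (fun j => ?_) (fun j => ?_) j
  · simp only [Fin.append_left]; fun_prop
  · simp only [Fin.append_right]; fun_prop

lemma mat_act (g : SLR (k+(e+1))) (p : PP k e) :
    mat (act g p.1, act g p.2) = (g : Matrix _ _ ℝ) * mat p := by
  ext i j
  simp only [mat, Matrix.mul_apply]
  refine Fin.addCases (fun j => ?_) (fun j => ?_) j
  · simp only [Fin.append_left]; rfl
  · simp only [Fin.append_right]; rfl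

lemma det_mat_act (g : SLR (k+(e+1))) (p : PP k e) :
    (mat (act g p.1, act g p.2)).det = (mat p).det := by
  rw [mat_act, Matrix.det_mul, g.2, one_mul]

def nrm (p : PP k e) : Matrix (Fin (k+(e+1))) (Fin (k+(e+1))) ℝ :=
  mat p * Matrix.diagonal (Function.update 1 (lastI k e) ((mat p).det)⁻¹)

lemma det_nrm (p : PP k e) (h : (mat p).det ≠ 0) : (nrm p).det = 1 := by
  unfold nrm
  rw [Matrix.det_mul, Matrix.det_diagonal, Finset.prod_update_of_mem (Finset.mem_univ _)]
  simp [h]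

open Classical in
def rho (p : PP k e) : SLR (k+(e+1)) :=
  ⟨if (mat p).det ≠ 0 then nrm p else 1, by
    split_ifs with h
    · exact det_nrm p h
    · simp⟩

lemma measurable_rho : Measurable (rho (k := k) (e := e)) := by
  classical
  refine Measurable.subtype_mk ?_
  have hd : Measurable (fun p : PP k e => (mat p).det) := (continuous_mat.matrix_det).measurable
  refine Measurable.ite (hd (measurableSet_singleton 0).compl) ?_ measurable_const
  refine measurable_pi_lambda _ fun i => measurable_pi_lambda _ fun j => ?_
  unfold nrm
  simp only [Matrix.mul_diagonal]
  have h1 : Measurable (fun p : PP k e => mat p i j) := by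
    have h2 : Measurable (mat (k := k) (e := e)) := continuous_mat.measurable
    exact (measurable_pi_apply j).comp ((measurable_pi_apply (X := fun _ => Fin (k+(e+1)) → ℝ) i).comp h2)
  refine h1.mul ?_
  by_cases h : j = lastI k e
  · subst h; simp only [Function.update_self]; exact hd.inv
  · simp only [Function.update_of_ne h]; exact measurable_const

def Tset (k e : ℕ) : Set (PP k e) := {p | 0 < (mat p).det ∧ (mat p).det ≤ 1}

lemma measurableSet_Tset : MeasurableSet (Tset k e) := by
  have hd : Measurable (fun p : PP k e => (mat p).det) := (continuous_mat.matrix_det).measurable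
  exact (measurableSet_lt measurable_const hd).inter (measurableSet_le hd measurable_const)

lemma rho_coe {p : PP k e} (hp : p ∈ Tset k e) : (rho p).1 = nrm p := by
  have h0 : (mat p).det ≠ 0 := hp.1.ne'
  simp only [rho]
  rw [if_pos h0]

lemma rho_act (g : SLR (k+(e+1))) (p : PP k e) (hp : p ∈ Tset k e) :
    rho (act g p.1, act g p.2) = g * rho p := by
  apply Subtype.ext
  have h1 : ((act g p.1, act g p.2) : PP k e) ∈ Tset k e := by
    unfold Tset
    rw [Set.mem_ofPred_eq, det_mat_act]
    exact hp
  rw [rho_coe h1, Matrix.SpecialLinearGroup.coe_mul, rho_coe hp]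
  unfold nrm
  rw [det_mat_act, mat_act, Matrix.mul_assoc]

def nt (m : Measure (Tup (k+(e+1)) k)) : Measure (SLR (k+(e+1))) :=
  Measure.map rho ((m.prod volume).restrict (Tset k e))

lemma nt_inv (m : Measure (Tup (k+(e+1)) k)) [SFinite m]
    (hinv : ∀ γ : SLR (k+(e+1)), Measure.map (act γ) m = m) : (nt m).IsMulLeftInvariant := by
  constructor
  intro g
  unfold nt
  have hA : Measurable (Prod.map (act g) (act g) : PP k e → PP k e) :=
    (measurable_act g).prodMap (measurable_act g)
  have h1 : Measure.map (Prod.map (act g) (act g)) (m.prod (volume : Measure (Tup (k+(e+1)) (e+1))))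
      = m.prod volume := by
    rw [← Measure.map_prod_map _ _ (measurable_act g) (measurable_act g), hinv, map_act_volume]
  have h2 : (Prod.map (act g) (act g) : PP k e → PP k e) ⁻¹' (Tset k e) = Tset k e := by
    ext p
    simp only [Tset, Set.mem_preimage, Set.mem_ofPred_eq, Prod.map]
    rw [det_mat_act]
  have h3 : Measure.map (Prod.map (act g) (act g)) ((m.prod volume).restrict (Tset k e))
      = (m.prod volume).restrict (Tset k e) := by
    have := Measure.restrict_map (μ := m.prod (volume : Measure (Tup (k+(e+1)) (e+1)))) hA
      (measurableSet_Tset (k := k) (e := e))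
    rw [h1, h2] at this
    exact this.symm
  rw [Measure.map_map (measurable_mul_left_SL g) measurable_rho]
  conv_rhs => rw [← h3]
  rw [Measure.map_map measurable_rho hA]
  refine Measure.map_congr ?_
  refine (ae_restrict_mem measurableSet_Tset).mono fun p hp => ?_
  exact (rho_act g p hp).symm

def cols (h : SLR (k+(e+1))) : Tup (k+(e+1)) (e+1) := fun j i => h.1 i (Fin.natAdd k j)
def cols0 (h : SLR (k+(e+1))) : Tup (k+(e+1)) k := fun j i => h.1 i (Fin.castAdd (e+1) j)

lemma cols0_rho {p : PP k e} (hp : p ∈ Tset k e) : cols0 (rho p) = p.1 := by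
  funext j i
  simp only [cols0, rho_coe hp, nrm, Matrix.mul_diagonal]
  rw [Function.update_of_ne]
  · simp [mat]
  · intro h
    have := congrArg Fin.val h
    have h2 := j.2
    simp [lastI] at this
    omega

lemma abs_le_cols_rho {p : PP k e} (hp : p ∈ Tset k e) (j : Fin (e+1)) (i) :
    |p.2 j i| ≤ |cols (rho p) j i| := by
  simp only [cols, rho_coe hp, nrm, Matrix.mul_diagonal]
  have h1 : mat p i (Fin.natAdd k j) = p.2 j i := by simp [mat]
  rw [h1, abs_mul]
  refine le_mul_of_one_le_right (abs_nonneg _) ?_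
  by_cases h : Fin.natAdd k j = lastI k e
  · rw [h, Function.update_self, abs_inv, abs_of_pos hp.1]
    exact (one_le_inv₀ hp.1).2 hp.2
  · rw [Function.update_of_ne h]; simp

lemma norm_le_cols_rho {p : PP k e} (hp : p ∈ Tset k e) : ‖p.2‖ ≤ ‖cols (rho p)‖ := by
  refine (pi_norm_le_iff_of_nonneg (norm_nonneg _)).2 fun j => ?_
  refine (pi_norm_le_iff_of_nonneg (norm_nonneg _)).2 fun i => ?_
  refine le_trans (abs_le_cols_rho hp j i) ?_
  exact le_trans (norm_le_pi_norm (cols (rho p) j) i) (norm_le_pi_norm (cols (rho p)) j)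

def Bset (k e : ℕ) (N : ℝ) : Set (SLR (k+(e+1))) := {h | ∀ i j, |h.1 i j| ≤ N}

lemma nt_finite (m : Measure (Tup (k+(e+1)) k)) [SFinite m]
    (hfin : ∀ N : ℕ, m (Kset (k+(e+1)) k N) < ⊤) (N : ℕ) : nt m (Bset k e N) < ⊤ := by
  have hB : MeasurableSet (Bset k e N) := by
    have : Bset k e N = ⋂ i, ⋂ j, {h : SLR (k+(e+1)) | |h.1 i j| ≤ (N:ℝ)} := by ext; simp [Bset]
    rw [this]
    exact MeasurableSet.iInter fun i => MeasurableSet.iInter fun j =>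
      measurableSet_le (continuous_abs.measurable.comp (measurable_coeff i j)) measurable_const
  unfold nt
  rw [Measure.map_apply measurable_rho hB, Measure.restrict_apply (measurable_rho hB)]
  have hsub : rho ⁻¹' Bset k e N ∩ Tset k e ⊆
      Kset (k+(e+1)) k N ×ˢ Metric.closedBall (0 : Tup (k+(e+1)) (e+1)) N := by
    rintro p ⟨hp1, hp2⟩
    refine ⟨⟨(rho p).1, (rho p).2, hp1, ?_⟩, ?_⟩
    · intro i j hij l
      have hj : j = Fin.castAdd (e+1) i := by apply Fin.ext; simpa using hij
      have := congrFun (congrFun (cols0_rho hp2) i) l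
      rw [hj]; exact this
    · rw [mem_closedBall_zero_iff]
      refine (norm_le_cols_rho hp2).trans ?_
      refine (pi_norm_le_iff_of_nonneg (Nat.cast_nonneg _)).2 fun j => ?_
      refine (pi_norm_le_iff_of_nonneg (Nat.cast_nonneg _)).2 fun i => ?_
      exact hp1 i _
  refine lt_of_le_of_lt (measure_mono hsub) ?_
  rw [Measure.prod_prod]
  exact ENNReal.mul_lt_top (hfin N) measure_closedBall_lt_top

lemma nt_sigma (m : Measure (Tup (k+(e+1)) k)) [SFinite m]
    (hfin : ∀ N : ℕ, m (Kset (k+(e+1)) k N) < ⊤) : SigmaFinite (nt m) := by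
  refine ⟨⟨⟨fun N => Bset k e N, fun _ => trivial, fun N => nt_finite m hfin N, ?_⟩⟩⟩
  refine Set.eq_univ_of_forall fun h => Set.mem_iUnion.2 ?_
  obtain ⟨N, hN⟩ := exists_nat_ge (∑ i, ∑ j, |h.1 i j|)
  refine ⟨N, fun i j => le_trans ?_ hN⟩
  have h1 : |h.1 i j| ≤ ∑ j, |h.1 i j| :=
    Finset.single_le_sum (f := fun j => |h.1 i j|) (fun _ _ => abs_nonneg _) (Finset.mem_univ j)
  exact h1.trans (Finset.single_le_sum (f := fun i => ∑ j, |h.1 i j|)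
    (fun _ _ => Finset.sum_nonneg fun _ _ => abs_nonneg _) (Finset.mem_univ i))

end uniq

section uniq
variable {k e : ℕ}

lemma LI_extend {d k : ℕ} {y : Tup d k} (hy : LinearIndependent ℝ y) (e : ℕ) (h : k + e ≤ d) :
    ∃ w : Tup d e, LinearIndependent ℝ (Fin.append y w : Fin (k+e) → Fin d → ℝ) := by
  induction e with
  | zero =>
    refine ⟨fun i => i.elim0, ?_⟩
    have : (Fin.append y (fun i => i.elim0) : Fin (k+0) → Fin d → ℝ) = y := by
      funext i
      exact Fin.append_left y (fun i : Fin 0 => i.elim0) i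
    rw [this]; exact hy
  | succ e ih =>
    obtain ⟨w, hw⟩ := ih (by omega)
    obtain ⟨x, hx⟩ := exists_linearIndependent_snoc_of_lt_finrank hw (by simp; omega)
    refine ⟨Fin.snoc w x, ?_⟩
    rw [Fin.append_snoc]
    exact hx

lemma ext1 {y : Tup (k+(e+1)) k} (hy : LinearIndependent ℝ y) (s : ℝ) :
    ∃ w : Tup (k+(e+1)) (e+1), (mat (y, w)).det = s := by
  obtain ⟨w, hw⟩ := LI_extend hy (e+1) le_rfl
  have h1 : (mat (y,w)).col = (Fin.append y w) := by
    funext j i; rfl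
  rw [← h1, Matrix.linearIndependent_cols_iff_isUnit, Matrix.isUnit_iff_isUnit_det] at hw
  have h0 : (mat (y,w)).det ≠ 0 := hw.ne_zero
  refine ⟨Function.update w (Fin.last e) ((s / (mat (y,w)).det) • w (Fin.last e)), ?_⟩
  have h2 : mat (y, Function.update w (Fin.last e) ((s / (mat (y,w)).det) • w (Fin.last e))) =
      (mat (y,w)).updateCol (lastI k e) ((s / (mat (y,w)).det) • (mat (y,w)).col (lastI k e)) := by
    ext i j
    simp only [Matrix.updateCol_apply]
    refine Fin.addCases (fun j => ?_) (fun j => ?_) j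
    · have : Fin.castAdd (e+1) j ≠ lastI k e := by
        intro h
        have := congrArg Fin.val h
        have h2 := j.2
        simp [lastI] at this
        omega
      rw [if_neg this]
      simp [mat]
    · by_cases hj : j = Fin.last e
      · subst hj
        have hl : Fin.natAdd k (Fin.last e) = lastI k e := rfl
        rw [if_pos hl]
        simp only [mat, Matrix.col_apply, Pi.smul_apply, ← hl, Fin.append_right, Function.update_self]
      · have : Fin.natAdd k j ≠ lastI k e := by
          intro h
          exact hj (Fin.natAdd_injective _ _ h)
        rw [if_neg this]
        simp [mat, hj]
  rw [h2, Matrix.det_updateCol_smul]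
  have h3 : (mat (y,w)).updateCol (lastI k e) ((mat (y,w)).col (lastI k e)) = mat (y,w) :=
    Matrix.updateCol_eq_self _ _
  rw [h3]
  field_simp

lemma exists_Kset {y : Tup (k+(e+1)) k} (hy : LinearIndependent ℝ y) :
    ∃ N : ℕ, y ∈ Kset (k+(e+1)) k N := by
  obtain ⟨w, hw⟩ := ext1 hy 1
  obtain ⟨N, hN⟩ := exists_nat_ge (∑ i, ∑ j, |mat (y,w) i j|)
  refine ⟨N, mat (y,w), hw, fun i j => le_trans ?_ hN, ?_⟩
  · have h1 : |mat (y,w) i j| ≤ ∑ j, |mat (y,w) i j| :=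
      Finset.single_le_sum (f := fun j => |mat (y,w) i j|) (fun _ _ => abs_nonneg _) (Finset.mem_univ j)
    exact h1.trans (Finset.single_le_sum (f := fun i => ∑ j, |mat (y,w) i j|)
      (fun _ _ => Finset.sum_nonneg fun _ _ => abs_nonneg _) (Finset.mem_univ i))
  · intro i j hij l
    have hj : j = Fin.castAdd (e+1) i := by apply Fin.ext; simpa using hij
    rw [hj]; simp [mat]

def psi (h : SLR (k+(e+1))) : ENNReal :=
  ENNReal.ofReal ((1 + ‖cols h‖) ^ (-((Module.finrank ℝ (Tup (k+(e+1)) (e+1)) : ℝ) + 1)))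

lemma measurable_cols : Measurable (cols (k := k) (e := e)) :=
  measurable_pi_lambda _ fun j => measurable_pi_lambda _ fun i => measurable_coeff i _

lemma measurable_cols0 : Measurable (cols0 (k := k) (e := e)) :=
  measurable_pi_lambda _ fun j => measurable_pi_lambda _ fun i => measurable_coeff i _

lemma measurable_psi : Measurable (psi (k := k) (e := e)) := by
  unfold psi
  exact ENNReal.measurable_ofReal.comp
    ((measurable_const.add (measurable_norm.comp measurable_cols)).pow_const _)

lemma psi_pos (h : SLR (k+(e+1))) : psi h ≠ 0 := by
  unfold psi
  have : 0 < (1 + ‖cols h‖) ^ (-((Module.finrank ℝ (Tup (k+(e+1)) (e+1)) : ℝ) + 1)) := by positivity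
  simpa using this

def kk (p : PP k e) : ENNReal := (Tset k e).indicator (fun p => psi (rho p)) p

lemma measurable_kk : Measurable (kk (k := k) (e := e)) :=
  (measurable_psi.comp measurable_rho).indicator measurableSet_Tset

def kapp (y : Tup (k+(e+1)) k) : ENNReal := ∫⁻ w : Tup (k+(e+1)) (e+1), kk (y, w)

lemma measurable_kapp : Measurable (kapp (k := k) (e := e)) :=
  Measurable.lintegral_prod_right' measurable_kk

lemma kapp_lt_top (y : Tup (k+(e+1)) k) : kapp y < ⊤ := by
  refine lt_of_le_of_lt ?_ (finite_integral_one_add_norm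
    (μ := (volume : Measure (Tup (k+(e+1)) (e+1)))) (lt_add_one _))
  refine lintegral_mono fun w => ?_
  unfold kk
  by_cases h : (y, w) ∈ Tset k e
  · rw [Set.indicator_of_mem h]
    unfold psi
    refine ENNReal.ofReal_le_ofReal ?_
    refine Real.rpow_le_rpow_of_nonpos (by positivity) ?_ ?_
    · have := norm_le_cols_rho h
      simpa using this
    · have : (0:ℝ) ≤ (Module.finrank ℝ (Tup (k+(e+1)) (e+1)) : ℝ) := Nat.cast_nonneg _
      linarith
  · rw [Set.indicator_of_notMem h]; exact bot_le

lemma kapp_pos {y : Tup (k+(e+1)) k} (hy : LinearIndependent ℝ y) : 0 < kapp y := by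
  unfold kapp
  have hmm : Measurable (fun w : Tup (k+(e+1)) (e+1) => kk (y, w)) :=
    measurable_kk.comp measurable_prodMk_left
  rw [lintegral_pos_iff_support hmm]
  have hcm : Continuous (fun w : Tup (k+(e+1)) (e+1) => (mat (y, w)).det) :=
    (continuous_mat.comp (by fun_prop)).matrix_det
  have ho : IsOpen {w : Tup (k+(e+1)) (e+1) | 0 < (mat (y,w)).det ∧ (mat (y,w)).det < 1} :=
    (isOpen_lt continuous_const hcm).inter (isOpen_lt hcm continuous_const)
  obtain ⟨w, hw⟩ := ext1 hy (1/2)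
  have hne : {w : Tup (k+(e+1)) (e+1) | 0 < (mat (y,w)).det ∧ (mat (y,w)).det < 1}.Nonempty :=
    ⟨w, by rw [Set.mem_ofPred_eq, hw]; norm_num⟩
  refine lt_of_lt_of_le (ho.measure_pos volume hne) (measure_mono ?_)
  rintro w ⟨h1, h2⟩
  have h : (y, w) ∈ Tset k e := ⟨h1, h2.le⟩
  rw [Function.mem_support]
  show kk (y,w) ≠ 0
  unfold kk
  rw [Set.indicator_of_mem h]
  exact psi_pos _

lemma lint_nt (m : Measure (Tup (k+(e+1)) k)) [SFinite m] {f : Tup (k+(e+1)) k → ENNReal}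
    (hf : Measurable f) :
    ∫⁻ h, f (cols0 h) * psi h ∂(nt m) = ∫⁻ y, f y * kapp y ∂m := by
  unfold nt
  have hmm : Measurable (fun h : SLR (k+(e+1)) => f (cols0 h) * psi h) :=
    (hf.comp measurable_cols0).mul measurable_psi
  rw [lintegral_map hmm measurable_rho]
  rw [← lintegral_indicator measurableSet_Tset]
  have h1 : ∀ p : PP k e, (Tset k e).indicator (fun a => f (cols0 (rho a)) * psi (rho a)) p =
      f p.1 * kk p := by
    intro p
    unfold kk
    by_cases h : p ∈ Tset k e
    · rw [Set.indicator_of_mem h, Set.indicator_of_mem h, cols0_rho h]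
    · rw [Set.indicator_of_notMem h, Set.indicator_of_notMem h, mul_zero]
  simp_rw [h1]
  have hm2 : Measurable (fun p : PP k e => f p.1 * kk p) :=
    (hf.comp measurable_fst).mul measurable_kk
  rw [lintegral_prod _ hm2.aemeasurable]
  refine lintegral_congr fun y => ?_
  have hm3 : Measurable (fun w : Tup (k+(e+1)) (e+1) => kk (y, w)) :=
    measurable_kk.comp measurable_prodMk_left
  exact lintegral_const_mul (f y) hm3

lemma vol_Kset_lt (d k : ℕ) (N : ℝ) : volume (Kset d k N) < ⊤ ∨ d < k := by
  by_cases hdk : d < k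
  · exact Or.inr hdk
  left
  refine lt_of_le_of_lt (measure_mono ?_)
    (measure_closedBall_lt_top (x := (0 : Tup d k)) (r := |N|))
  rintro y ⟨M, -, h2, h3⟩
  rw [mem_closedBall_zero_iff]
  refine (pi_norm_le_iff_of_nonneg (abs_nonneg _)).2 fun i => ?_
  refine (pi_norm_le_iff_of_nonneg (abs_nonneg _)).2 fun l => ?_
  rw [← h3 i ⟨i, by omega⟩ rfl l]
  exact (h2 _ _).trans (le_abs_self _)

lemma nt_vol_pos : ∃ N : ℕ, nt (volume : Measure (Tup (k+(e+1)) k)) (Bset k e N) ≠ 0 := by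
  by_contra! hcon
  have h1 : (nt (volume : Measure (Tup (k+(e+1)) k))) Set.univ = 0 := by
    have hU : (Set.univ : Set (SLR (k+(e+1)))) = ⋃ N : ℕ, Bset k e N := by
      symm
      refine Set.eq_univ_of_forall fun h => Set.mem_iUnion.2 ?_
      obtain ⟨N, hN⟩ := exists_nat_ge (∑ i, ∑ j, |h.1 i j|)
      refine ⟨N, fun i j => le_trans ?_ hN⟩
      have h1 : |h.1 i j| ≤ ∑ j, |h.1 i j| :=
        Finset.single_le_sum (f := fun j => |h.1 i j|) (fun _ _ => abs_nonneg _) (Finset.mem_univ j)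
      exact h1.trans (Finset.single_le_sum (f := fun i => ∑ j, |h.1 i j|)
        (fun _ _ => Finset.sum_nonneg fun _ _ => abs_nonneg _) (Finset.mem_univ i))
    rw [hU]
    exact measure_iUnion_null hcon
  unfold nt at h1
  rw [Measure.map_apply measurable_rho MeasurableSet.univ, Set.preimage_univ,
    Measure.restrict_apply_univ] at h1
  have hcm : Continuous (fun p : PP k e => (mat p).det) := continuous_mat.matrix_det
  have ho : IsOpen {p : PP k e | 0 < (mat p).det ∧ (mat p).det < 1} :=
    (isOpen_lt continuous_const hcm).inter (isOpen_lt hcm continuous_const)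
  have hae := ae_LI (d := k+(e+1)) (k := k) (by omega)
  obtain ⟨y, hy⟩ : ∃ y : Tup (k+(e+1)) k, LinearIndependent ℝ y := by
    by_contra! hc
    have hz : (volume : Measure (Tup (k+(e+1)) k)) Set.univ = 0 := by
      rw [ae_iff] at hae
      rw [← hae]; congr 1; symm
      exact Set.eq_univ_of_forall hc
    have := isOpen_univ.measure_pos (volume : Measure (Tup (k+(e+1)) k)) ⟨0, trivial⟩
    exact this.ne' hz
  obtain ⟨w, hw⟩ := ext1 hy (1/2)
  have hne : {p : PP k e | 0 < (mat p).det ∧ (mat p).det < 1}.Nonempty :=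
    ⟨(y,w), by rw [Set.mem_ofPred_eq, hw]; norm_num⟩
  have := ho.measure_pos ((volume : Measure (Tup (k+(e+1)) k)).prod
    (volume : Measure (Tup (k+(e+1)) (e+1)))) hne
  refine absurd (measure_mono_null ?_ h1) this.ne'
  rintro p ⟨h1, h2⟩
  exact ⟨h1, h2.le⟩

lemma sigmaFinite_of (m : Measure (Tup (k+(e+1)) k))
    (hLI : m {y | ¬ LinearIndependent ℝ y} = 0)
    (hfin : ∀ N : ℕ, m (Kset (k+(e+1)) k N) < ⊤) : SigmaFinite m := by
  refine ⟨⟨⟨fun N => Kset (k+(e+1)) k N ∪ {y | ¬ LinearIndependent ℝ y}, fun _ => trivial,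
    fun N => ?_, ?_⟩⟩⟩
  · refine lt_of_le_of_lt (measure_union_le _ _) ?_
    rw [hLI, add_zero]; exact hfin N
  · refine Set.eq_univ_of_forall fun y => Set.mem_iUnion.2 ?_
    by_cases hy : LinearIndependent ℝ y
    · obtain ⟨N, hN⟩ := exists_Kset hy
      exact ⟨N, Or.inl hN⟩
    · exact ⟨0, Or.inr hy⟩

theorem uniq' (m : Measure (Tup (k+(e+1)) k))
    (hinv : ∀ γ : SLR (k+(e+1)), Measure.map (act γ) m = m)
    (hLI : m {y | ¬ LinearIndependent ℝ y} = 0)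
    (hfin : ∀ N : ℕ, m (Kset (k+(e+1)) k N) < ⊤) :
    ∃ c : ENNReal, c ≠ ⊤ ∧ m = c • volume := by
  have := sigmaFinite_of m hLI hfin
  have hvfin : ∀ N : ℕ, volume (Kset (k+(e+1)) k N) < ⊤ := fun N =>
    (vol_Kset_lt (k+(e+1)) k N).resolve_right (by omega)
  have i1 := nt_sigma m hfin
  have i2 := nt_sigma (volume : Measure (Tup (k+(e+1)) k)) hvfin
  have i3 := nt_inv m hinv
  have i4 := nt_inv (volume : Measure (Tup (k+(e+1)) k)) map_act_volume
  obtain ⟨N, hN⟩ := nt_vol_pos (k := k) (e := e)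
  have hB := nt_finite m hfin N
  have hB' := nt_finite (volume : Measure (Tup (k+(e+1)) k)) hvfin N
  have key := measure_eq_div_smul (nt m) (nt (volume : Measure (Tup (k+(e+1)) k))) hN hB'.ne
  set c := nt m (Bset k e N) / nt (volume : Measure (Tup (k+(e+1)) k)) (Bset k e N) with hc
  refine ⟨c, ENNReal.div_ne_top hB.ne hN, ?_⟩
  have hmain : ∀ m' : Measure (Tup (k+(e+1)) k), SFinite m' → m' {y | ¬ LinearIndependent ℝ y} = 0 →
      ∀ A, MeasurableSet A → m' A =
        ∫⁻ h, (A.indicator (fun y => (kapp y)⁻¹) (cols0 h)) * psi h ∂(nt m') := by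
    intro m' _ hm' A hA
    have hmm : Measurable (A.indicator (fun y => (kapp (k := k) (e := e) y)⁻¹)) :=
      (measurable_kapp.inv).indicator hA
    rw [lint_nt m' hmm, ← lintegral_indicator_one hA]
    refine lintegral_congr_ae ?_
    have hae : ∀ᵐ y ∂m', LinearIndependent ℝ y := by rw [ae_iff]; exact hm'
    filter_upwards [hae] with y hy
    by_cases h : y ∈ A
    · rw [Set.indicator_of_mem h, Set.indicator_of_mem h,
        ENNReal.inv_mul_cancel (kapp_pos hy).ne' (kapp_lt_top y).ne]
      rfl
    · rw [Set.indicator_of_notMem h, Set.indicator_of_notMem h, zero_mul]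
  have hvLI : (volume : Measure (Tup (k+(e+1)) k)) {y | ¬ LinearIndependent ℝ y} = 0 := by
    have := ae_LI (d := k+(e+1)) (k := k) (by omega)
    rwa [ae_iff] at this
  refine Measure.ext fun A hA => ?_
  rw [hmain m inferInstance hLI A hA, key, lintegral_smul_measure, Measure.smul_apply,
    hmain volume inferInstance hvLI A hA]

theorem uniq {d k : ℕ} (hk : k < d) (m : Measure (Tup d k))
    (hinv : ∀ γ : SLR d, Measure.map (act γ) m = m)
    (hLI : m {y | ¬ LinearIndependent ℝ y} = 0)
    (hfin : ∀ N : ℕ, m (Kset d k N) < ⊤) :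
    ∃ c : ENNReal, c ≠ ⊤ ∧ m = c • volume := by
  obtain ⟨e, rfl⟩ := Nat.exists_eq_add_of_lt hk
  exact uniq' m hinv hLI hfin

end uniq

lemma cv_zsmul {d : ℕ} (n : ℤ) (z : Fin d → ℤ) : cv (n • z) = (n : ℝ) • cv z := by
  funext i; simp [cv_apply]

lemma cv_comb {d k : ℕ} (a : Fin k → ℤ) (v : ZTup d k) :
    cv (∑ i, a i • v i) = ∑ i, (a i : ℝ) • cv (v i) := by
  rw [map_sum]; exact Finset.sum_congr rfl fun i _ => cv_zsmul _ _

def Prim {d k : ℕ} (v : ZTup d k) : Prop :=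
  LinearIndependent ℝ (zc v) ∧ ∀ z : Fin d → ℤ, cv z ∈ Submodule.span ℝ (Set.range (zc v)) →
    ∃ a : Fin k → ℤ, z = ∑ i, a i • v i

lemma zc_snoc {d k : ℕ} (v : ZTup d k) (u : Fin d → ℤ) :
    zc (Fin.snoc v u : ZTup d (k+1)) = (Fin.snoc (zc v) (cv u) : Tup d (k+1)) := by
  funext i
  refine Fin.lastCases ?_ (fun j => ?_) i
  · simp [zc]
  · simp [zc]

lemma sum_snoc {d k : ℕ} (v : Tup d k) (u : Fin d → ℝ) (c : Fin (k+1) → ℝ) :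
    ∑ i, c i • (Fin.snoc v u : Tup d (k+1)) i = ∑ i, c (Fin.castSucc i) • v i + c (Fin.last k) • u := by
  rw [Fin.sum_univ_castSucc]; simp

lemma lemmaP {d k : ℕ} {v : ZTup d k} (hv : Prim v) {u0 : Fin d → ℤ}
    (hu0 : cv u0 ∉ Submodule.span ℝ (Set.range (zc v))) :
    ∃ (u : Fin d → ℤ) (h : ℕ) (a : Fin k → ℕ), Prim (Fin.snoc v u : ZTup d (k+1)) ∧ 1 ≤ h ∧
      (∀ i, a i < h) ∧ u0 = (h : ℤ) • u + ∑ i, (a i : ℤ) • v i := by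
  obtain ⟨f, hf0, hfle⟩ := Submodule.exists_le_ker_of_notMem hu0
  obtain ⟨φ, hφ1, hφv⟩ : ∃ φ : (Fin d → ℝ) →ₗ[ℝ] ℝ, φ (cv u0) = 1 ∧ ∀ i, φ (cv (v i)) = 0 := by
    refine ⟨(f (cv u0))⁻¹ • f, ?_, fun i => ?_⟩
    · simp [hf0]
    · have : cv (v i) ∈ Submodule.span ℝ (Set.range (zc v)) := Submodule.subset_span ⟨i, rfl⟩
      have := hfle this
      rw [LinearMap.mem_ker] at this
      simp [this]
  have hφs : ∀ q : Fin k → ℝ, φ (∑ i, q i • cv (v i)) = 0 := by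
    intro q; simp [map_sum, hφv]
  let W : (Fin d → ℤ) → Prop := fun z => ∃ q : Fin k → ℝ,
    cv z = ∑ i, q i • cv (v i) + φ (cv z) • cv u0
  let F : Set (Fin d → ℤ) := {z | (∃ q : Fin k → ℝ, (∀ i, 0 ≤ q i ∧ q i < 1) ∧
    cv z = ∑ i, q i • cv (v i) + φ (cv z) • cv u0) ∧ 0 < φ (cv z) ∧ φ (cv z) ≤ 1}
  have hFfin : F.Finite := by
    let B : Fin d → ℤ := fun l => ∑ i, |v i l| + |u0 l|
    refine (Set.finite_Icc (-B) B).subset ?_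
    rintro z ⟨⟨q, hq, hz⟩, ht0, ht1⟩
    have hb : ∀ l, |z l| ≤ B l := by
      intro l
      have h1 : (z l : ℝ) = ∑ i, q i * (v i l : ℝ) + φ (cv z) * (u0 l : ℝ) := by
        have := congrFun hz l
        simpa [cv_apply] using this
      have h2 : |(z l : ℝ)| ≤ (B l : ℝ) := by
        rw [h1]
        refine (abs_add_le _ _).trans ?_
        simp only [B]
        push_cast
        refine add_le_add ((Finset.abs_sum_le_sum_abs _ _).trans (Finset.sum_le_sum fun i _ => ?_)) ?_
        · rw [abs_mul, abs_of_nonneg (hq i).1]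
          exact mul_le_of_le_one_left (abs_nonneg _) (hq i).2.le
        · rw [abs_mul, abs_of_pos ht0]
          exact mul_le_of_le_one_left (abs_nonneg _) ht1
      exact_mod_cast h2
    exact ⟨fun l => (abs_le.1 (hb l)).1, fun l => (abs_le.1 (hb l)).2⟩
  have hFne : F.Nonempty := ⟨u0, ⟨fun _ => 0, by simp, by simp [hφ1]⟩, by simp [hφ1], by simp [hφ1]⟩
  obtain ⟨u, huF, hmin⟩ := Set.exists_min_image F (fun z => φ (cv z)) hFfin hFne
  set t0 := φ (cv u) with ht0
  have hmin' : ∀ z, W z → 0 < φ (cv z) → φ (cv z) ≤ 1 → t0 ≤ φ (cv z) := by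
    rintro z ⟨q, hq⟩ h1 h2
    have e1 : cv (z - ∑ i, ⌊q i⌋ • v i) = ∑ i, Int.fract (q i) • cv (v i) + φ (cv z) • cv u0 := by
      rw [map_sub, cv_comb]
      conv_lhs => rw [hq]
      rw [add_sub_right_comm, ← Finset.sum_sub_distrib]
      congr 1
      refine Finset.sum_congr rfl fun i _ => ?_
      rw [← sub_smul]; rfl
    have e2 : φ (cv (z - ∑ i, ⌊q i⌋ • v i)) = φ (cv z) := by
      rw [map_sub, cv_comb, map_sub, hφs, sub_zero]
    have := hmin (z - ∑ i, ⌊q i⌋ • v i) ⟨⟨fun i => Int.fract (q i),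
      fun i => ⟨Int.fract_nonneg _, Int.fract_lt_one _⟩, by rw [e2]; exact e1⟩, by rwa [e2], by rwa [e2]⟩
    rwa [e2] at this
  have ht0p : 0 < t0 := huF.2.1
  have ht01 : t0 ≤ 1 := huF.2.2
  have claim : ∀ u' : Fin d → ℤ, W u' → φ (cv u') = t0 → Prim (Fin.snoc v u' : ZTup d (k+1)) := by
    rintro u' ⟨q', hq'⟩ hu'
    refine ⟨?_, ?_⟩
    · rw [zc_snoc]
      refine linearIndependent_finSnoc.2 ⟨hv.1, fun hmem => ?_⟩
      have : φ (cv u') = 0 := by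
        obtain ⟨c, hc⟩ := (Submodule.mem_span_range_iff_exists_fun ℝ).1 hmem
        rw [← hc]; exact hφs c
      rw [hu'] at this; exact ht0p.ne' this
    · intro z hz
      rw [zc_snoc] at hz
      obtain ⟨c, hc⟩ := (Submodule.mem_span_range_iff_exists_fun ℝ).1 hz
      rw [sum_snoc] at hc
      set s := c (Fin.last k) with hs
      have e1 : cv (z - ⌊s⌋ • u') = ∑ i, c (Fin.castSucc i) • cv (v i) + Int.fract s • cv u' := by
        rw [map_sub, cv_zsmul, ← hc, add_sub_assoc, ← sub_smul]; rfl
      have e2 : φ (cv (z - ⌊s⌋ • u')) = Int.fract s * t0 := by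
        rw [e1, map_add, hφs, zero_add, map_smul, hu', smul_eq_mul]
      have hfr : Int.fract s = 0 := by
        by_contra hne
        have hpos : 0 < Int.fract s := lt_of_le_of_ne (Int.fract_nonneg _) (Ne.symm hne)
        have hlt := Int.fract_lt_one s
        have hW : W (z - ⌊s⌋ • u') := by
          refine ⟨fun i => c (Fin.castSucc i) + Int.fract s * q' i, ?_⟩
          rw [e2, e1]
          conv_lhs => rw [hq', hu']
          simp only [smul_add, add_smul, Finset.sum_add_distrib, Finset.smul_sum, smul_smul]
          abel
        have := hmin' _ hW (by rw [e2]; positivity) (by rw [e2]; nlinarith)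
        rw [e2] at this
        nlinarith
      rw [hfr, zero_smul, add_zero] at e1
      obtain ⟨a, ha⟩ := hv.2 _ ((Submodule.mem_span_range_iff_exists_fun ℝ).2 ⟨_, e1.symm⟩)
      refine ⟨Fin.snoc a ⌊s⌋, ?_⟩
      rw [Fin.sum_univ_castSucc]
      simp only [Fin.snoc_castSucc, Fin.snoc_last]
      rw [← ha]; abel
  obtain ⟨⟨q, -, hq⟩, -, -⟩ := huF
  have hWu : W u := ⟨q, hq⟩
  have hPu := claim u hWu rfl
  have hu0mem : cv u0 ∈ Submodule.span ℝ (Set.range (zc (Fin.snoc v u : ZTup d (k+1)))) := by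
    rw [zc_snoc]
    refine (Submodule.mem_span_range_iff_exists_fun ℝ).2 ⟨Fin.snoc (fun i => -(t0⁻¹ * q i)) t0⁻¹, ?_⟩
    rw [sum_snoc]
    simp only [Fin.snoc_castSucc, Fin.snoc_last]
    rw [hq]
    simp only [smul_add, Finset.smul_sum, smul_smul, neg_smul, Finset.sum_neg_distrib]
    rw [← ht0, inv_mul_cancel₀ ht0p.ne', one_smul]
    simp [zc]
  obtain ⟨b, hb⟩ := hPu.2 u0 hu0mem
  rw [Fin.sum_univ_castSucc] at hb
  simp only [Fin.snoc_castSucc, Fin.snoc_last] at hb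
  set h := b (Fin.last k) with hh
  have hht : (h : ℝ) * t0 = 1 := by
    have := congrArg (fun z => φ (cv z)) hb
    simp only [map_add, cv_comb, hφs, cv_zsmul, map_smul, hφ1] at this
    rw [zero_add, smul_eq_mul] at this
    exact this.symm
  have hhpos : 0 < h := by
    have : (0:ℝ) < h := by
      by_contra hn
      push Not at hn
      nlinarith
    exact_mod_cast this
  let u' := u + ∑ i, (b (Fin.castSucc i) / h) • v i
  refine ⟨u', h.toNat, fun i => (b (Fin.castSucc i) % h).toNat, ?_, ?_, ?_, ?_⟩
  · have e : φ (cv u') = t0 := by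
      simp only [u', map_add, cv_comb, hφs, add_zero]; rfl
    refine claim u' ⟨fun i => q i + ((b (Fin.castSucc i) / h : ℤ) : ℝ), ?_⟩ e
    rw [e]
    simp only [u', map_add, cv_comb, add_smul, Finset.sum_add_distrib]
    conv_lhs => rw [hq]
    abel
  · omega
  · intro i
    have h1 := Int.emod_lt_of_pos (b (Fin.castSucc i)) hhpos
    have h2 := Int.emod_nonneg (b (Fin.castSucc i)) hhpos.ne'
    show (b (Fin.castSucc i) % h).toNat < h.toNat
    omega
  · rw [Int.toNat_of_nonneg hhpos.le]
    have h3 : ∀ i, (((b (Fin.castSucc i) % h).toNat : ℕ) : ℤ) = b (Fin.castSucc i) % h := fun i =>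
      Int.toNat_of_nonneg (Int.emod_nonneg _ hhpos.ne')
    simp only [h3, u', smul_add, Finset.smul_sum, smul_smul]
    rw [hb, add_assoc, ← Finset.sum_add_distrib, add_comm]
    congr 1
    refine Finset.sum_congr rfl fun i _ => ?_
    rw [← add_smul, Int.mul_ediv_add_emod]

lemma mink {d : ℕ} (A : SLR d) (b : Fin d → ℝ) (hb : ∀ i, 0 < b i) (hp : 1 < ∏ i, b i) :
    ∃ z : Fin d → ℤ, z ≠ 0 ∧ ∀ i, |A.1.mulVec (cv z) i| ≤ b i := by
  let s : Set (Fin d → ℝ) := (Matrix.toLin' A.1) ⁻¹' (Set.Icc (-b) b)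
  have hdet : LinearMap.det (Matrix.toLin' A.1) = 1 := by rw [LinearMap.det_toLin', A.2]
  have hvol : volume s = ENNReal.ofReal (2 ^ d * ∏ i, b i) := by
    have := Measure.addHaar_preimage_linearMap (volume : Measure (Fin d → ℝ))
      (f := Matrix.toLin' A.1) (by rw [hdet]; exact one_ne_zero) (Set.Icc (-b) b)
    rw [this, hdet, Real.volume_Icc_pi, ← ENNReal.ofReal_prod_of_nonneg]
    · simp only [Pi.neg_apply, sub_neg_eq_add, ← two_mul]
      rw [Finset.prod_mul_distrib]
      simp
    · intro i _
      have := hb i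
      simp only [Pi.neg_apply]; linarith
  let bs := Pi.basisFun ℝ (Fin d)
  have hfd : volume (ZSpan.fundamentalDomain bs) = 1 := by
    rw [ZSpan.volume_fundamentalDomain]
    have : (Matrix.of (bs : Fin d → Fin d → ℝ)) = 1 := by
      ext i j
      simp [bs, Matrix.one_apply, Pi.single_apply, eq_comm]
    rw [this]; simp
  have hcount : Countable (Submodule.span ℤ (Set.range bs)).toAddSubgroup :=
    inferInstanceAs (Countable (Submodule.span ℤ (Set.range bs)))
  obtain ⟨x, hx0, hx⟩ := exists_ne_zero_mem_lattice_of_measure_mul_two_pow_lt_measure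
    (μ := (volume : Measure (Fin d → ℝ))) (s := s) (ZSpan.isAddFundamentalDomain' bs volume) (by
      intro x hx
      simp only [s, Set.mem_preimage, map_neg] at hx ⊢
      exact ⟨neg_le_neg hx.2, by have := neg_le_neg hx.1; rwa [neg_neg] at this⟩)
      ((convex_Icc _ _).linear_preimage _) (by
        rw [hfd, hvol, one_mul]
        simp only [Module.finrank_fin_fun]
        rw [show (2:ENNReal)^d = ENNReal.ofReal (2^d) by
          rw [ENNReal.ofReal_pow (by norm_num)]; simp]
        refine (ENNReal.ofReal_lt_ofReal_iff (by positivity)).2 ?_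
        have : (0:ℝ) < 2^d := by positivity
        nlinarith)
  have hmem : (x : Fin d → ℝ) ∈ Submodule.span ℤ (Set.range bs) := x.2
  obtain ⟨c, hc⟩ := (Submodule.mem_span_range_iff_exists_fun ℤ).1 hmem
  have hcx : cv c = x := by
    rw [← hc]
    funext i
    simp [bs, cv_apply, Finset.sum_apply, Pi.single_apply]
  refine ⟨c, ?_, fun i => ?_⟩
  · rintro rfl
    apply hx0
    apply Subtype.ext
    rw [← hcx]; simp
  · rw [hcx]
    exact abs_le.2 ⟨hx.1 i, hx.2 i⟩

lemma lemmaExt {d k : ℕ} (hkd : k < d) {v : ZTup d k} (hv : Prim v) (g : SLR d) {N : ℝ}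
    (hN : act g (zc v) ∈ Kset d k N) :
    ∃ u : Fin d → ℤ, Prim (Fin.snoc v u : ZTup d (k+1)) ∧
      ∀ l, |g.1.mulVec (cv u) l| ≤ (d * 2^d + k) * N := by
  obtain ⟨M0, hM1, hM2, hM3⟩ := hN
  have hcol : ∀ i : Fin k, M0.mulVec (Pi.single (Fin.castLE hkd.le i) 1) = g.1.mulVec (cv (v i)) := by
    intro i
    rw [Matrix.mulVec_single_one]
    funext l
    exact hM3 i (Fin.castLE hkd.le i) rfl l
  let M : SLR d := ⟨M0, hM1⟩
  let A : SLR d := M⁻¹ * g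
  have hMA : ∀ x, M0.mulVec (A.1.mulVec x) = g.1.mulVec x := by
    intro x
    have h1 : M * A = g := by simp [A]
    have h2 : M.1 * A.1 = g.1 := by rw [← Matrix.SpecialLinearGroup.coe_mul, h1]
    rw [Matrix.mulVec_mulVec]
    exact congrArg (fun X : Matrix (Fin d) (Fin d) ℝ => X.mulVec x) h2
  have hAv : ∀ i : Fin k, A.1.mulVec (cv (v i)) = Pi.single (Fin.castLE hkd.le i) 1 := by
    intro i
    have h1 : A.1 = (M⁻¹).1 * g.1 := rfl
    have h3 : (M⁻¹).1 * M0 = 1 := by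
      have : (M⁻¹ * M).1 = 1 := by rw [inv_mul_cancel]; rfl
      exact this
    rw [h1, ← Matrix.mulVec_mulVec, ← hcol, Matrix.mulVec_mulVec, h3, Matrix.one_mulVec]
  let L : Fin d := ⟨d-1, by omega⟩
  let b : Fin d → ℝ := Function.update (fun _ => 1/2) L (2^d)
  have hbpos : ∀ i, 0 < b i := by
    intro i
    by_cases h : i = L
    · simp only [b, h, Function.update_self]; positivity
    · simp only [b, Function.update_of_ne h]; positivity
  have hble : ∀ i, b i ≤ 2^d := by
    intro i
    by_cases h : i = L
    · simp only [b, h, Function.update_self]; exact le_rfl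
    · simp only [b, Function.update_of_ne h]
      have : (1:ℝ) ≤ 2^d := one_le_pow₀ (by norm_num)
      linarith
  have hprod : 1 < ∏ i, b i := by
    simp only [b]
    rw [Finset.prod_update_of_mem (Finset.mem_univ _), Finset.prod_const]
    have hc : (Finset.univ \ {L} : Finset (Fin d)).card = d - 1 := by
      rw [Finset.card_sdiff]; simp
    rw [hc]
    obtain ⟨e, rfl⟩ : ∃ e, d = e + 1 := ⟨d-1, by omega⟩
    rw [pow_succ, mul_assoc, mul_comm (2:ℝ), ← mul_assoc, show e + 1 - 1 = e by omega, ← mul_pow]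
    norm_num
  obtain ⟨z, hz0, hz⟩ := mink A b hbpos hprod
  have hnot : cv z ∉ Submodule.span ℝ (Set.range (zc v)) := by
    intro hmem
    obtain ⟨a, ha⟩ := hv.2 z hmem
    have hAz : A.1.mulVec (cv z) = ∑ i, (a i : ℝ) • Pi.single (Fin.castLE hkd.le i) (1:ℝ) := by
      rw [ha, cv_comb, Matrix.mulVec_sum]
      exact Finset.sum_congr rfl fun i _ => by rw [Matrix.mulVec_smul, hAv]
    have ha0 : ∀ i, a i = 0 := by
      intro i
      have h1 := hz (Fin.castLE hkd.le i)
      have h2 : A.1.mulVec (cv z) (Fin.castLE hkd.le i) = a i := by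
        rw [hAz, Finset.sum_apply, Finset.sum_eq_single i]
        · simp
        · intro j _ hj
          have : (Fin.castLE hkd.le i) ≠ Fin.castLE hkd.le j := by
            intro h; exact hj (Fin.castLE_injective hkd.le h).symm
          simp [Pi.single_apply, this]
        · simp
      have h3 : b (Fin.castLE hkd.le i) ≤ 1/2 ∨ (Fin.castLE hkd.le i) = L := by
        by_cases h : Fin.castLE hkd.le i = L
        · exact Or.inr h
        · left; simp only [b, Function.update_of_ne h]; exact le_rfl
      rcases h3 with h3 | h3
      · rw [h2] at h1
        have h4 : |(a i : ℝ)| < 1 := lt_of_le_of_lt (h1.trans h3) (by norm_num)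
        have h5 : |a i| < 1 := by exact_mod_cast h4
        exact Int.abs_lt_one_iff.1 h5
      · exfalso
        have := congrArg Fin.val h3
        have h6 := i.2
        simp [L] at this
        omega
    apply hz0
    rw [ha]; simp [ha0]
  obtain ⟨u, h, a, hPu, hh, hah, hu⟩ := lemmaP hv hnot
  refine ⟨u, hPu, fun l => ?_⟩
  have hN0 : 0 ≤ N := (abs_nonneg _).trans (hM2 L L)
  have hgz : |g.1.mulVec (cv z) l| ≤ d * 2^d * N := by
    rw [← hMA]
    simp only [Matrix.mulVec, dotProduct]
    refine (Finset.abs_sum_le_sum_abs _ _).trans ?_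
    refine (Finset.sum_le_card_nsmul _ _ (2^d * N) fun j _ => ?_).trans ?_
    · rw [abs_mul, mul_comm]
      exact mul_le_mul ((hz j).trans (hble j)) (hM2 l j) (abs_nonneg _) (by positivity)
    · simp [mul_assoc]
  have hgv : ∀ i, |g.1.mulVec (cv (v i)) l| ≤ N := by
    intro i
    have := hM3 i (Fin.castLE hkd.le i) rfl l
    have h2 : g.1.mulVec (cv (v i)) l = M0 l (Fin.castLE hkd.le i) := this.symm
    rw [h2]; exact hM2 _ _
  have heq : (h : ℝ) * g.1.mulVec (cv u) l = g.1.mulVec (cv z) l -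
      ∑ i, (a i : ℝ) * g.1.mulVec (cv (v i)) l := by
    rw [hu, map_add, cv_zsmul, cv_comb, Matrix.mulVec_add, Matrix.mulVec_smul, Matrix.mulVec_sum]
    simp [Matrix.mulVec_smul, Finset.sum_apply]
  have hhr : (1:ℝ) ≤ h := by exact_mod_cast hh
  have hb1 : (h : ℝ) * |g.1.mulVec (cv u) l| ≤ h * ((d * 2^d + k) * N) := by
    rw [← abs_of_nonneg (show (0:ℝ) ≤ h by linarith), ← abs_mul, heq, abs_of_nonneg (show (0:ℝ) ≤ h by linarith)]
    refine (abs_sub _ _).trans ?_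
    have h1 : |∑ i, (a i : ℝ) * g.1.mulVec (cv (v i)) l| ≤ k * (h * N) := by
      refine (Finset.abs_sum_le_sum_abs _ _).trans ?_
      refine (Finset.sum_le_card_nsmul _ _ (h * N) fun j _ => ?_).trans ?_
      · rw [abs_mul, Nat.abs_cast]
        exact mul_le_mul (by exact_mod_cast (hah j).le) (hgv j) (abs_nonneg _) (by positivity)
      · simp
    have h2 : (d * 2^d * N : ℝ) ≤ h * (d * 2^d * N) := le_mul_of_one_le_left (by positivity) hhr
    nlinarith
  exact le_of_mul_le_mul_left hb1 (by linarith)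

lemma act_LI {d k : ℕ} (h : SLR d) {y : Tup d k} :
    LinearIndependent ℝ (act h y) ↔ LinearIndependent ℝ y := by
  have h1 : ∀ (g : SLR d) (z : Tup d k), LinearIndependent ℝ z → LinearIndependent ℝ (act g z) := by
    intro g z hz
    have h2 : act g z = (Matrix.toLin' g.1) ∘ z := by
      funext i; simp [act]
    rw [h2]
    refine hz.map' _ (LinearMap.ker_eq_bot.2 ?_)
    intro a b hab
    have h3 : ∀ c : Fin d → ℝ, (g⁻¹).1.mulVec (g.1.mulVec c) = c := by
      intro c
      have h4 : (g⁻¹).1 * g.1 = 1 := by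
        have : (g⁻¹ * g).1 = 1 := by rw [inv_mul_cancel]; rfl
        exact this
      rw [Matrix.mulVec_mulVec, h4, Matrix.one_mulVec]
    rw [Matrix.toLin'_apply, Matrix.toLin'_apply] at hab
    rw [← h3 a, hab, h3]
  refine ⟨fun h2 => ?_, h1 h y⟩
  have := h1 h⁻¹ _ h2
  rwa [act_inv_act] at this

lemma zact_LI {d k : ℕ} (γ : Matrix.SpecialLinearGroup (Fin d) ℤ) {v : ZTup d k} :
    LinearIndependent ℝ (zc (zact γ v)) ↔ LinearIndependent ℝ (zc v) := by
  rw [zc_zact, act_LI]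

lemma mS_LI {d k : ℕ} (μ : Measure (Xspace d)) {S : Set (ZTup d k)} (hS : GInv S)
    (hLI : ∀ v ∈ S, LinearIndependent ℝ (zc v)) :
    mS μ S {y | ¬ LinearIndependent ℝ y} = 0 := by
  have hm : MeasurableSet {y : Tup d k | ¬ LinearIndependent ℝ y} := (measurableSet_LI d k).compl
  rw [mS_apply μ hS hm]
  have : ∀ h : SLR d, sieg S (Set.indicator {y | ¬ LinearIndependent ℝ y} 1) h = 0 := by
    intro h
    unfold sieg
    rw [ENNReal.tsum_eq_zero]
    intro v
    rw [Set.indicator_of_notMem]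
    intro h1
    exact h1 (act_LI h |>.2 (hLI v.1 v.2))
  exact (lintegral_congr fun x => this _).trans lintegral_zero

lemma mS_uniq {d k : ℕ} (hk : k < d) {μ : Measure (Xspace d)} (hμ : XInv μ) {S : Set (ZTup d k)}
    (hS : GInv S) (hLI : ∀ v ∈ S, LinearIndependent ℝ (zc v))
    (hfin : ∀ N : ℕ, mS μ S (Kset d k N) < ⊤) : ∃ c : ENNReal, c ≠ ⊤ ∧ mS μ S = c • volume :=
  uniq hk _ (map_act_mS hμ hS) (mS_LI μ hS hLI) hfin

lemma mS_cover {d k : ℕ} {ι : Type*} [Countable ι] {r : ι → ℕ} (μ : Measure (Xspace d))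
    {S : Set (ZTup d k)} (hS : GInv S)
    {S' : ∀ i, Set (ZTup d (r i))} (hS' : ∀ i, GInv (S' i))
    {A : Set (Tup d k)} (hA : MeasurableSet A)
    {A' : ∀ i, Set (Tup d (r i))} (hA' : ∀ i, MeasurableSet (A' i))
    (R : ∀ i, ZTup d (r i) → ZTup d k)
    (hc : ∀ h : SLR d, ∀ v ∈ S, act h (zc v) ∈ A → ∃ i, ∃ w ∈ S' i, R i w = v ∧
        act h (zc w) ∈ A' i) :
    mS μ S A ≤ ∑' i, mS μ (S' i) (A' i) := by
  rw [mS_apply μ hS hA]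
  have h1 : ∀ i, mS μ (S' i) (A' i) =
      ∫⁻ x, sieg (S' i) ((A' i).indicator 1) (Quotient.out x) ∂μ := fun i => mS_apply μ (hS' i) (hA' i)
  simp_rw [h1]
  rw [← lintegral_tsum fun i => (measurable_sieg_out (hS' i) (measurable_one.indicator (hA' i))).aemeasurable]
  refine lintegral_mono fun x => ?_
  refine sieg_cover S S' _ (fun i => (A' i).indicator 1) _ R ?_
  intro v hv hne
  have hmem : act (Quotient.out x) (zc v) ∈ A := by
    by_contra hn
    exact hne (Set.indicator_of_notMem hn _)
  obtain ⟨i, w, hw, h2, h3⟩ := hc _ v hv hmem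
  refine ⟨i, w, hw, h2, ?_⟩
  rw [Set.indicator_of_mem hmem, Set.indicator_of_mem h3]
  rfl

lemma sieg_le_card {d k : ℕ} {ι : Type*} [Fintype ι] (S : Set (ZTup d k)) (A : Set (Tup d k))
    (h : SLR d) (F : ZTup d k → ι)
    (hF : Set.InjOn F {v | v ∈ S ∧ act h (zc v) ∈ A}) :
    sieg S (A.indicator 1) h ≤ Fintype.card ι := by
  classical
  unfold sieg
  rw [ENNReal.tsum_eq_iSup_sum]
  refine iSup_le fun s => ?_
  have h1 : ∑ v ∈ s, A.indicator 1 (act h (zc v.1)) =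
      (((s.filter fun v => act h (zc v.1) ∈ A).card : ℕ) : ENNReal) := by
    rw [Finset.card_filter, Nat.cast_sum]
    refine Finset.sum_congr rfl fun v _ => ?_
    by_cases hv : act h (zc v.1) ∈ A <;> simp [hv]
  rw [h1]
  norm_cast
  rw [← Finset.card_univ]
  refine Finset.card_le_card_of_injOn (fun v => F v.1) (fun _ _ => by simp) ?_
  intro v hv w hw hvw
  simp only [Finset.coe_filter, Set.mem_ofPred_eq] at hv hw
  exact Subtype.ext (hF ⟨v.2, hv.2⟩ ⟨w.2, hw.2⟩ hvw)

def PS (d k : ℕ) : Set (ZTup d k) := {v | Prim v}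

lemma PS_inv (d k : ℕ) : GInv (PS d k) := by
  intro γ v hv
  refine ⟨(zact_LI γ).2 hv.1, fun z hz => ?_⟩
  obtain ⟨c, hc⟩ := (Submodule.mem_span_range_iff_exists_fun ℝ).1 hz
  have h1 : ∀ x : Fin d → ℤ, (γ⁻¹).1.mulVec (γ.1.mulVec x) = x := by
    intro x
    have h4 : (γ⁻¹).1 * γ.1 = 1 := by
      have : (γ⁻¹ * γ).1 = 1 := by rw [inv_mul_cancel]; rfl
      exact this
    rw [Matrix.mulVec_mulVec, h4, Matrix.one_mulVec]
  have h1' : ∀ x : Fin d → ℤ, γ.1.mulVec ((γ⁻¹).1.mulVec x) = x := by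
    intro x
    have h4 : γ.1 * (γ⁻¹).1 = 1 := by
      have : (γ * γ⁻¹).1 = 1 := by rw [mul_inv_cancel]; rfl
      exact this
    rw [Matrix.mulVec_mulVec, h4, Matrix.one_mulVec]
  have h2 : cv ((γ⁻¹).1.mulVec z) ∈ Submodule.span ℝ (Set.range (zc v)) := by
    refine (Submodule.mem_span_range_iff_exists_fun ℝ).2 ⟨c, ?_⟩
    rw [cv_mulVec, ← hc, Matrix.mulVec_sum]
    refine Finset.sum_congr rfl fun i _ => ?_
    rw [Matrix.mulVec_smul]
    congr 1
    have : zc (zact γ v) i = cv (γ.1.mulVec (v i)) := rfl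
    rw [this, ← cv_mulVec, h1]
    rfl
  obtain ⟨a, ha⟩ := hv.2 _ h2
  refine ⟨a, ?_⟩
  rw [← h1' z, ha, Matrix.mulVec_sum]
  exact Finset.sum_congr rfl fun i _ => by rw [Matrix.mulVec_smul]; rfl

def box (d k : ℕ) (R : ℝ) : Set (Tup d k) := {y | ∀ i l, |y i l| ≤ R}

lemma measurableSet_box (d k : ℕ) (R : ℝ) : MeasurableSet (box d k R) := by
  have : IsClosed (box d k R) := by
    have h : box d k R = ⋂ i, ⋂ l, {y : Tup d k | |y i l| ≤ R} := by ext; simp [box]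
    rw [h]
    exact isClosed_iInter fun i => isClosed_iInter fun l =>
      isClosed_le (by fun_prop) continuous_const
  exact this.measurableSet

lemma vol_box_lt (d k : ℕ) (R : ℝ) : volume (box d k R) < ⊤ := by
  refine lt_of_le_of_lt (measure_mono ?_)
    (measure_closedBall_lt_top (x := (0 : Tup d k)) (r := |R|))
  intro y hy
  rw [mem_closedBall_zero_iff]
  refine (pi_norm_le_iff_of_nonneg (abs_nonneg _)).2 fun i => ?_
  refine (pi_norm_le_iff_of_nonneg (abs_nonneg _)).2 fun l => ?_
  exact (hy i l).trans (le_abs_self _)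

lemma adj_bound (d : ℕ) (R : ℝ) : ∃ B : ℝ, 0 ≤ B ∧ ∀ X : Matrix (Fin d) (Fin d) ℝ,
    (∀ i j, |X i j| ≤ R) → ∀ i j, |X.adjugate i j| ≤ B := by
  have hc : IsCompact {X : Matrix (Fin d) (Fin d) ℝ | ∀ i j, |X i j| ≤ R} := by
    have h1 : IsCompact (Set.univ.pi fun _ : Fin d => Set.univ.pi fun _ : Fin d => Set.Icc (-R) R) :=
      isCompact_univ_pi fun _ => isCompact_univ_pi fun _ => isCompact_Icc
    have h4 : {M : Matrix (Fin d) (Fin d) ℝ | (∀ i j, |M i j| ≤ R)} =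
        (Set.univ.pi fun _ : Fin d => Set.univ.pi fun _ : Fin d => Set.Icc (-R) R) := by
      apply Set.ext
      intro M
      constructor
      · intro hb i _ j _
        exact abs_le.1 (hb i j)
      · intro ha i j
        exact abs_le.2 (ha i trivial j trivial)
    rw [h4]; exact h1
  have hcont : ContinuousOn (fun X : Matrix (Fin d) (Fin d) ℝ => ∑ i, ∑ j, |X.adjugate i j|)
      {X : Matrix (Fin d) (Fin d) ℝ | ∀ i j, |X i j| ≤ R} := by
    refine Continuous.continuousOn ?_
    refine continuous_finsetSum _ fun i _ => continuous_finsetSum _ fun j _ => ?_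
    exact (continuous_id.matrix_adjugate.matrix_elem i j).abs
  obtain ⟨B, hB⟩ := hc.bddAbove_image hcont
  refine ⟨|B|, abs_nonneg _, fun X hX i j => ?_⟩
  have h1 := hB ⟨X, hX, rfl⟩
  refine le_trans ?_ (h1.trans (le_abs_self _))
  have h1 : |X.adjugate i j| ≤ ∑ j, |X.adjugate i j| :=
    Finset.single_le_sum (f := fun j => |X.adjugate i j|) (fun _ _ => abs_nonneg _) (Finset.mem_univ j)
  exact h1.trans (Finset.single_le_sum (f := fun i => ∑ j, |X.adjugate i j|)
    (fun _ _ => Finset.sum_nonneg fun _ _ => abs_nonneg _) (Finset.mem_univ i))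

lemma PS_top_count (d : ℕ) (R : ℝ) (hR : 0 ≤ R) :
    ∃ C : ℕ, ∀ h : SLR d, sieg (PS d d) ((box d d R).indicator 1) h ≤ C := by
  classical
  obtain ⟨B, hB0, hB⟩ := adj_bound d R
  obtain ⟨K, hK⟩ := exists_nat_ge (d * (B * R))
  let ι := Fin d → Fin d → Finset.Icc (-(K:ℤ)) K
  refine ⟨Fintype.card ι, fun h => ?_⟩
  by_cases hex : ∃ v0, v0 ∈ PS d d ∧ act h (zc v0) ∈ box d d R
  swap
  · refine sieg_le_card (ι := ι) _ _ _ (fun _ _ _ => ⟨0, by simp⟩) ?_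
    intro v hv
    exact absurd ⟨v, hv⟩ hex
  obtain ⟨v0, hv0, hb0⟩ := hex
  have hspan : ∀ z : Fin d → ℤ, ∃ a : Fin d → ℤ, z = ∑ i, a i • v0 i := by
    intro z
    refine hv0.2 z ?_
    have := hv0.1.span_eq_top_of_card_eq_finrank' (by simp)
    rw [this]; trivial
  choose α hα using hspan
  have hbound : ∀ z : Fin d → ℤ, (∀ l, |h.1.mulVec (cv z) l| ≤ R) → ∀ i, |α z i| ≤ K := by
    intro z hz i
    let X : Matrix (Fin d) (Fin d) ℝ := fun l i => h.1.mulVec (cv (v0 i)) l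
    let V : Matrix (Fin d) (Fin d) ℤ := fun l i => v0 i l
    have hXV : X = h.1 * V.map (Int.castRingHom ℝ) := by
      ext l i; rfl
    have hdet : X.det = ((V.det : ℤ) : ℝ) := by
      rw [hXV, Matrix.det_mul, h.2, one_mul]
      exact ((Int.castRingHom ℝ).map_det V).symm
    have hne : V.det ≠ 0 := by
      have h1 : LinearIndependent ℝ (V.map (Int.castRingHom ℝ)).col := hv0.1
      rw [Matrix.linearIndependent_cols_iff_isUnit, Matrix.isUnit_iff_isUnit_det] at h1
      have h2 := h1.ne_zero
      intro h3
      apply h2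
      have h4 := (Int.castRingHom ℝ).map_det V
      rw [h3] at h4
      simp only [map_zero] at h4
      exact h4.symm
    have hX1 : 1 ≤ |X.det| := by
      rw [hdet]; exact_mod_cast Int.one_le_abs hne
    have hmul : X.mulVec (cv (α z)) = h.1.mulVec (cv z) := by
      conv_rhs => rw [hα z]
      rw [cv_comb, Matrix.mulVec_sum]
      funext l
      simp only [Matrix.mulVec_smul, Finset.sum_apply, Pi.smul_apply, smul_eq_mul]
      simp only [Matrix.mulVec, dotProduct, X, cv_apply]
      exact Finset.sum_congr rfl fun i _ => mul_comm _ _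
    have hadj : X.det * (α z i : ℝ) = X.adjugate.mulVec (h.1.mulVec (cv z)) i := by
      rw [← hmul, Matrix.mulVec_mulVec, Matrix.adjugate_mul, Matrix.smul_mulVec, Matrix.one_mulVec]
      rfl
    have hle : |X.adjugate.mulVec (h.1.mulVec (cv z)) i| ≤ d * (B * R) := by
      simp only [Matrix.mulVec, dotProduct]
      refine (Finset.abs_sum_le_sum_abs _ _).trans ?_
      refine (Finset.sum_le_card_nsmul _ _ (B * R) fun j _ => ?_).trans ?_
      · rw [abs_mul]
        exact mul_le_mul (hB X (fun i j => hb0 j i) _ _) (hz j) (abs_nonneg _) hB0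
      · simp
    rw [← hadj, abs_mul] at hle
    have : |(α z i : ℝ)| ≤ K := by
      refine le_trans ?_ (hle.trans hK)
      exact le_mul_of_one_le_left (abs_nonneg _) hX1
    exact_mod_cast this
  let F : ZTup d d → ι := fun v => if hv : act h (zc v) ∈ box d d R then
    fun j i => ⟨α (v j) i, by
      have := hbound (v j) (hv j) i
      rw [Finset.mem_Icc]; exact abs_le.1 this⟩ else fun _ _ => ⟨0, by simp⟩
  refine sieg_le_card (ι := ι) _ _ _ F ?_
  rintro v ⟨-, hv⟩ w ⟨-, hw⟩ hvw
  simp only [F, dif_pos hv, dif_pos hw] at hvw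
  funext j
  rw [hα (v j), hα (w j)]
  refine Finset.sum_congr rfl fun i _ => ?_
  have := congrArg Subtype.val (congrFun (congrFun hvw j) i)
  simp only at this
  rw [this]

lemma PS_step {d k : ℕ} (hkd : k < d) (μ : Measure (Xspace d))
    (hbox : ∀ R : ℝ, 0 ≤ R → mS μ (PS d (k+1)) (box d (k+1) R) < ⊤) (N : ℕ) :
    mS μ (PS d k) (Kset d k N) < ⊤ := by
  have h := mS_cover (ι := Unit) (r := fun _ => k+1) μ (PS_inv d k) (fun _ => PS_inv d (k+1))
    (measurableSet_Kset hkd.le N) (fun _ => measurableSet_box d (k+1) ((d * 2^d + k + 1) * N))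
    (fun _ w => Fin.init w) (by
      intro h v hv hK
      obtain ⟨u, hu, hub⟩ := lemmaExt hkd hv h hK
      refine ⟨(), Fin.snoc v u, hu, Fin.init_snoc _ _, ?_⟩
      rw [zc_snoc]
      intro i
      have hN0 : (0:ℝ) ≤ N := Nat.cast_nonneg _
      refine Fin.lastCases ?_ (fun j => ?_) i
      · intro l
        simp only [act, Fin.snoc_last]
        refine (hub l).trans ?_
        nlinarith
      · intro l
        simp only [act, Fin.snoc_castSucc]
        obtain ⟨M0, hM1, hM2, hM3⟩ := hK
        have := hM3 j (Fin.castLE hkd.le j) rfl l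
        have h2 : h.1.mulVec (zc v j) l = M0 l (Fin.castLE hkd.le j) := this.symm
        rw [h2]
        refine (hM2 _ _).trans ?_
        have : (0:ℝ) ≤ (d * 2^d + k) * N := by positivity
        nlinarith)
  refine lt_of_le_of_lt h ?_
  rw [tsum_fintype]
  simp only [Finset.univ_unique, Finset.sum_singleton]
  exact hbox _ (by positivity)

theorem PS_const {d : ℕ} {μ : Measure (Xspace d)} [IsFiniteMeasure μ] (hμ : XInv μ) {k : ℕ} (hkd : k < d) :
    ∃ c : ENNReal, c ≠ ⊤ ∧ mS μ (PS d k) = c • volume := by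
  obtain ⟨e, rfl⟩ := Nat.exists_eq_add_of_lt hkd
  clear hkd
  suffices H : ∀ e k : ℕ, ∀ d, d = k + e + 1 → ∀ (μ : Measure (Xspace d)) [IsFiniteMeasure μ], XInv μ →
      ∃ c : ENNReal, c ≠ ⊤ ∧ mS μ (PS d k) = c • volume from H e k _ rfl μ hμ
  intro e'
  induction e' with
  | zero =>
    intro k d hd μ _ hμ
    refine mS_uniq (by omega) hμ (PS_inv d k) (fun v hv => hv.1) (PS_step (by omega) μ ?_)
    intro R hR
    obtain rfl : d = k + 1 := by omega
    obtain ⟨C, hC⟩ := PS_top_count (k+1) R hR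
    rw [mS_apply μ (PS_inv _ _) (measurableSet_box _ _ _)]
    refine lt_of_le_of_lt (lintegral_mono fun x => hC _) ?_
    rw [lintegral_const]
    exact ENNReal.mul_lt_top (by simp) (measure_lt_top _ _)
  | succ e' ih =>
    intro k d hd μ _ hμ
    refine mS_uniq (by omega) hμ (PS_inv d k) (fun v hv => hv.1) (PS_step (by omega) μ ?_)
    intro R hR
    obtain ⟨c, hc, he⟩ := ih (k+1) d (by omega) μ hμ
    rw [he, Measure.smul_apply, smul_eq_mul]
    exact ENNReal.mul_lt_top hc.lt_top (vol_box_lt _ _ _)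

lemma tsum_pi_prod (r : ℕ) (f : ℕ → ENNReal) :
    ∑' m : Fin r → ℕ, ∏ j, f (m j) = (∑' n, f n) ^ r := by
  induction r with
  | zero =>
    rw [tsum_fintype]
    simp
  | succ r ih =>
    rw [← (Fin.consEquiv (fun _ : Fin (r+1) => ℕ)).tsum_eq (fun m => ∏ j, f (m j))]
    simp only [Fin.prod_univ_succ, Fin.consEquiv, Equiv.coe_fn_mk, Fin.cons_zero, Fin.cons_succ]
    rw [ENNReal.tsum_prod']
    simp only [ENNReal.tsum_mul_left, ih, ENNReal.tsum_mul_right]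
    rw [pow_succ, mul_comm]

/-- column combination `w · H` -/
def comb {d r : ℕ} (H : Matrix (Fin r) (Fin r) ℝ) : Tup d r →ₗ[ℝ] Tup d r :=
  LinearMap.pi fun j => ∑ i, H i j • LinearMap.proj i

lemma comb_apply {d r : ℕ} (H : Matrix (Fin r) (Fin r) ℝ) (w : Tup d r) (j : Fin r) :
    comb H w j = ∑ i, H i j • w i := by
  simp [comb]

def swapE (d r : ℕ) : Tup d r ≃ₗ[ℝ] (Fin d → Fin r → ℝ) where
  toFun y := fun l i => y i l
  invFun y := fun i l => y l i
  map_add' _ _ := rfl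
  map_smul' _ _ := rfl
  left_inv _ := rfl
  right_inv _ := rfl

lemma det_comb {d r : ℕ} (H : Matrix (Fin r) (Fin r) ℝ) :
    LinearMap.det (comb (d := d) H) = H.det ^ d := by
  have h : LinearMap.det ((swapE d r).toLinearMap ∘ₗ comb (d := d) H ∘ₗ (swapE d r).symm.toLinearMap)
      = H.det ^ d := by
    have : ((swapE d r).toLinearMap ∘ₗ comb (d := d) H ∘ₗ (swapE d r).symm.toLinearMap) =
        LinearMap.pi fun l => (Matrix.toLin' Hᵀ) ∘ₗ LinearMap.proj l := by
      refine LinearMap.ext fun y => ?_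
      funext l i
      simp [swapE, comb_apply, Matrix.mulVec, dotProduct]
    rw [this, LinearMap.det_pi]
    simp
  rw [← h, LinearMap.det_conj]

lemma comb_act {d r : ℕ} (H : Matrix (Fin r) (Fin r) ℝ) (h : SLR d) (w : Tup d r) :
    comb H (act h w) = act h (comb H w) := by
  funext j
  simp only [comb_apply, act, Matrix.mulVec_sum, Matrix.mulVec_smul]

lemma hermite {d r : ℕ} (u : ZTup d r) (hu : LinearIndependent ℝ (zc u)) :
    ∃ (w : ZTup d r) (H : Matrix (Fin r) (Fin r) ℕ), Prim w ∧ (∀ i j, j < i → H i j = 0) ∧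
      (∀ j, 1 ≤ H j j) ∧ (∀ i j, i < j → H i j < H j j) ∧ ∀ j, u j = ∑ i, (H i j : ℤ) • w i := by
  induction r with
  | zero =>
    refine ⟨u, 0, ⟨hu, ?_⟩, fun i => i.elim0, fun i => i.elim0, fun i => i.elim0, fun i => i.elim0⟩
    intro z hz
    refine ⟨fun i => i.elim0, ?_⟩
    have : Set.range (zc u) = ∅ := Set.range_eq_empty _
    rw [this, Submodule.span_empty, Submodule.mem_bot] at hz
    have h0 : cv z = cv 0 := by rw [hz, map_zero]
    simpa using cv_inj h0
  | succ r ih =>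
    have hsn : u = (Fin.snoc (Fin.init u) (u (Fin.last r)) : ZTup d (r+1)) := (Fin.snoc_init_self u).symm
    have hu2 := hu
    rw [hsn, zc_snoc, linearIndependent_finSnoc] at hu2
    obtain ⟨w, H, hw, h1, h2, h3, h4⟩ := ih (Fin.init u) hu2.1
    have hle : Submodule.span ℝ (Set.range (zc (Fin.init u : ZTup d r))) ≤ Submodule.span ℝ (Set.range (zc w)) := by
      rw [Submodule.span_le]
      rintro _ ⟨j, rfl⟩
      refine (Submodule.mem_span_range_iff_exists_fun ℝ).2 ⟨fun i => (H i j : ℝ), ?_⟩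
      have := congrArg cv (h4 j)
      rw [cv_comb] at this
      show _ = cv (Fin.init u j)
      rw [this]; rfl
    have heq := Submodule.eq_of_le_of_finrank_eq hle (by
      rw [finrank_span_eq_card hu2.1, finrank_span_eq_card hw.1])
    have hni : cv (u (Fin.last r)) ∉ Submodule.span ℝ (Set.range (zc w)) := by
      rw [← heq]; exact hu2.2
    obtain ⟨x, h, a, hP, hh, ha, hx⟩ := lemmaP hw hni
    refine ⟨Fin.snoc w x, fun i j => Fin.lastCases (motive := fun _ => ℕ)
      (Fin.lastCases (motive := fun _ => ℕ) h (fun i => a i) i)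
      (fun j => Fin.lastCases (motive := fun _ => ℕ) 0 (fun i => H i j) i) j, hP, ?_, ?_, ?_, ?_⟩
    · intro i j
      refine Fin.lastCases ?_ (fun j => ?_) j <;> refine Fin.lastCases ?_ (fun i => ?_) i
      · intro h; exact absurd h (lt_irrefl _)
      · intro h; exact absurd h (not_lt.2 (Fin.le_last _))
      · simp
      · intro h; simpa using h1 i j (by simpa using h)
    · intro j
      refine Fin.lastCases ?_ (fun j => ?_) j
      · simpa using hh
      · simpa using h2 j
    · intro i j
      refine Fin.lastCases ?_ (fun j => ?_) j <;> refine Fin.lastCases ?_ (fun i => ?_) i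
      · intro h; exact absurd h (lt_irrefl _)
      · intro h; simpa using ha i
      · intro h; exact absurd h (not_lt.2 (Fin.le_last _))
      · intro h; simpa using h3 i j (by simpa using h)
    · intro j
      rw [Fin.sum_univ_castSucc]
      refine Fin.lastCases ?_ (fun j => ?_) j
      · simp only [Fin.lastCases_last, Fin.lastCases_castSucc, Fin.snoc_castSucc, Fin.snoc_last]
        rw [hx, add_comm]
      · simp only [Fin.lastCases_last, Fin.lastCases_castSucc, Fin.snoc_castSucc, Fin.snoc_last]
        have := h4 j
        simp only [Fin.init] at this
        rw [this]; simp

/-- integer vectors in the parallelepiped, with their code -/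
def Code {r : ℕ} (H : Matrix (Fin r) (Fin r) ℕ) (t : Fin r → ℕ) (z : Fin r → ℤ) : Prop :=
  ∃ q : Fin r → ℝ, (∀ i, |q i| ≤ 1) ∧ (∀ i, (z i : ℝ) = ∑ j, (H i j : ℝ) * q j) ∧
    ∀ i, (t i : ℤ) = ⌊(H i i : ℝ) * q i + H i i⌋

lemma Code_unique {r : ℕ} {H : Matrix (Fin r) (Fin r) ℕ} (h1 : ∀ i j, j < i → H i j = 0)
    (h2 : ∀ j, 1 ≤ H j j) {t : Fin r → ℕ} {z z' : Fin r → ℤ} (hz : Code H t z) (hz' : Code H t z') :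
    z = z' := by
  obtain ⟨q, hq, hzq, ht⟩ := hz
  obtain ⟨q', hq', hzq', ht'⟩ := hz'
  have key : ∀ n : ℕ, ∀ i : Fin r, r - i.val ≤ n → q i = q' i := by
    intro n
    induction n with
    | zero => intro i hi; omega
    | succ n ih =>
      intro i hi
      have hs : ∑ j, (H i j : ℝ) * q j - ∑ j, (H i j : ℝ) * q' j = (H i i : ℝ) * (q i - q' i) := by
        rw [← Finset.sum_sub_distrib, Finset.sum_eq_single i]
        · ring
        · intro j _ hj
          rcases lt_or_gt_of_ne hj with h | h
          · rw [h1 i j h]; simp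
          · rw [ih j (by have : i.val < j.val := h; omega)]; ring
        · simp
      rw [← hzq, ← hzq'] at hs
      have hf : |(H i i : ℝ) * q i + H i i - ((H i i : ℝ) * q' i + H i i)| < 1 :=
        Int.abs_sub_lt_one_of_floor_eq_floor (by rw [← ht, ← ht'])
      have h3 : |((z i - z' i : ℤ) : ℝ)| < 1 := by
        push_cast
        rw [hs]
        convert hf using 2
        ring
      have h4 : z i - z' i = 0 := by
        rw [← Int.abs_lt_one_iff]; exact_mod_cast h3
      have h5 : (H i i : ℝ) * (q i - q' i) = 0 := by
        rw [← hs]; exact_mod_cast h4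
      have h6 : (H i i : ℝ) ≠ 0 := by
        have := h2 i
        exact_mod_cast (by omega : H i i ≠ 0)
      have := (mul_eq_zero.1 h5).resolve_left h6
      linarith
  have hqq : q = q' := funext fun i => key r i (by omega)
  funext i
  have : (z i : ℝ) = z' i := by rw [hzq, hzq', hqq]
  exact_mod_cast this

lemma Code_exists {r : ℕ} {H : Matrix (Fin r) (Fin r) ℕ} {z : Fin r → ℤ} {q : Fin r → ℝ}
    (hq : ∀ i, |q i| ≤ 1) (hz : ∀ i, (z i : ℝ) = ∑ j, (H i j : ℝ) * q j) :
    ∃ t : Fin r → ℕ, (∀ i, t i < 2 * H i i + 1) ∧ Code H t z := by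
  have h0 : ∀ i, 0 ≤ ⌊(H i i : ℝ) * q i + H i i⌋ := by
    intro i
    apply Int.floor_nonneg.2
    have := (abs_le.1 (hq i)).1
    have h : (0:ℝ) ≤ H i i := Nat.cast_nonneg _
    nlinarith
  refine ⟨fun i => ⌊(H i i : ℝ) * q i + H i i⌋.toNat, fun i => ?_, q, hq, hz, fun i => ?_⟩
  · have : ⌊(H i i : ℝ) * q i + H i i⌋ < 2 * H i i + 1 := by
      rw [Int.floor_lt]
      have := (abs_le.1 (hq i)).2
      have h : (0:ℝ) ≤ H i i := Nat.cast_nonneg _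
      push_cast
      nlinarith
    have := h0 i
    simp only
    omega
  · exact Int.toNat_of_nonneg (h0 i)

def Bary (d k r s : ℕ) : Set (ZTup d k) :=
  {v | ∃ e : Fin r ⊕ Fin s ≃ Fin k, LinearIndependent ℝ (fun i => zc v (e (Sum.inl i))) ∧
    ∀ j, ∃ q : Fin r → ℝ, (∀ i, |q i| ≤ 1) ∧
      zc v (e (Sum.inr j)) = ∑ i, q i • zc v (e (Sum.inl i))}

lemma Bary_inv (d k r s : ℕ) : GInv (Bary d k r s) := by
  rintro γ v ⟨e, h1, h2⟩
  refine ⟨e, ?_, fun j => ?_⟩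
  · rw [zc_zact]
    exact (act_LI (zemb γ)).2 h1
  · obtain ⟨q, hq, h3⟩ := h2 j
    refine ⟨q, hq, ?_⟩
    rw [zc_zact]
    simp only [act]
    rw [h3, Matrix.mulVec_sum]
    exact Finset.sum_congr rfl fun i _ => by rw [Matrix.mulVec_smul]

def Hd {r : ℕ} (m : Fin r → ℕ) (a : ∀ j, Fin r → Fin (m j + 1)) : Matrix (Fin r) (Fin r) ℕ :=
  fun i j => if j < i then 0 else if i = j then m j + 1 else (a j i : ℕ)

lemma Hd_diag {r : ℕ} (m : Fin r → ℕ) (a : ∀ j, Fin r → Fin (m j + 1)) (j : Fin r) :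
    Hd m a j j = m j + 1 := by simp [Hd]

lemma Hd_low {r : ℕ} (m : Fin r → ℕ) (a : ∀ j, Fin r → Fin (m j + 1)) (i j : Fin r) (h : j < i) :
    Hd m a i j = 0 := by simp [Hd, h]

lemma Hd_exists {r : ℕ} (H : Matrix (Fin r) (Fin r) ℕ) (h1 : ∀ i j, j < i → H i j = 0)
    (h2 : ∀ j, 1 ≤ H j j) (h3 : ∀ i j, i < j → H i j < H j j) :
    ∃ m a, H = Hd (r := r) m a := by
  refine ⟨fun j => H j j - 1, fun j i => if h : i < j then ⟨H i j, by
    have := h3 i j h; show H i j < H j j - 1 + 1; omega⟩ else 0, ?_⟩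
  funext i j
  unfold Hd
  rcases lt_trichotomy i j with h | h | h
  · simp [h, h.not_gt, h.ne]
  · subst h
    have := h2 i
    simp only [lt_irrefl, if_false, if_true]; omega
  · simp [h, h1 i j h]

def Hr {r : ℕ} (H : Matrix (Fin r) (Fin r) ℕ) : Matrix (Fin r) (Fin r) ℝ := fun i j => (H i j : ℝ)

lemma det_Hr {r : ℕ} (m : Fin r → ℕ) (a : ∀ j, Fin r → Fin (m j + 1)) :
    (Hr (Hd m a)).det = ∏ j, ((m j : ℝ) + 1) := by
  rw [Matrix.det_of_isUpperTriangular]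
  · refine Finset.prod_congr rfl fun j _ => ?_
    simp [Hr, Hd_diag]
  · intro i j h
    simp only [Hr]
    rw [Hd_low m a i j h]; simp

open Classical in
def zsel {r : ℕ} (H : Matrix (Fin r) (Fin r) ℕ) (t : Fin r → ℕ) : Fin r → ℤ :=
  if h : ∃ z, Code H t z then h.choose else 0

lemma zsel_eq {r : ℕ} {H : Matrix (Fin r) (Fin r) ℕ} (h1 : ∀ i j, j < i → H i j = 0)
    (h2 : ∀ j, 1 ≤ H j j) {t : Fin r → ℕ} {z : Fin r → ℤ} (hz : Code H t z) : zsel H t = z := by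
  have h : ∃ z, Code H t z := ⟨z, hz⟩
  unfold zsel
  rw [dif_pos h]
  exact Code_unique h1 h2 h.choose_spec hz

abbrev BIx (k r s : ℕ) := (Fin r ⊕ Fin s ≃ Fin k) × (Σ m : Fin r → ℕ,
  (∀ j, Fin r → Fin (m j + 1)) × (Fin s → ∀ i, Fin (2 * (m i + 1) + 1)))

def Rmap {d k r s : ℕ} (x : BIx k r s) (w : ZTup d r) : ZTup d k := fun l =>
  Sum.elim (fun j => ∑ i, (Hd x.2.1 x.2.2.1 i j : ℤ) • w i)
    (fun j => ∑ i, zsel (Hd x.2.1 x.2.2.1) (fun i => (x.2.2.2 j i : ℕ)) i • w i) (x.1.symm l)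

lemma vol_comb {d r : ℕ} (m : Fin r → ℕ) (a : ∀ j, Fin r → Fin (m j + 1)) (A : Set (Tup d r)) :
    volume ((comb (Hr (Hd m a))) ⁻¹' A) =
      (∏ j, (((m j + 1 : ℕ) : ENNReal) ^ d)⁻¹) * volume A := by
  have hd : LinearMap.det (comb (d := d) (Hr (Hd m a))) = ∏ j, (((m j : ℝ) + 1) ^ d) := by
    rw [det_comb, det_Hr, Finset.prod_pow]
  have hp : 0 < ∏ j, (((m j : ℝ) + 1) ^ d) := Finset.prod_pos fun j _ => by positivity
  rw [Measure.addHaar_preimage_linearMap _ (by rw [hd]; exact hp.ne'), hd,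
    abs_of_pos (inv_pos.2 hp)]
  congr 1
  rw [← Finset.prod_inv_distrib, ENNReal.ofReal_prod_of_nonneg (fun j _ => by positivity)]
  refine Finset.prod_congr rfl fun j _ => ?_
  rw [ENNReal.ofReal_inv_of_pos (by positivity), ENNReal.ofReal_pow (by positivity)]
  congr 2
  rw [← Nat.cast_succ, ENNReal.ofReal_natCast]

lemma tsum_inv_sq_lt : ∑' n : ℕ, ((((n + 1 : ℕ) : ENNReal)) ^ 2)⁻¹ ≠ ⊤ := by
  have h : Summable (fun n : ℕ => (((n + 1 : ℕ) : ℝ) ^ 2)⁻¹) := by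
    have := (summable_nat_add_iff (f := fun n : ℕ => ((n : ℝ) ^ 2)⁻¹) 1).2
      (Real.summable_nat_pow_inv.2 (by norm_num))
    exact this
  have h2 := h.tsum_ofReal_ne_top
  convert h2 using 3 with n
  rw [ENNReal.ofReal_inv_of_pos (by positivity), ENNReal.ofReal_pow (by positivity), ENNReal.ofReal_natCast]

theorem Bary_bound {d k r s : ℕ} (hk : k = r + s) (hd : k + 2 ≤ d) {μ : Measure (Xspace d)}
    [IsFiniteMeasure μ] (hμ : XInv μ) :
    ∃ C : ENNReal, C ≠ ⊤ ∧ ∀ (S : Set (ZTup d k)), GInv S → S ⊆ Bary d k r s →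
      ∀ (E : Set (Tup d k)) (A : Set (Tup d r)), MeasurableSet E → MeasurableSet A →
      (∀ y ∈ E, ∀ I : Fin r → Fin k, Function.Injective I → (fun i => y (I i)) ∈ A) →
      mS μ S E ≤ C * volume A := by
  obtain ⟨c, hc, hPS⟩ := PS_const hμ (k := r) (by omega : r < d)
  let Z : ENNReal := (∑' n : ℕ, 3 ^ s * ((((n + 1 : ℕ) : ENNReal)) ^ 2)⁻¹) ^ r
  refine ⟨(Fintype.card (Fin r ⊕ Fin s ≃ Fin k)) * (c * Z), ?_, ?_⟩
  · refine ENNReal.mul_ne_top (by simp) (ENNReal.mul_ne_top hc (ENNReal.pow_ne_top ?_))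
    rw [ENNReal.tsum_mul_left]
    exact ENNReal.mul_ne_top (by simp) tsum_inv_sq_lt
  intro S hS hSB E A hE hA hEA
  have hcov := mS_cover (ι := BIx k r s) (r := fun _ => r) μ hS (fun _ => PS_inv d r) hE
    (A' := fun x => (comb (Hr (Hd x.2.1 x.2.2.1))) ⁻¹' A)
    (fun x => (LinearMap.continuous_of_finiteDimensional _).measurable hA)
    (fun x => Rmap x) (by
      intro h v hv hvE
      obtain ⟨e, hLI, hq⟩ := hSB hv
      obtain ⟨w, H, hw, h1, h2, h3, h4⟩ := hermite (fun i => v (e (Sum.inl i))) hLI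
      obtain ⟨m, a, rfl⟩ := Hd_exists H h1 h2 h3
      have hcv : ∀ j, cv (v (e (Sum.inl j))) = comb (Hr (Hd m a)) (zc w) j := by
        intro j
        rw [h4, cv_comb, comb_apply]
        rfl
      choose q hq1 hq2 using hq
      have hz : ∀ j, ∃ z : Fin r → ℤ, v (e (Sum.inr j)) = ∑ i, z i • w i ∧
          ∀ i, (z i : ℝ) = ∑ l, (Hd m a i l : ℝ) * q j l := by
        intro j
        have e1 : cv (v (e (Sum.inr j))) = ∑ i, (∑ l, (Hd m a i l : ℝ) * q j l) • cv (w i) := by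
          have := hq2 j
          simp only [zc] at this
          rw [this]
          simp only [hcv, comb_apply, Finset.smul_sum, Finset.sum_smul, smul_smul]
          rw [Finset.sum_comm]
          refine Finset.sum_congr rfl fun i _ => Finset.sum_congr rfl fun l _ => ?_
          rw [mul_comm]; rfl
        obtain ⟨z, hz⟩ := hw.2 (v (e (Sum.inr j)))
          ((Submodule.mem_span_range_iff_exists_fun ℝ).2 ⟨_, e1.symm⟩)
        refine ⟨z, hz, fun i => ?_⟩
        have e2 : ∑ i, (z i : ℝ) • cv (w i) = ∑ i, (∑ l, (Hd m a i l : ℝ) * q j l) • cv (w i) := by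
          rw [← e1, hz, cv_comb]
        have := Fintype.linearIndependent_iff.1 hw.1
          (fun i => (z i : ℝ) - ∑ l, (Hd m a i l : ℝ) * q j l) (by
            simp only [sub_smul, Finset.sum_sub_distrib]
            exact sub_eq_zero.2 e2) i
        exact sub_eq_zero.1 this
      choose z hz1 hz2 using hz
      choose t ht1 ht2 using fun j => Code_exists (H := Hd m a) (hq1 j) (hz2 j)
      refine ⟨⟨e, m, a, fun j i => ⟨t j i, by have := ht1 j i; rwa [Hd_diag] at this⟩⟩, w, hw, ?_, ?_⟩
      · funext l
        unfold Rmap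
        obtain ⟨x, rfl⟩ := e.surjective l
        simp only [Equiv.symm_apply_apply]
        rcases x with j | j
        · simp only [Sum.elim_inl]
          exact (h4 j).symm
        · simp only [Sum.elim_inr]
          rw [zsel_eq h1 h2 (ht2 j)]
          exact (hz1 j).symm
      · show comb (Hr (Hd m a)) (act h (zc w)) ∈ A
        rw [comb_act]
        have := hEA _ hvE (fun i => e (Sum.inl i)) (fun x y hxy => Sum.inl_injective (e.injective hxy))
        convert this using 1
        funext j
        simp only [act]
        rw [← hcv]; rfl)
  refine hcov.trans ?_
  simp only [hPS, Measure.smul_apply, smul_eq_mul, vol_comb]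
  rw [ENNReal.tsum_prod']
  simp only [ENNReal.tsum_sigma', tsum_fintype, Finset.sum_const,
    Finset.card_univ, nsmul_eq_mul]
  rw [mul_assoc]
  refine mul_le_mul_right ?_ _
  simp only [Z]
  rw [← tsum_pi_prod, mul_assoc, ← ENNReal.tsum_mul_right, ← ENNReal.tsum_mul_left]
  refine ENNReal.tsum_le_tsum fun m => ?_
  rw [Fintype.card_prod, Fintype.card_pi]
  simp only [Fintype.card_pi, Finset.prod_const, Fintype.card_fin, Finset.card_univ]
  have hcomb : (((∏ j, (m j + 1) ^ r) * (∏ i, (2 * (m i + 1) + 1)) ^ s : ℕ) : ENNReal) *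
      (∏ j, (((m j + 1 : ℕ) : ENNReal) ^ d)⁻¹) ≤ ∏ j, (3 ^ s * (((m j + 1 : ℕ) : ENNReal) ^ 2)⁻¹) := by
    rw [← Finset.prod_pow, ← Finset.prod_mul_distrib, Nat.cast_prod, ← Finset.prod_mul_distrib]
    refine Finset.prod_le_prod' fun j _ => ?_
    have hN : ((m j + 1) ^ r * (2 * (m j + 1) + 1) ^ s) * (m j + 1) ^ 2 ≤ 3 ^ s * (m j + 1) ^ d := by
      calc ((m j + 1) ^ r * (2 * (m j + 1) + 1) ^ s) * (m j + 1) ^ 2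
          ≤ ((m j + 1) ^ r * (3 * (m j + 1)) ^ s) * (m j + 1) ^ 2 := by gcongr; omega
        _ = 3 ^ s * (m j + 1) ^ (r + s + 2) := by rw [mul_pow]; ring
        _ ≤ 3 ^ s * (m j + 1) ^ d := by gcongr <;> omega
    have hN' : ((((m j + 1) ^ r * (2 * (m j + 1) + 1) ^ s : ℕ) : ENNReal)) * ((m j + 1 : ℕ) : ENNReal) ^ 2 ≤
        3 ^ s * ((m j + 1 : ℕ) : ENNReal) ^ d := by exact_mod_cast hN
    have hne : ∀ p : ℕ, ((m j + 1 : ℕ) : ENNReal) ^ p ≠ 0 := fun p => pow_ne_zero _ (by simp)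
    have hnt : ∀ p : ℕ, ((m j + 1 : ℕ) : ENNReal) ^ p ≠ ⊤ := fun p => ENNReal.pow_ne_top (by simp)
    rw [← div_eq_mul_inv, ← div_eq_mul_inv, ENNReal.div_le_iff (hne d) (hnt d),
      ENNReal.mul_div_right_comm.symm, ENNReal.le_div_iff_mul_le (Or.inl (hne 2)) (Or.inl (hnt 2))]
    exact hN'
  calc _ = c * ((((∏ j, (m j + 1) ^ r) * (∏ i, (2 * (m i + 1) + 1)) ^ s : ℕ) : ENNReal) *
      (∏ j, (((m j + 1 : ℕ) : ENNReal) ^ d)⁻¹) * volume A) := by ring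
    _ ≤ _ := by gcongr

lemma max_coeff {V : Type*} [AddCommGroup V] [Module ℝ V] {r k : ℕ} (b : Module.Basis (Fin r) ℝ V)
    (v : Fin k → V) (hv : Submodule.span ℝ (Set.range v) = ⊤) :
    ∃ I : Fin r → Fin k, LinearIndependent ℝ (v ∘ I) ∧
      ∀ j, ∃ q : Fin r → ℝ, (∀ i, |q i| ≤ 1) ∧ v j = ∑ i, q i • v (I i) := by
  classical
  have hdim : Module.finrank ℝ V = r := by rw [Module.finrank_eq_card_basis b]; simp
  have : Module.Finite ℝ V := Module.Finite.of_basis b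
  obtain ⟨I0, hI0⟩ : ∃ I0 : Fin r → Fin k, b.det (v ∘ I0) ≠ 0 := by
    by_contra hcon
    push Not at hcon
    have hz : b.det = 0 := by
      obtain ⟨f, hf⟩ : ∃ f : Fin r → Fin k → ℝ, ∀ i, ∑ j, f i j • v j = b i := by
        have : ∀ i, ∃ f : Fin k → ℝ, ∑ j, f j • v j = b i := fun i =>
          (Submodule.mem_span_range_iff_exists_fun ℝ).1 (by rw [hv]; trivial)
        choose f hf using this
        exact ⟨f, hf⟩
      exfalso
      have h1 : b.det b = 1 := b.det_self
      have h2 : b.det (fun i => ∑ j, f i j • v j) = 0 := by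
        have h3 := (b.det).toMultilinearMap.map_sum (fun i j => f i j • v j)
        have h4 : ∀ I : Fin r → Fin k, (b.det).toMultilinearMap (fun i => f i (I i) • v (I i)) = 0 := by
          intro I
          rw [MultilinearMap.map_smul_univ]
          have := hcon I
          have h5 : (b.det).toMultilinearMap (fun i => v (I i)) = 0 := this
          rw [h5, smul_zero]
        simp only [h4, Finset.sum_const_zero] at h3
        exact h3
      have h3 : (fun i => ∑ j, f i j • v j) = b := funext hf
      rw [h3, h1] at h2
      exact one_ne_zero h2
    have h1 : b.det b = 1 := b.det_self
    rw [hz] at h1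
    simp at h1
  obtain ⟨I, -, hI⟩ := Finset.exists_max_image Finset.univ (fun I : Fin r → Fin k => |b.det (v ∘ I)|)
    ⟨I0, Finset.mem_univ _⟩
  have hne : b.det (v ∘ I) ≠ 0 := by
    have := hI I0 (Finset.mem_univ _)
    exact abs_pos.1 (lt_of_lt_of_le (abs_pos.2 hI0) this)
  have hb := (Module.Basis.is_basis_iff_det b (v := v ∘ I)).2 (isUnit_iff_ne_zero.2 hne)
  refine ⟨I, hb.1, fun j => ?_⟩
  obtain ⟨q, hq⟩ := (Submodule.mem_span_range_iff_exists_fun ℝ).1 (by rw [hb.2]; trivial : v j ∈ Submodule.span ℝ (Set.range (v ∘ I)))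
  refine ⟨q, fun i => ?_, hq.symm⟩
  have h1 : b.det (Function.update (v ∘ I) i (v j)) = q i * b.det (v ∘ I) := by
    rw [← hq]
    have h2 := (b.det).toMultilinearMap.map_update_sum Finset.univ i (fun l => q l • (v ∘ I) l) (v ∘ I)
    have h3 : ∀ l, (b.det) (Function.update (v ∘ I) i (q l • (v ∘ I) l)) =
        if l = i then q i * b.det (v ∘ I) else 0 := by
      intro l
      rw [AlternatingMap.map_update_smul]
      by_cases hl : l = i
      · subst hl; rw [Function.update_eq_self, if_pos rfl, smul_eq_mul]
      · rw [if_neg hl, AlternatingMap.map_update_self _ _ (Ne.symm hl), smul_zero]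
    have h4 : ∀ l, (b.det).toMultilinearMap (Function.update (v ∘ I) i (q l • (v ∘ I) l)) =
        if l = i then q i * b.det (v ∘ I) else 0 := h3
    simp only [h4, Finset.sum_ite_eq', Finset.mem_univ, if_true] at h2
    exact h2
  have h2 : Function.update (v ∘ I) i (v j) = v ∘ (Function.update I i j) := by
    rw [Function.comp_update]
  rw [h2] at h1
  have h3 := hI (Function.update I i j) (Finset.mem_univ _)
  rw [h1, abs_mul] at h3
  exact le_of_mul_le_mul_right (by linarith) (abs_pos.2 hne)

lemma Bary_cover {d k : ℕ} (v : ZTup d k) : ∃ r s, k = r + s ∧ v ∈ Bary d k r s := by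
  classical
  let V := Submodule.span ℝ (Set.range (zc v))
  let b := Module.finBasis ℝ V
  let v' : Fin k → V := fun i => ⟨zc v i, Submodule.subset_span ⟨i, rfl⟩⟩
  have hv' : Submodule.span ℝ (Set.range v') = ⊤ := by
    have := Submodule.span_setOfPred_mem_eq_top (R := ℝ) (s := Set.range (zc v))
    rw [← this]
    congr 1
    apply Set.ext
    intro x
    constructor
    · rintro ⟨i, rfl⟩; exact ⟨i, rfl⟩
    · rintro ⟨i, hi⟩; exact ⟨i, Subtype.ext hi⟩
  obtain ⟨I, hI, hq⟩ := max_coeff b v' hv'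
  let r := Module.finrank ℝ V
  have hinj : Function.Injective I := fun x y hxy => hI.injective (by simp only [Function.comp_apply, hxy])
  have hrk : r ≤ k := by simpa using Fintype.card_le_of_injective I hinj
  have hcard : Fintype.card ((Set.range I)ᶜ : Set (Fin k)) = k - r := by
    rw [Fintype.card_compl_set, Set.card_range_of_injective hinj]; simp [r]
  let e : Fin r ⊕ Fin (k - r) ≃ Fin k :=
    (Equiv.sumCongr (Equiv.ofInjective I hinj) (Fintype.equivFinOfCardEq hcard).symm).trans
      (Equiv.Set.sumCompl (Set.range I))
  have he : ∀ i, e (Sum.inl i) = I i := fun i => rfl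
  refine ⟨r, k - r, by omega, e, ?_, fun j => ?_⟩
  · have := hI.map' V.subtype (by simp)
    exact this
  · obtain ⟨q, h1, h2⟩ := hq (e (Sum.inr j))
    refine ⟨q, h1, ?_⟩
    have := congrArg V.subtype h2
    rw [map_sum] at this
    simp only [map_smul] at this
    exact this

lemma Bary_LI {d k r s : ℕ} {v : ZTup d k} (hk : k = r + s) (hv : v ∈ Bary d k r s) (hs : s = 0) :
    LinearIndependent ℝ (zc v) := by
  subst hs
  obtain ⟨e, h, -⟩ := hv
  let e' : Fin r ≃ Fin k := (Equiv.sumEmpty (Fin r) (Fin 0)).symm.trans e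
  have : LinearIndependent ℝ (zc v ∘ e') := h
  exact (linearIndependent_equiv e').1 this

lemma Bary_zero {d k s : ℕ} {v : ZTup d k} (hv : v ∈ Bary d k 0 s) : v = 0 := by
  obtain ⟨e, -, h⟩ := hv
  funext l
  obtain ⟨x, rfl⟩ := e.surjective l
  rcases x with j | j
  · exact j.elim0
  · obtain ⟨q, -, h2⟩ := h j
    have h3 : cv (v (e (Sum.inr j))) = cv 0 := by
      have : cv (v (e (Sum.inr j))) = ∑ i : Fin 0, q i • zc v (e (Sum.inl i)) := h2
      rw [this]; simp
    exact cv_inj h3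

lemma tsum_pi_prod' {α : Type*} (r : ℕ) (f : α → ENNReal) :
    ∑' m : Fin r → α, ∏ j, f (m j) = (∑' n, f n) ^ r := by
  induction r with
  | zero =>
    rw [tsum_fintype]
    simp
  | succ r ih =>
    rw [← (Fin.consEquiv (fun _ : Fin (r+1) => α)).tsum_eq (fun m => ∏ j, f (m j))]
    simp only [Fin.prod_univ_succ, Fin.consEquiv, Equiv.coe_fn_mk, Fin.cons_zero, Fin.cons_succ]
    rw [ENNReal.tsum_prod']
    simp only [ENNReal.tsum_mul_left, ih, ENNReal.tsum_mul_right]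
    rw [pow_succ, mul_comm]

def cube (d : ℕ) (R : ℝ) : Set (Fin d → ℝ) := {x | ∀ l, |x l| ≤ R}

def cset {d : ℕ} (h : SLR d) (R : ℝ) : Set (Fin d → ℤ) := {z | h.1.mulVec (cv z) ∈ cube d R}

lemma SL_inv_mulVec {d : ℕ} (h : SLR d) (x : Fin d → ℝ) :
    (h⁻¹).1.mulVec (h.1.mulVec x) = x := by
  have h4 : (h⁻¹).1 * h.1 = 1 := by
    have : (h⁻¹ * h).1 = 1 := by rw [inv_mul_cancel]; rfl
    exact this
  rw [Matrix.mulVec_mulVec, h4, Matrix.one_mulVec]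

lemma cset_finite {d : ℕ} (h : SLR d) (R : ℝ) : (cset h R).Finite := by
  let B : ℝ := ∑ i, ∑ j, |(h⁻¹).1 i j| * R
  obtain ⟨N, hN⟩ := exists_nat_ge (∑ i, ∑ j, |(h⁻¹).1 i j| * |R|)
  refine (Set.finite_Icc (fun _ : Fin d => -(N:ℤ)) (fun _ => (N:ℤ))).subset ?_
  intro z hz
  have hb : ∀ l, |z l| ≤ (N:ℤ) := by
    intro l
    have h1 : (z l : ℝ) = ∑ j, (h⁻¹).1 l j * (h.1.mulVec (cv z)) j := by
      have := congrFun (SL_inv_mulVec h (cv z)) l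
      rw [← cv_apply z l, ← this]; rfl
    have h2 : |(z l : ℝ)| ≤ N := by
      rw [h1]
      refine (Finset.abs_sum_le_sum_abs _ _).trans (le_trans ?_ hN)
      refine le_trans ?_ (Finset.single_le_sum (f := fun i => ∑ j, |(h⁻¹).1 i j| * |R|)
        (fun i _ => Finset.sum_nonneg fun j _ => by positivity) (Finset.mem_univ l))
      refine Finset.sum_le_sum fun j _ => ?_
      rw [abs_mul]
      exact mul_le_mul_of_nonneg_left ((hz j).trans (le_abs_self _)) (abs_nonneg _)
    exact_mod_cast h2
  exact ⟨fun l => (abs_le.1 (hb l)).1, fun l => (abs_le.1 (hb l)).2⟩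

def Fc {d : ℕ} (h : SLR d) (R : ℝ) : ENNReal := ((cset h R).ncard : ENNReal)

lemma sieg_univ_box {d k : ℕ} (h : SLR d) (R : ℝ) :
    sieg (Set.univ : Set (ZTup d k)) ((box d k R).indicator 1) h = Fc h R ^ k := by
  classical
  have h1 : Fc h R = ∑' z : Fin d → ℤ, (cset h R).indicator (fun _ => (1:ENNReal)) z := by
    unfold Fc
    rw [← tsum_subtype, ENNReal.tsum_set_one, ← (cset_finite h R).cast_ncard_eq]
    simp
  rw [h1, ← tsum_pi_prod']
  unfold sieg
  rw [← (Equiv.Set.univ (ZTup d k)).tsum_eq]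
  refine tsum_congr fun v => ?_
  simp only [Equiv.Set.univ_apply]
  by_cases hv : act h (zc v.1) ∈ box d k R
  · rw [Set.indicator_of_mem hv]
    have : ∀ j, (cset h R).indicator (fun _ => (1:ENNReal)) (v.1 j) = 1 := by
      intro j
      have hj : v.1 j ∈ cset h R := hv j
      exact Set.indicator_of_mem hj _
    simp [this]
  · rw [Set.indicator_of_notMem hv]
    symm
    have : ∃ j, v.1 j ∉ cset h R := by
      by_contra hcon
      push Not at hcon
      exact hv fun j => hcon j
    obtain ⟨j, hj⟩ := this
    exact Finset.prod_eq_zero (Finset.mem_univ j) (Set.indicator_of_notMem hj _)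

lemma Fc_dom {d : ℕ} (h : SLR d) (n : ℕ) (hn : 1 ≤ n) : Fc h n ≤ (3 * n) ^ d * Fc h 1 := by
  classical
  let fl : (Fin d → ℤ) → (Fin d → ℤ) := fun z l => ⌊h.1.mulVec (cv z) l⌋
  have hex : ∀ t : Fin d → ℤ, ∃ z0, (∃ z ∈ cset h n, fl z = t) → (z0 ∈ cset h n ∧ fl z0 = t) := by
    intro t
    by_cases ht : ∃ z ∈ cset h n, fl z = t
    · obtain ⟨z, h1, h2⟩ := ht
      exact ⟨z, fun _ => ⟨h1, h2⟩⟩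
    · exact ⟨0, fun h => absurd h ht⟩
  choose s hs using hex
  let cells : Finset (Fin d → ℤ) := Fintype.piFinset fun _ => Finset.Icc (-(n:ℤ)) n
  have hcells : cells.card = (2 * n + 1) ^ d := by
    simp only [cells, Fintype.card_piFinset, Int.card_Icc, Finset.prod_const, Finset.card_univ, Fintype.card_fin]
    congr 1
    omega
  have key : (cset h n).ncard ≤ (2 * n + 1) ^ d * (cset h 1).ncard := by
    have h1 : (cset h n).ncard ≤ ((cells : Set (Fin d → ℤ)) ×ˢ (cset h 1)).ncard := by
      refine Set.ncard_le_ncard_of_injOn (fun z => (fl z, z - s (fl z))) ?_ ?_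
        ((Finset.finite_toSet cells).prod (cset_finite h 1))
      · intro z hz
        refine ⟨?_, ?_⟩
        · simp only [cells, Fintype.coe_piFinset, Finset.coe_Icc]
          intro l _
          have := abs_le.1 (hz l)
          refine ⟨Int.le_floor.2 (by push_cast; exact this.1), ?_⟩
          have h2 := (Int.floor_le (h.1.mulVec (cv z) l)).trans this.2
          exact_mod_cast h2
        · intro l
          obtain ⟨-, h2⟩ := hs (fl z) ⟨z, hz, rfl⟩
          simp only [map_sub, Matrix.mulVec_sub, Pi.sub_apply]
          exact (Int.abs_sub_lt_one_of_floor_eq_floor (congrFun h2 l).symm).le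
      · intro z _ w _ hzw
        simp only [Prod.mk.injEq] at hzw
        obtain ⟨h1, h2⟩ := hzw
        rw [h1] at h2
        exact sub_left_injective h2
    refine h1.trans ?_
    rw [Set.ncard_prod, Set.ncard_coe_finset, hcells]
  have key2 : (cset h n).ncard ≤ (3 * n) ^ d * (cset h 1).ncard :=
    key.trans (Nat.mul_le_mul_right _ (Nat.pow_le_pow_left (by omega) d))
  unfold Fc
  exact_mod_cast key2

lemma Fc_tendsto {d : ℕ} (h : SLR d) :
    Filter.Tendsto (fun n : ℕ => Fc h n / (n:ENNReal) ^ d) Filter.atTop (nhds (2 ^ d)) := by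
  let L : (Fin d → ℝ) →ₗ[ℝ] (Fin d → ℝ) := Matrix.toLin' h.1
  have hLc : Continuous L := LinearMap.continuous_of_finiteDimensional _
  let s : Set (Fin d → ℝ) := L ⁻¹' (cube d 1)
  have hcube : cube d 1 = Set.Icc (fun _ => (-1:ℝ)) (fun _ => 1) := by
    apply Set.ext
    intro x
    constructor
    · intro hx; exact ⟨fun l => (abs_le.1 (hx l)).1, fun l => (abs_le.1 (hx l)).2⟩
    · intro hx l; exact abs_le.2 ⟨hx.1 l, hx.2 l⟩
  have hcl : IsClosed s := by
    refine IsClosed.preimage hLc ?_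
    rw [hcube]; exact isClosed_Icc
  have hvol : volume s = 2 ^ d := by
    have hdet : LinearMap.det L = 1 := by simp [L]
    rw [Measure.addHaar_preimage_linearMap _ (by rw [hdet]; exact one_ne_zero), hdet, hcube,
      Real.volume_Icc_pi]
    norm_num
  have hbd : Bornology.IsBounded s := by
    have : s ⊆ (Matrix.toLin' (h⁻¹).1) '' (cube d 1) := by
      intro x hx
      refine ⟨L x, hx, ?_⟩
      simp only [L, Matrix.toLin'_apply]
      exact SL_inv_mulVec h x
    refine Bornology.IsBounded.subset ?_ this
    refine IsCompact.isBounded (IsCompact.image ?_ (LinearMap.continuous_of_finiteDimensional _))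
    rw [hcube]; exact isCompact_Icc
  have hconv : Convex ℝ s := by
    refine Convex.linear_preimage ?_ L
    rw [hcube]; exact convex_Icc _ _
  have ht := tendsto_card_div_pow_atTop_volume s hbd hcl.measurableSet (hconv.addHaar_frontier volume)
  have hreal : volume.real s = 2 ^ d := by simp [Measure.real, hvol]
  rw [hreal, Fintype.card_fin] at ht
  have ht2 := ENNReal.tendsto_ofReal ht
  have e2 : ENNReal.ofReal (2 ^ d) = 2 ^ d := by
    rw [ENNReal.ofReal_pow (by norm_num)]; norm_num
  rw [e2] at ht2
  refine Filter.Tendsto.congr' ?_ ht2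
  filter_upwards [Filter.eventually_gt_atTop 0] with n hn
  have hn' : (0:ℝ) < n := by exact_mod_cast hn
  rw [ENNReal.ofReal_div_of_pos (by positivity), ENNReal.ofReal_pow (by positivity),
    ENNReal.ofReal_natCast, ENNReal.ofReal_natCast]
  congr 2
  rw [← Nat.card_coe_set_eq]
  symm
  refine Nat.card_congr (Equiv.ofBijective (fun z : cset h n => ⟨(n:ℝ)⁻¹ • cv z.1, ?_, ?_⟩) ⟨?_, ?_⟩)
  · intro l
    have := z.2 l
    simp only [L, map_smul, Matrix.toLin'_apply, Pi.smul_apply, smul_eq_mul, abs_mul]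
    rw [abs_of_pos (inv_pos.2 hn'), inv_mul_le_iff₀ hn', mul_one]
    exact this
  · refine Set.smul_mem_smul_set ?_
    rw [SetLike.mem_coe, Module.Basis.mem_span_iff_repr_mem]
    intro i
    exact ⟨z.1 i, by simp [cv_apply]⟩
  · intro z w hzw
    have := congrArg Subtype.val hzw
    simp only at this
    have h3 := smul_right_injective _ (inv_ne_zero hn'.ne') this
    exact Subtype.ext (cv_inj h3)
  · rintro ⟨x, hx, y, hy, hyx⟩
    rw [SetLike.mem_coe, Module.Basis.mem_span_iff_repr_mem] at hy
    choose z hz using hy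
    have hzy : cv z = y := by
      funext i
      have := hz i
      simpa [cv_apply] using this
    have hyx' : (n:ℝ)⁻¹ • y = x := hyx
    refine ⟨⟨z, ?_⟩, ?_⟩
    · intro l
      have := hx l
      rw [← hyx'] at this
      simp only [L, map_smul, Matrix.toLin'_apply, Pi.smul_apply, smul_eq_mul, abs_mul] at this
      rw [abs_of_pos (inv_pos.2 hn'), inv_mul_le_iff₀ hn', mul_one] at this
      rw [hzy]; exact this
    · apply Subtype.ext
      simp only
      rw [hzy]; exact hyx'

lemma sieg_union {d k : ℕ} {S1 S2 : Set (ZTup d k)} (h : Disjoint S1 S2) (f : Tup d k → ENNReal)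
    (g : SLR d) : sieg (S1 ∪ S2) f g = sieg S1 f g + sieg S2 f g := by
  unfold sieg
  exact ENNReal.summable.tsum_union_disjoint (f := fun v : ZTup d k => f (act g (zc v))) h ENNReal.summable

lemma GInv_union {d k : ℕ} {S1 S2 : Set (ZTup d k)} (h1 : GInv S1) (h2 : GInv S2) : GInv (S1 ∪ S2) := by
  rintro γ v (h | h)
  · exact Or.inl (h1 γ v h)
  · exact Or.inr (h2 γ v h)

lemma GInv_inter {d k : ℕ} {S1 S2 : Set (ZTup d k)} (h1 : GInv S1) (h2 : GInv S2) : GInv (S1 ∩ S2) := by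
  rintro γ v ⟨h, h'⟩
  exact ⟨h1 γ v h, h2 γ v h'⟩

lemma mS_union {d k : ℕ} (μ : Measure (Xspace d)) {S1 S2 : Set (ZTup d k)} (h1 : GInv S1) (h2 : GInv S2)
    (h : Disjoint S1 S2) {A : Set (Tup d k)} (hA : MeasurableSet A) :
    mS μ (S1 ∪ S2) A = mS μ S1 A + mS μ S2 A := by
  rw [mS_apply μ (GInv_union h1 h2) hA, mS_apply μ h1 hA, mS_apply μ h2 hA,
    ← lintegral_add_left (measurable_sieg_out h1 (measurable_one.indicator hA))]
  exact lintegral_congr fun x => sieg_union h _ _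

def LIS (d k : ℕ) : Set (ZTup d k) := {v | LinearIndependent ℝ (zc v)}

lemma LIS_inv (d k : ℕ) : GInv (LIS d k) := fun γ _ hv => (zact_LI γ).2 hv

lemma LISc_inv (d k : ℕ) : GInv (LIS d k)ᶜ := fun γ _ hv h => hv ((zact_LI γ).1 h)

lemma Dep_bound {d k : ℕ} (hd : k + 2 ≤ d) {μ : Measure (Xspace d)} [IsFiniteMeasure μ] (hμ : XInv μ) :
    ∃ C : ℕ → ENNReal, (∀ r, C r ≠ ⊤) ∧ ∀ (r0 : ℕ) (S : Set (ZTup d k)), GInv S →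
      (∀ v ∈ S, ¬ LinearIndependent ℝ (zc v) ∧ (r0 = 0 ∨ (r0 = 1 ∧ v ≠ 0))) →
      ∀ (E : Set (Tup d k)) (A : ∀ r, Set (Tup d r)), MeasurableSet E → (∀ r, MeasurableSet (A r)) →
      (∀ y ∈ E, ∀ r, ∀ I : Fin r → Fin k, Function.Injective I → (fun i => y (I i)) ∈ A r) →
      mS μ S E ≤ ∑ r ∈ Finset.Ico r0 k, C r * volume (A r) := by
  have hC : ∀ r, ∃ C : ENNReal, C ≠ ⊤ ∧ (r < k → ∀ (S : Set (ZTup d k)), GInv S → S ⊆ Bary d k r (k - r) →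
      ∀ (E : Set (Tup d k)) (A : Set (Tup d r)), MeasurableSet E → MeasurableSet A →
      (∀ y ∈ E, ∀ I : Fin r → Fin k, Function.Injective I → (fun i => y (I i)) ∈ A) →
      mS μ S E ≤ C * volume A) := by
    intro r
    by_cases hr : r < k
    · obtain ⟨C, h1, h2⟩ := Bary_bound (d := d) (k := k) (r := r) (s := k - r) (by omega) hd hμ
      exact ⟨C, h1, fun _ => h2⟩
    · exact ⟨0, by simp, fun h => absurd h hr⟩
  choose C hC1 hC2 using hC
  refine ⟨C, hC1, ?_⟩
  intro r0 S hS hSv E A hE hA hEA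
  have hcov := mS_cover (ι := Finset.Ico r0 k) (r := fun _ => k) μ hS
    (S' := fun r => S ∩ Bary d k r (k - r)) (fun r => GInv_inter hS (Bary_inv _ _ _ _)) hE
    (A' := fun _ => E) (fun _ => hE) (fun _ w => w) (by
      intro h v hv hvE
      obtain ⟨r, s, hrs, hB⟩ := Bary_cover v
      have hs : s = k - r := by omega
      have hr : r < k := by
        by_contra hcon
        exact (hSv v hv).1 (Bary_LI hrs hB (by omega))
      have hr0 : r0 ≤ r := by
        rcases (hSv v hv).2 with h0 | ⟨h0, h1⟩
        · omega
        · have : r ≠ 0 := by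
            rintro rfl
            exact h1 (Bary_zero hB)
          omega
      subst hs
      exact ⟨⟨r, Finset.mem_Ico.2 ⟨hr0, hr⟩⟩, v, ⟨hv, hB⟩, rfl, hvE⟩)
  refine hcov.trans ?_
  rw [tsum_fintype]
  rw [← Finset.sum_coe_sort (Finset.Ico r0 k) (fun r => C r * volume (A r))]
  refine Finset.sum_le_sum fun r _ => ?_
  exact hC2 r.1 (Finset.mem_Ico.1 r.2).2 _ (GInv_inter hS (Bary_inv _ _ _ _)) Set.inter_subset_right E
    (A r) hE (hA r) (fun y hy => hEA y hy r)

lemma LIS_sub (d k : ℕ) : LIS d k ⊆ Bary d k k 0 := by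
  intro v hv
  refine ⟨Equiv.sumEmpty (Fin k) (Fin 0), ?_, fun j => j.elim0⟩
  exact hv

lemma Kset_box {d k : ℕ} (hk : k ≤ d) (N : ℝ) : Kset d k N ⊆ box d k N := by
  rintro y ⟨M0, hM1, hM2, hM3⟩ i l
  have := hM3 i (Fin.castLE hk i) rfl l
  rw [← this]
  exact hM2 _ _

lemma LIS_const {d k : ℕ} (hd : k + 2 ≤ d) {μ : Measure (Xspace d)} [IsFiniteMeasure μ] (hμ : XInv μ) :
    ∃ c : ENNReal, c ≠ ⊤ ∧ mS μ (LIS d k) = c • volume := by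
  refine mS_uniq (by omega) hμ (LIS_inv d k) (fun v hv => hv) fun N => ?_
  obtain ⟨C, hC, hb⟩ := Bary_bound (d := d) (k := k) (r := k) (s := 0) (by omega) hd hμ
  refine lt_of_le_of_lt (hb _ (LIS_inv d k) (LIS_sub d k) (Kset d k N) (box d k N)
    (measurableSet_Kset (by omega) N) (measurableSet_box _ _ _) ?_) (ENNReal.mul_lt_top hC.lt_top (vol_box_lt _ _ _))
  intro y hy I _ i
  exact Kset_box (by omega) N hy (I i)

lemma vol_box {d k : ℕ} (R : ℝ) : volume (box d k R) = ENNReal.ofReal (2 * R) ^ (d * k) := by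
  have h : box d k R = Set.univ.pi fun _ : Fin k => Set.univ.pi fun _ : Fin d => Set.Icc (-R) R := by
    apply Set.ext
    intro y
    constructor
    · intro hy i _ l _
      exact abs_le.1 (hy i l)
    · intro hy i l
      exact abs_le.2 (hy i trivial l trivial)
  rw [h, volume_pi_pi]
  simp only [volume_pi_pi, Real.volume_Icc, Finset.prod_const, Finset.card_univ, Fintype.card_fin]
  rw [← pow_mul]
  congr 2
  ring

theorem LIS_one {d k : ℕ} (hk1 : 1 ≤ k) (hd : k + 2 ≤ d) {μ : Measure (Xspace d)} [IsProbabilityMeasure μ] (hμ : XInv μ) :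
    mS μ (LIS d k) = volume := by
  obtain ⟨c, hc, hcv⟩ := LIS_const (k := k) hd hμ
  obtain ⟨C, hC1, hC2⟩ := Dep_bound (k := k) hd hμ
  have hsplit : ∀ n : ℕ, ∫⁻ x, sieg (Set.univ : Set (ZTup d k)) ((box d k n).indicator 1) (Quotient.out x) ∂μ
      = c * volume (box d k (n:ℝ)) + mS μ (LIS d k)ᶜ (box d k n) := by
    intro n
    have h1 : GInv (Set.univ : Set (ZTup d k)) := fun _ _ _ => trivial
    rw [← mS_apply μ h1 (measurableSet_box _ _ _)]
    have h2 := mS_union μ (LIS_inv d k) (LISc_inv d k) disjoint_compl_right (measurableSet_box d k n)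
    rw [Set.union_compl_self] at h2
    rw [h2, hcv]; rfl
  have hdep : ∀ n : ℕ, mS μ (LIS d k)ᶜ (box d k n) ≤ ∑ r ∈ Finset.Ico 0 k, C r * volume (box d r (n:ℝ)) := by
    intro n
    refine hC2 0 _ (LISc_inv d k) (fun v hv => ⟨hv, Or.inl rfl⟩) _ (fun r => box d r n)
      (measurableSet_box _ _ _) (fun r => measurableSet_box _ _ _) ?_
    intro y hy r I _ i
    exact hy (I i)
  have hfin : ∀ n : ℕ, ∫⁻ x, sieg (Set.univ : Set (ZTup d k)) ((box d k n).indicator 1) (Quotient.out x) ∂μ ≠ ⊤ := by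
    intro n
    rw [hsplit]
    refine ENNReal.add_ne_top.2 ⟨ENNReal.mul_ne_top hc (vol_box_lt _ _ _).ne, ?_⟩
    refine ne_top_of_le_ne_top ?_ (hdep n)
    exact ENNReal.sum_ne_top.2 fun r _ => ENNReal.mul_ne_top (hC1 r) (vol_box_lt _ _ _).ne
  have hbox : ∀ (r n : ℕ), volume (box d r (n:ℝ)) = 2 ^ (d * r) * (n:ENNReal) ^ (d * r) := by
    intro r n
    rw [vol_box, ENNReal.ofReal_mul (by norm_num), ENNReal.ofReal_natCast, mul_pow]
    norm_num
  have hmeas : ∀ n : ℕ, Measurable (fun x : Xspace d =>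
      sieg (Set.univ : Set (ZTup d k)) ((box d k n).indicator 1) (Quotient.out x)) := fun n =>
    measurable_sieg_out (fun _ _ _ => Set.mem_univ _) (measurable_one.indicator (measurableSet_box _ _ _))
  -- limit 1
  have hlim1 : Filter.Tendsto (fun n : ℕ => ∫⁻ x, (sieg (Set.univ : Set (ZTup d k))
      ((box d k ((n+1:ℕ):ℝ)).indicator 1) (Quotient.out x)) / ((n+1:ℕ):ENNReal) ^ (d * k) ∂μ) Filter.atTop
      (nhds (∫⁻ x : Xspace d, (2:ENNReal) ^ (d * k) ∂μ)) := by
    refine tendsto_lintegral_of_dominated_convergence (fun x => 3 ^ (d * k) *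
      sieg (Set.univ : Set (ZTup d k)) ((box d k ((1:ℕ):ℝ)).indicator 1) (Quotient.out x)) ?_ ?_ ?_ ?_
    · intro n
      exact (hmeas (n+1)).div_const _
    · intro n
      refine Filter.Eventually.of_forall fun x => ?_
      simp only [sieg_univ_box]
      have h1 := Fc_dom (Quotient.out x) (n+1) (by omega)
      rw [ENNReal.div_le_iff (pow_ne_zero _ (by simp)) (ENNReal.pow_ne_top (by simp))]
      calc _ ≤ ((3 * ((n+1:ℕ):ENNReal)) ^ d * Fc (Quotient.out x) 1) ^ k := by gcongr
        _ = _ := by rw [mul_pow, ← pow_mul, mul_pow, Nat.cast_one]; ring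
    · rw [lintegral_const_mul _ (hmeas 1)]
      exact ENNReal.mul_ne_top (by simp) (hfin 1)
    · refine Filter.Eventually.of_forall fun x => ?_
      simp only [sieg_univ_box]
      have h1 := (Fc_tendsto (Quotient.out x)).comp (Filter.tendsto_add_atTop_nat 1)
      have h2 := ENNReal.Tendsto.pow (n := k) h1
      rw [← pow_mul] at h2
      refine h2.congr fun n => ?_
      simp only [Function.comp_apply]
      rw [div_eq_mul_inv, mul_pow, ← ENNReal.inv_pow, ← pow_mul, ← div_eq_mul_inv]
  have hne : ∀ n p : ℕ, ((n + 1 : ℕ) : ENNReal) ^ p ≠ 0 := fun n p => pow_ne_zero _ (by simp)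
  have hnt : ∀ n p : ℕ, ((n + 1 : ℕ) : ENNReal) ^ p ≠ ⊤ := fun n p => ENNReal.pow_ne_top (by simp)
  have heq : ∀ n : ℕ, ∫⁻ x, (sieg (Set.univ : Set (ZTup d k))
      ((box d k ((n+1:ℕ):ℝ)).indicator 1) (Quotient.out x)) / ((n+1:ℕ):ENNReal) ^ (d * k) ∂μ =
      c * 2 ^ (d * k) + mS μ (LIS d k)ᶜ (box d k ((n+1:ℕ):ℝ)) / ((n+1:ℕ):ENNReal) ^ (d * k) := by
    intro n
    simp only [div_eq_mul_inv]
    rw [lintegral_mul_const _ (hmeas (n+1)), hsplit, hbox, add_mul]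
    congr 1
    rw [← mul_assoc, mul_assoc _ (((n+1:ℕ):ENNReal) ^ (d * k)), ENNReal.mul_inv_cancel (hne _ _) (hnt _ _), mul_one]
  have hlim2 : Filter.Tendsto (fun n : ℕ => mS μ (LIS d k)ᶜ (box d k ((n+1:ℕ):ℝ)) / ((n+1:ℕ):ENNReal) ^ (d * k))
      Filter.atTop (nhds 0) := by
    let K : ENNReal := ∑ r ∈ Finset.Ico 0 k, C r * 2 ^ (d * r)
    have hK : K ≠ ⊤ := ENNReal.sum_ne_top.2 fun r _ => ENNReal.mul_ne_top (hC1 r) (by simp)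
    have hz : Filter.Tendsto (fun n : ℕ => K * ((n+1:ℕ):ENNReal)⁻¹) Filter.atTop (nhds 0) := by
      have h1 := (ENNReal.tendsto_inv_nat_nhds_zero).comp (Filter.tendsto_add_atTop_nat 1)
      have := ENNReal.Tendsto.const_mul (a := K) h1 (Or.inr hK)
      rw [mul_zero] at this
      exact this
    refine tendsto_of_tendsto_of_tendsto_of_le_of_le tendsto_const_nhds hz (fun _ => bot_le) fun n => ?_
    refine (ENNReal.div_le_div_right (hdep (n+1)) _).trans ?_
    rw [ENNReal.div_le_iff (hne _ _) (hnt _ _)]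
    simp only [K, hbox]
    rw [mul_assoc, Finset.sum_mul]
    refine Finset.sum_le_sum fun r hr => ?_
    rw [mul_assoc]
    refine mul_le_mul_right (mul_le_mul_right ?_ _) _
    have hr' : r + 1 ≤ k := (Finset.mem_Ico.1 hr).2
    have hdk : d * r + 1 ≤ d * k := by
      have : d * (r + 1) ≤ d * k := Nat.mul_le_mul_left _ hr'
      have : d * (r+1) = d * r + d := by ring
      omega
    rw [mul_comm (((n+1:ℕ):ENNReal)⁻¹), ← div_eq_mul_inv, ENNReal.le_div_iff_mul_le (Or.inl (by simp)) (Or.inl (by simp)), ← pow_succ]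
    exact pow_le_pow_right₀ (by simp) hdk
  have hlim3 := (tendsto_const_nhds (x := c * 2 ^ (d * k))).add hlim2
  have huniq := tendsto_nhds_unique (hlim1.congr heq) hlim3
  rw [lintegral_const, measure_univ, mul_one, add_zero] at huniq
  have hc1 : c = 1 := by
    have h2 : (2:ENNReal) ^ (d * k) ≠ 0 := by simp
    have h3 : (2:ENNReal) ^ (d * k) ≠ ⊤ := by simp
    have : (1:ENNReal) * 2 ^ (d*k) = c * 2 ^ (d * k) := by rw [one_mul]; exact huniq
    exact ((ENNReal.mul_left_inj h2 h3).1 this).symm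
  rw [hcv, hc1, one_smul]

lemma gcd_nonneg_int {d : ℕ} (z : Fin d → ℤ) : 0 ≤ Finset.univ.gcd z := by
  rw [← Finset.normalize_gcd]
  exact Int.nonneg_of_normalize_eq_self (by simp)

lemma isPrim_act {d : ℕ} (γ : Matrix.SpecialLinearGroup (Fin d) ℤ) {z : Fin d → ℤ}
    (hz : IsPrimitiveVec z) : IsPrimitiveVec (γ.1.mulVec z) := by
  have h1' : (γ⁻¹).1.mulVec (γ.1.mulVec z) = z := by
    have h4 : (γ⁻¹).1 * γ.1 = 1 := by
      have : (γ⁻¹ * γ).1 = 1 := by rw [inv_mul_cancel]; rfl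
      exact this
    rw [Matrix.mulVec_mulVec, h4, Matrix.one_mulVec]
  refine ⟨fun h0 => hz.1 ?_, ?_⟩
  · rw [← h1', h0, Matrix.mulVec_zero]
  · have hdvd : Finset.univ.gcd (γ.1.mulVec z) ∣ Finset.univ.gcd z := by
      refine Finset.dvd_gcd fun i _ => ?_
      have hz3 : z i = ∑ j, (γ⁻¹).1 i j * (γ.1.mulVec z) j := by
        conv_lhs => rw [← h1']
        rfl
      rw [hz3]
      exact Finset.dvd_sum fun j _ =>
        Dvd.dvd.mul_left (Finset.gcd_dvd (f := γ.1.mulVec z) (Finset.mem_univ j)) _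
    rw [hz.2] at hdvd
    exact Int.eq_one_of_dvd_one (gcd_nonneg_int _) hdvd

def PV (d k : ℕ) : Set (ZTup d k) := {v | ∀ l, IsPrimitiveVec (v l)}

lemma PV_inv (d k : ℕ) : GInv (PV d k) := fun γ _ hv l => isPrim_act γ (hv l)

lemma gcd_smul_prim {d : ℕ} (m : ℕ) {z : Fin d → ℤ} (hz : IsPrimitiveVec z) :
    Finset.univ.gcd (((m+1 : ℕ) : ℤ) • z) = ((m+1 : ℕ) : ℤ) := by
  have : (((m+1 : ℕ) : ℤ) • z) = fun i => ((m+1 : ℕ) : ℤ) * z i := by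
    funext i; simp
  rw [this, Finset.gcd_mul_left, hz.2, mul_one, Int.normalize_of_nonneg (by positivity)]

lemma exists_smul_prim {d : ℕ} {z : Fin d → ℤ} (hz : z ≠ 0) :
    ∃ (m : ℕ) (p : Fin d → ℤ), IsPrimitiveVec p ∧ ((m+1 : ℕ) : ℤ) • p = z := by
  obtain ⟨i0, hi0⟩ : ∃ i, z i ≠ 0 := by
    by_contra hcon
    push Not at hcon
    exact hz (funext hcon)
  obtain ⟨p, hp, hg⟩ := Finset.extract_gcd z (s := Finset.univ) ⟨i0, Finset.mem_univ _⟩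
  set G := Finset.univ.gcd z with hG
  have hG0 : G ≠ 0 := by
    intro h0
    have := hp i0 (Finset.mem_univ _)
    rw [h0, zero_mul] at this
    exact hi0 this
  have hGp : 0 < G := lt_of_le_of_ne (gcd_nonneg_int z) (Ne.symm hG0)
  refine ⟨G.toNat - 1, p, ⟨?_, hg⟩, ?_⟩
  · intro h0
    have := hp i0 (Finset.mem_univ _)
    rw [h0] at this
    simp at this
    exact hi0 this
  · have h1 : ((G.toNat - 1 + 1 : ℕ) : ℤ) = G := by omega
    rw [h1]
    funext i
    rw [hp i (Finset.mem_univ _)]; simp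

def PPS (d k : ℕ) : Set (ZTup d k) := LIS d k ∩ PV d k

lemma PPS_inv (d k : ℕ) : GInv (PPS d k) := GInv_inter (LIS_inv d k) (PV_inv d k)

lemma PPS_const {d k : ℕ} (hd : k + 2 ≤ d) {μ : Measure (Xspace d)} [IsFiniteMeasure μ] (hμ : XInv μ) :
    ∃ c : ENNReal, c ≠ ⊤ ∧ mS μ (PPS d k) = c • volume := by
  refine mS_uniq (by omega) hμ (PPS_inv d k) (fun v hv => hv.1) fun N => ?_
  obtain ⟨C, hC, hb⟩ := Bary_bound (d := d) (k := k) (r := k) (s := 0) (by omega) hd hμ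
  refine lt_of_le_of_lt (hb _ (PPS_inv d k) (Set.inter_subset_left.trans (LIS_sub d k)) (Kset d k N) (box d k N)
    (measurableSet_Kset (by omega) N) (measurableSet_box _ _ _) ?_) (ENNReal.mul_lt_top hC.lt_top (vol_box_lt _ _ _))
  intro y hy I _ i
  exact Kset_box (by omega) N hy (I i)

def scl {d k : ℕ} (m : Fin k → ℕ) : Tup d k →ₗ[ℝ] Tup d k := comb (Hr (Hd m (fun _ _ => 0)))

lemma scl_apply {d k : ℕ} (m : Fin k → ℕ) (y : Tup d k) (j : Fin k) :
    scl m y j = ((m j : ℝ) + 1) • y j := by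
  unfold scl
  rw [comb_apply, Finset.sum_eq_single j]
  · simp [Hr, Hd_diag]
  · intro i _ hij
    have : Hd m (fun _ _ => 0) i j = 0 := by
      simp [Hd, hij]
    simp [Hr, this]
  · simp

def zscl {d k : ℕ} (m : Fin k → ℕ) (v : ZTup d k) : ZTup d k := fun i => ((m i + 1 : ℕ) : ℤ) • v i

lemma zc_zscl {d k : ℕ} (m : Fin k → ℕ) (v : ZTup d k) : zc (zscl m v) = scl m (zc v) := by
  funext i
  rw [scl_apply]
  show cv (((m i + 1 : ℕ) : ℤ) • v i) = _
  rw [cv_zsmul]; push_cast; rfl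

lemma scl_LI {d k : ℕ} (m : Fin k → ℕ) (y : Tup d k) :
    LinearIndependent ℝ (scl m y) ↔ LinearIndependent ℝ y := by
  have h : scl m y = (fun i => (Units.mk0 ((m i : ℝ) + 1) (by positivity) : ℝˣ)) • y := by
    funext i
    rw [scl_apply]; rfl
  rw [h]
  exact LinearIndependent.units_smul_iff y _

lemma scl_act {d k : ℕ} (m : Fin k → ℕ) (h : SLR d) (y : Tup d k) :
    scl m (act h y) = act h (scl m y) := comb_act _ _ _

def sclEquiv (d k : ℕ) : ((Fin k → ℕ) × PPS d k) ≃ LIS d k :=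
  Equiv.ofBijective (fun x => ⟨zscl x.1 x.2.1, by
    show LinearIndependent ℝ _
    rw [zc_zscl, scl_LI]
    exact x.2.2.1⟩) (by
    constructor
    · rintro ⟨m, p, hp⟩ ⟨m', p', hp'⟩ h
      have h1 : zscl m p = zscl m' p' := congrArg Subtype.val h
      have h2 : m = m' := by
        funext i
        have h3 := congrArg (fun z => Finset.univ.gcd z) (congrFun h1 i)
        simp only [zscl] at h3
        rw [gcd_smul_prim _ (hp.2 i), gcd_smul_prim _ (hp'.2 i)] at h3
        omega
      subst h2
      have h3 : p = p' := by
        funext i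
        have h4 := congrFun h1 i
        simp only [zscl] at h4
        exact smul_right_injective _ (by positivity) h4
      subst h3
      rfl
    · rintro ⟨v, hv⟩
      have hv' : LinearIndependent ℝ (zc v) := hv
      have hne : ∀ i, v i ≠ 0 := by
        intro i h0
        apply hv'.ne_zero i
        show cv (v i) = 0
        rw [h0, map_zero]
      choose m p hp hmp using fun i => exists_smul_prim (hne i)
      have hz : zscl m p = v := funext hmp
      refine ⟨⟨m, p, ?_, hp⟩, Subtype.ext hz⟩
      show LinearIndependent ℝ (zc p)
      rw [← scl_LI m, ← zc_zscl, hz]; exact hv)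

lemma sieg_scl {d k : ℕ} (A : Set (Tup d k)) (h : SLR d) :
    sieg (LIS d k) (A.indicator 1) h = ∑' m : Fin k → ℕ, sieg (PPS d k) ((scl m ⁻¹' A).indicator 1) h := by
  unfold sieg
  rw [← (sclEquiv d k).tsum_eq, ENNReal.tsum_prod']
  refine tsum_congr fun m => tsum_congr fun v => ?_
  show A.indicator 1 (act h (zc (zscl m v.1))) = _
  rw [zc_zscl, ← scl_act]
  rfl

lemma zeta_pos {d : ℕ} (hd : 2 ≤ d) : 0 < zetaval d ∧
    ∑' n : ℕ, (((n + 1 : ℕ) : ENNReal) ^ d)⁻¹ = ENNReal.ofReal (zetaval d) := by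
  have h : Summable (fun n : ℕ => (1:ℝ) / (((n:ℝ) + 1) ^ d)) := by
    have := (summable_nat_add_iff (f := fun n : ℕ => ((n : ℝ) ^ d)⁻¹) 1).2
      (Real.summable_nat_pow_inv.2 (by omega))
    refine this.congr fun n => ?_
    push_cast
    rw [one_div]
  constructor
  · exact h.tsum_pos (fun n => by positivity) 0 (by positivity)
  · unfold zetaval
    rw [ENNReal.ofReal_tsum_of_nonneg (fun n => by positivity) h]
    refine tsum_congr fun n => ?_
    rw [one_div, ENNReal.ofReal_inv_of_pos (by positivity), ENNReal.ofReal_pow (by positivity),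
      ← Nat.cast_succ, ENNReal.ofReal_natCast]

theorem PPS_vol {d k : ℕ} (hk1 : 1 ≤ k) (hd : k + 2 ≤ d) {μ : Measure (Xspace d)} [IsProbabilityMeasure μ]
    (hμ : XInv μ) : mS μ (PPS d k) = (ENNReal.ofReal (zetaval d) ^ k)⁻¹ • volume := by
  obtain ⟨c, hc, hcv⟩ := PPS_const (k := k) hd hμ
  have hsm : ∀ m : Fin k → ℕ, Measurable (scl (d := d) m) := fun m =>
    (LinearMap.continuous_of_finiteDimensional _).measurable
  have h1 : volume (box d k 1) = ∑' m : Fin k → ℕ, mS μ (PPS d k) (scl m ⁻¹' (box d k 1)) := by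
    rw [← LIS_one hk1 hd hμ, mS_apply μ (LIS_inv d k) (measurableSet_box _ _ _)]
    simp_rw [sieg_scl]
    rw [lintegral_tsum fun m => (measurable_sieg_out (PPS_inv d k)
      (measurable_one.indicator (hsm m (measurableSet_box d k 1)))).aemeasurable]
    exact tsum_congr fun m => (mS_apply μ (PPS_inv d k) (hsm m (measurableSet_box d k 1))).symm
  simp only [hcv, Measure.smul_apply, smul_eq_mul, scl, vol_comb] at h1
  rw [ENNReal.tsum_mul_left, ENNReal.tsum_mul_right,
    tsum_pi_prod k (fun n => (((n + 1 : ℕ) : ENNReal) ^ d)⁻¹), (zeta_pos (by omega : 2 ≤ d)).2] at h1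
  have hb0 : volume (box d k 1) ≠ 0 := by
    rw [vol_box]
    norm_num
  have hbt : volume (box d k 1) ≠ ⊤ := (vol_box_lt _ _ _).ne
  have h2 : 1 * volume (box d k 1) = (c * ENNReal.ofReal (zetaval d) ^ k) * volume (box d k 1) := by
    rw [one_mul, mul_assoc]; exact h1
  have h3 := (ENNReal.mul_left_inj hb0 hbt).1 h2
  rw [hcv, ENNReal.eq_inv_of_mul_eq_one_left h3.symm]

abbrev WW (n : ℕ) := Fin n → ℝ × ℝ

def om {n : ℕ} (v w : WW n) : ℝ := ∑ i, ((v i).1 * (w i).2 - (v i).2 * (w i).1)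

lemma continuous_om {n : ℕ} : Continuous (fun p : WW n × WW n => om p.1 p.2) := by
  unfold om
  fun_prop

lemma om_swap {n : ℕ} (v w : WW n) :
    om (fun i => (v i).swap) (fun i => (w i).swap) = - om v w := by
  unfold om
  rw [← Finset.sum_neg_distrib]
  refine Finset.sum_congr rfl fun i _ => ?_
  simp only [Prod.fst_swap, Prod.snd_swap]; ring

lemma om_split {n : ℕ} (i0 : Fin (n+1)) (v w : WW (n+1)) :
    om v w = (v i0).1 * (w i0).2 - (v i0).2 * (w i0).1
      + om (fun i => v (i0.succAbove i)) (fun i => w (i0.succAbove i)) := by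
  unfold om
  rw [Fin.sum_univ_succAbove _ i0]

lemma om_sub_smul {n : ℕ} (v w p : WW n) (s t : ℝ) :
    om (v - s • p) (w - t • p) = om v w - t * om v p - s * om p w := by
  unfold om
  rw [Finset.mul_sum, Finset.mul_sum, ← Finset.sum_sub_distrib, ← Finset.sum_sub_distrib]
  refine Finset.sum_congr rfl fun i _ => ?_
  simp only [Pi.sub_apply, Pi.smul_apply, Prod.fst_sub, Prod.snd_sub, Prod.smul_fst, Prod.smul_snd,
    smul_eq_mul]
  ring

lemma om_anti {n : ℕ} (v w : WW n) : om v w = - om w v := by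
  unfold om
  rw [← Finset.sum_neg_distrib]
  refine Finset.sum_congr rfl fun i _ => ?_
  ring

def AS (r n : ℕ) (c R : ℝ) : Set (Fin r → WW n) :=
  {z | (∀ i j, |om (z i) (z j)| ≤ c) ∧ ∀ i j, |(z i j).1| ≤ R ∧ |(z i j).2| ≤ R}

lemma measurable_om {n : ℕ} {α : Type*} [MeasurableSpace α] {f g : α → WW n} (hf : Measurable f)
    (hg : Measurable g) : Measurable (fun x => om (f x) (g x)) :=
  continuous_om.measurable.comp (hf.prodMk hg)

lemma measurableSet_AS (r n : ℕ) (c R : ℝ) : MeasurableSet (AS r n c R) := by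
  apply MeasurableSet.inter
  · show MeasurableSet {z : Fin r → WW n | ∀ i j, |om (z i) (z j)| ≤ c}
    simp only [Set.ofPred_forall]
    refine MeasurableSet.iInter fun i => MeasurableSet.iInter fun j => ?_
    exact measurableSet_le (measurable_om (measurable_pi_apply i) (measurable_pi_apply j)).abs
      measurable_const
  · show MeasurableSet {z : Fin r → WW n | ∀ i j, |(z i j).1| ≤ R ∧ |(z i j).2| ≤ R}
    simp only [Set.ofPred_forall]
    refine MeasurableSet.iInter fun i => MeasurableSet.iInter fun j => ?_
    have h : Measurable (fun z : Fin r → WW n => z i j) := by fun_prop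
    exact (measurableSet_le (measurable_fst.comp h).abs measurable_const).inter
      (measurableSet_le (measurable_snd.comp h).abs measurable_const)

/-- the shear -/
def shr {n : ℕ} (i0 : Fin (n+1)) (v u : WW (n+1)) : (ℝ × ℝ) × WW n :=
  (((u i0).1, om v u / (v i0).1),
    (fun i => u (i0.succAbove i)) - ((u i0).1 / (v i0).1) • (fun i => v (i0.succAbove i)))

lemma shr_mp {n : ℕ} (i0 : Fin (n+1)) (v : WW (n+1)) (hv : (v i0).1 ≠ 0) :
    MeasurePreserving (shr i0 v) := by
  have h1 := volume_preserving_piFinSuccAbove (fun _ : Fin (n+1) => ℝ × ℝ) i0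
  set ρ := (v i0).1 with hρ
  set w : WW n := fun i => v (i0.succAbove i) with hw
  have h2 : MeasurePreserving (fun p : WW n × (ℝ × ℝ) =>
      (id p.1, (p.2.1, p.2.2 + (om w p.1 / ρ - (v i0).2 / ρ * p.2.1)))) := by
    refine MeasurePreserving.skew_product (g := fun (a : WW n) (q : ℝ × ℝ) =>
      (q.1, q.2 + (om w a / ρ - (v i0).2 / ρ * q.1))) (MeasurePreserving.id _) ?_ ?_
    · have : Measurable (fun x : WW n × (ℝ × ℝ) => om w x.1) :=
        measurable_om measurable_const measurable_fst
      simp only [Function.uncurry_def]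
      fun_prop
    · refine Filter.Eventually.of_forall fun a => ?_
      refine MeasurePreserving.map_eq (μa := (volume : Measure (ℝ × ℝ))) ?_
      refine MeasurePreserving.skew_product (f := id) (g := fun (x y : ℝ) =>
        y + (om w a / ρ - (v i0).2 / ρ * x)) (MeasurePreserving.id _) ?_ ?_
      · simp only [Function.uncurry_def]
        fun_prop
      · exact Filter.Eventually.of_forall fun x => (measurePreserving_add_right volume _).map_eq
  have h3 : MeasurePreserving (fun p : (ℝ × ℝ) × WW n =>
      (id p.1, p.2 - (p.1.1 / ρ) • w)) := by
    refine MeasurePreserving.skew_product (g := fun (a : ℝ × ℝ) (q : WW n) =>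
      q - (a.1 / ρ) • w) (MeasurePreserving.id _) ?_ ?_
    · simp only [Function.uncurry_def]
      fun_prop
    · exact Filter.Eventually.of_forall fun x => (measurePreserving_sub_right volume _).map_eq
  have hs1 : MeasurePreserving (Prod.swap : (ℝ × ℝ) × WW n → _) := Measure.measurePreserving_swap
  have hs2 : MeasurePreserving (Prod.swap : WW n × (ℝ × ℝ) → _) := Measure.measurePreserving_swap
  have h4 := (((h3.comp hs2).comp h2).comp hs1).comp h1
  convert h4 using 1
  funext u
  have e1 : om v u / ρ = (u i0).2 + (om w (fun i => u (i0.succAbove i)) / ρ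
      - (v i0).2 / ρ * (u i0).1) := by
    rw [om_split i0]
    field_simp
    ring
  unfold shr
  rw [e1]
  rfl

def BS (r n : ℕ) (c R : ℝ) (i1 : Fin (r+1)) (i0 : Fin (n+1)) : Set (Fin (r+1) → WW (n+1)) :=
  AS (r+1) (n+1) c R ∩ {z | (z i1 i0).1 ≠ 0 ∧
    ∀ i j, |(z i j).1| ≤ |(z i1 i0).1| ∧ |(z i j).2| ≤ |(z i1 i0).1|}

lemma measurableSet_BS (r n : ℕ) (c R : ℝ) (i1 : Fin (r+1)) (i0 : Fin (n+1)) :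
    MeasurableSet (BS r n c R i1 i0) := by
  apply (measurableSet_AS _ _ _ _).inter
  have h : ∀ i j, Measurable (fun z : Fin (r+1) → WW (n+1) => z i j) := by intro i j; fun_prop
  apply MeasurableSet.inter
  · exact (measurable_fst.comp (h i1 i0)) (measurableSet_singleton 0).compl
  · show MeasurableSet {z : Fin (r+1) → WW (n+1) | ∀ i j, |(z i j).1| ≤ |(z i1 i0).1| ∧ |(z i j).2| ≤ |(z i1 i0).1|}
    simp only [Set.ofPred_forall]
    refine MeasurableSet.iInter fun i => MeasurableSet.iInter fun j => ?_
    exact (measurableSet_le (measurable_fst.comp (h i j)).abs (measurable_fst.comp (h i1 i0)).abs).inter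
      (measurableSet_le (measurable_snd.comp (h i j)).abs (measurable_fst.comp (h i1 i0)).abs)

lemma shr_bound {n : ℕ} {i0 : Fin (n+1)} {v u u' : WW (n+1)} {c : ℝ} (hv : (v i0).1 ≠ 0)
    (h1 : |om u u'| ≤ c) (h2 : |om v u| ≤ c) (h3 : |om v u'| ≤ c)
    (h4 : |(u i0).1| ≤ |(v i0).1|) (h5 : |(u' i0).1| ≤ |(v i0).1|) :
    |om (shr i0 v u).2 (shr i0 v u').2| ≤ 3 * c := by
  have e : om (shr i0 v u).2 (shr i0 v u').2 = om u u' - ((u i0).1 / (v i0).1) * om v u'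
      + ((u' i0).1 / (v i0).1) * om v u := by
    unfold shr
    simp only
    rw [om_sub_smul, om_anti _ (fun i => v (i0.succAbove i)), om_split i0 u u', om_split i0 v u',
      om_split i0 v u]
    field_simp
    ring
  have hq : ∀ x : ℝ, |x| ≤ |(v i0).1| → |x / (v i0).1| ≤ 1 := fun x hx => by
    rw [abs_div]; exact div_le_one_of_le₀ hx (abs_nonneg _)
  have b1 : |((u i0).1 / (v i0).1) * om v u'| ≤ 1 * c := by
    rw [abs_mul]; exact mul_le_mul (hq _ h4) h3 (abs_nonneg _) (by norm_num)
  have b2 : |((u' i0).1 / (v i0).1) * om v u| ≤ 1 * c := by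
    rw [abs_mul]; exact mul_le_mul (hq _ h5) h2 (abs_nonneg _) (by norm_num)
  rw [e]
  rw [abs_le] at *
  constructor <;> linarith [b1.1, b1.2, b2.1, b2.2, h1.1, h1.2]

lemma fiber_bound {r n : ℕ} {c R : ℝ} (i1 : Fin (r+1)) (i0 : Fin (n+1)) (v : WW (n+1))
    (hv : (v i0).1 ≠ 0) :
    volume {u : Fin r → WW (n+1) | (i1.insertNth v u : Fin (r+1) → WW (n+1)) ∈ BS r n c R i1 i0}
      ≤ ENNReal.ofReal (4 * c) ^ r * volume (AS r n (3*c) (2*R)) := by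
  set ρ := |(v i0).1| with hρ
  have hρ0 : 0 < ρ := abs_pos.2 hv
  have m1 : MeasurePreserving (fun (u : Fin r → WW (n+1)) (i : Fin r) => shr i0 v (u i)) :=
    volume_preserving_pi fun _ => shr_mp i0 v hv
  have m2 := (volume_measurePreserving_arrowProdEquivProdArrow (ℝ × ℝ) (WW n) (Fin r)).comp m1
  set D : Set ((Fin r → ℝ × ℝ) × (Fin r → WW n)) :=
    (Set.univ.pi fun _ => Set.Icc (-ρ) ρ ×ˢ Set.Icc (-(c/ρ)) (c/ρ)) ×ˢ AS r n (3*c) (2*R) with hD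
  have hDm : MeasurableSet D :=
    (MeasurableSet.univ_pi fun _ => measurableSet_Icc.prod measurableSet_Icc).prod
      (measurableSet_AS _ _ _ _)
  have hvol : volume D = ENNReal.ofReal (4 * c) ^ r * volume (AS r n (3*c) (2*R)) := by
    rw [hD, Measure.volume_eq_prod, Measure.prod_prod, volume_pi_pi]
    congr 1
    rw [Finset.prod_const, Finset.card_univ, Fintype.card_fin]
    congr 1
    rw [Measure.volume_eq_prod, Measure.prod_prod, Real.volume_Icc, Real.volume_Icc,
      ← ENNReal.ofReal_mul (by linarith)]
    congr 1
    field_simp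
    ring
  rw [← hvol, ← m2.measure_preimage hDm.nullMeasurableSet]
  apply measure_mono
  intro u hu
  obtain ⟨⟨ha, hb⟩, -, hc⟩ := hu
  have hi1 : (i1.insertNth v u : Fin (r+1) → WW (n+1)) i1 = v := Fin.insertNth_apply_same _ _ _
  have his : ∀ j, (i1.insertNth v u : Fin (r+1) → WW (n+1)) (i1.succAbove j) = u j :=
    fun j => Fin.insertNth_apply_succAbove _ _ _ _
  have ha1 : ∀ j, |om v (u j)| ≤ c := fun j => by
    have := ha i1 (i1.succAbove j); rwa [hi1, his] at this
  have ha2 : ∀ i j, |om (u i) (u j)| ≤ c := fun i j => by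
    have := ha (i1.succAbove i) (i1.succAbove j); rwa [his, his] at this
  have hb1 : ∀ i, |(v i).1| ≤ R ∧ |(v i).2| ≤ R := fun i => by
    have := hb i1 i; rwa [hi1] at this
  have hb2 : ∀ j i, |(u j i).1| ≤ R ∧ |(u j i).2| ≤ R := fun j i => by
    have := hb (i1.succAbove j) i; rwa [his] at this
  have hc2 : ∀ j i, |(u j i).1| ≤ ρ ∧ |(u j i).2| ≤ ρ := fun j i => by
    have := hc (i1.succAbove j) i; rwa [his, hi1] at this
  show (_ , _) ∈ D
  refine ⟨fun j _ => ⟨abs_le.1 (hc2 j i0).1, abs_le.1 ?_⟩, ?_, ?_⟩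
  · show |om v (u j) / (v i0).1| ≤ c / ρ
    rw [abs_div]
    exact div_le_div_of_nonneg_right (ha1 j) hρ0.le
  · intro i j
    exact shr_bound hv (ha2 i j) (ha1 i) (ha1 j) (hc2 i i0).1 (hc2 j i0).1
  · intro j i
    have hq : |(u j i0).1 / (v i0).1| ≤ 1 := by
      rw [abs_div]; exact div_le_one_of_le₀ (hc2 j i0).1 (abs_nonneg _)
    have key : ∀ x y : ℝ, |x| ≤ R → |y| ≤ R → |x - (u j i0).1 / (v i0).1 * y| ≤ 2 * R := by
      intro x y hx hy
      have : |(u j i0).1 / (v i0).1 * y| ≤ 1 * R := by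
        rw [abs_mul]; exact mul_le_mul hq hy (abs_nonneg _) (by norm_num)
      rw [abs_le] at *
      constructor <;> linarith [this.1, this.2, hx.1, hx.2]
    exact ⟨key _ _ (hb2 j _).1 (hb1 _).1, key _ _ (hb2 j _).2 (hb1 _).2⟩

lemma BS_bound {r n : ℕ} {c R : ℝ} (i1 : Fin (r+1)) (i0 : Fin (n+1)) :
    volume (BS r n c R i1 i0) ≤ ENNReal.ofReal (2*R) ^ (2*(n+1)) *
      (ENNReal.ofReal (4 * c) ^ r * volume (AS r n (3*c) (2*R))) := by
  have h1 := (volume_preserving_piFinSuccAbove (fun _ : Fin (r+1) => WW (n+1)) i1).symm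
  set Q : Set (WW (n+1)) := Set.univ.pi fun _ => Set.Icc (-R) R ×ˢ Set.Icc (-R) R with hQ
  have hQm : MeasurableSet Q := MeasurableSet.univ_pi fun _ => measurableSet_Icc.prod measurableSet_Icc
  have hQv : volume Q = ENNReal.ofReal (2*R) ^ (2*(n+1)) := by
    rw [hQ, volume_pi_pi, Finset.prod_const, Finset.card_univ, Fintype.card_fin,
      Measure.volume_eq_prod, Measure.prod_prod, Real.volume_Icc, ← pow_two, ← pow_mul]
    congr 2
    ring
  rw [← h1.measure_preimage (measurableSet_BS _ _ _ _ _ _).nullMeasurableSet,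
    Measure.volume_eq_prod, Measure.prod_apply (h1.measurable (measurableSet_BS _ _ _ _ _ _)), ← hQv,
    mul_comm, ← setLIntegral_const, ← lintegral_indicator hQm]
  have hne : ∀ᵐ v : WW (n+1), (v i0).1 ≠ 0 := by
    have hmp : Measure.QuasiMeasurePreserving (fun v : WW (n+1) => v i0) := by
      exact Measure.quasiMeasurePreserving_eval _ i0
    have hfst : Measure.QuasiMeasurePreserving (Prod.fst : ℝ × ℝ → ℝ) :=
      Measure.quasiMeasurePreserving_fst
    have h0 : ∀ᵐ x : ℝ, x ≠ 0 := by
      rw [ae_iff]; simp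
    exact (hfst.comp hmp).ae h0
  refine lintegral_mono_ae ?_
  filter_upwards [hne] with v hv
  by_cases hvQ : v ∈ Q
  · rw [Set.indicator_of_mem hvQ]
    exact fiber_bound i1 i0 v hv
  · rw [Set.indicator_of_notMem hvQ, nonpos_iff_eq_zero]
    convert measure_empty (μ := (volume : Measure (Fin r → WW (n+1))))
    rw [Set.eq_empty_iff_forall_notMem]
    intro u hu
    apply hvQ
    have hu' : (i1.insertNth v u : Fin (r+1) → WW (n+1)) ∈ BS r n c R i1 i0 := hu
    intro i _
    have := hu'.1.2 i1 i
    rw [Fin.insertNth_apply_same] at this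
    exact ⟨abs_le.1 this.1, abs_le.1 this.2⟩

def swp {r n : ℕ} (z : Fin r → WW n) : Fin r → WW n := fun i j => (z i j).swap

lemma swp_mp (r n : ℕ) : MeasurePreserving (swp (r := r) (n := n)) :=
  volume_preserving_pi fun _ => volume_preserving_pi fun _ => Measure.measurePreserving_swap

lemma AS_swp {r n : ℕ} {c R : ℝ} {z : Fin r → WW n} (hz : z ∈ AS r n c R) : swp z ∈ AS r n c R := by
  refine ⟨fun i j => ?_, fun i j => ⟨(hz.2 i j).2, (hz.2 i j).1⟩⟩
  have := om_swap (z i) (z j)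
  show |om (fun l => (z i l).swap) (fun l => (z j l).swap)| ≤ c
  rw [this, abs_neg]
  exact hz.1 i j

lemma AS_cover {r n : ℕ} (c R : ℝ) : AS (r+1) (n+1) c R ⊆
    ({0} ∪ ⋃ p : Fin (r+1) × Fin (n+1), (BS r n c R p.1 p.2 ∪ swp ⁻¹' BS r n c R p.1 p.2)) := by
  intro z hz
  by_cases hz0 : z = 0
  · exact Or.inl hz0
  right
  obtain ⟨q, hq⟩ := Finite.exists_max (fun q : (Fin (r+1) × Fin (n+1)) × Bool =>
    if q.2 then |(z q.1.1 q.1.2).1| else |(z q.1.1 q.1.2).2|)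
  obtain ⟨⟨i1, i0⟩, b⟩ := q
  have h1 : ∀ i j, |(z i j).1| ≤ _ := fun i j => hq ((i, j), true)
  have h2 : ∀ i j, |(z i j).2| ≤ _ := fun i j => hq ((i, j), false)
  refine Set.mem_iUnion.2 ⟨(i1, i0), ?_⟩
  cases b
  · right
    simp only [Bool.false_eq_true, if_false] at h1 h2
    refine ⟨AS_swp hz, fun h0 => hz0 ?_, fun i j => ⟨h2 i j, h1 i j⟩⟩
    have h0' : (z i1 i0).2 = 0 := h0
    rw [h0', abs_zero] at h1 h2
    funext i j
    exact Prod.ext (abs_nonpos_iff.1 (h1 i j)) (abs_nonpos_iff.1 (h2 i j))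
  · left
    simp only [if_true] at h1 h2
    refine ⟨hz, fun h0 => hz0 ?_, fun i j => ⟨h1 i j, h2 i j⟩⟩
    have h0' : (z i1 i0).1 = 0 := h0
    rw [h0', abs_zero] at h1 h2
    funext i j
    exact Prod.ext (abs_nonpos_iff.1 (h1 i j)) (abs_nonpos_iff.1 (h2 i j))

lemma AS_step {r n : ℕ} (c R : ℝ) : volume (AS (r+1) (n+1) c R) ≤
    ((r+1) * (n+1) * 2 : ℕ) * (ENNReal.ofReal (2*R) ^ (2*(n+1)) *
      (ENNReal.ofReal (4 * c) ^ r * volume (AS r n (3*c) (2*R)))) := by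
  refine (measure_mono (AS_cover c R)).trans ?_
  refine (measure_union_le _ _).trans ?_
  have h0 : volume ({0} : Set (Fin (r+1) → WW (n+1))) = 0 := by
    refine measure_mono_null (t := Set.univ.pi fun _ => Set.univ.pi fun _ => {0} ×ˢ {0}) ?_ ?_
    · rintro _ rfl i _ j _
      exact ⟨rfl, rfl⟩
    · rw [volume_pi_pi]
      refine Finset.prod_eq_zero (Finset.mem_univ 0) ?_
      rw [volume_pi_pi]
      refine Finset.prod_eq_zero (Finset.mem_univ 0) ?_
      rw [Measure.volume_eq_prod, Measure.prod_prod]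
      simp
  rw [h0, zero_add]
  refine (measure_iUnion_fintype_le _ _).trans ?_
  set X := ENNReal.ofReal (2*R) ^ (2*(n+1)) *
      (ENNReal.ofReal (4 * c) ^ r * volume (AS r n (3*c) (2*R)))
  have : ∀ p : Fin (r+1) × Fin (n+1),
      volume (BS r n c R p.1 p.2 ∪ swp ⁻¹' BS r n c R p.1 p.2) ≤ 2 * X := by
    intro p
    refine (measure_union_le _ _).trans ?_
    rw [(swp_mp _ _).measure_preimage (measurableSet_BS _ _ _ _ _ _).nullMeasurableSet, two_mul]
    exact add_le_add (BS_bound _ _) (BS_bound _ _)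
  refine (Finset.sum_le_sum fun p _ => this p).trans ?_
  rw [Finset.sum_const, Finset.card_univ, Fintype.card_prod, Fintype.card_fin, Fintype.card_fin,
    nsmul_eq_mul]
  push_cast
  rw [← mul_assoc]

lemma AS_vol : ∀ (r n : ℕ), r ≤ n → ∀ c : ℝ, ∃ K : ENNReal, K ≠ ⊤ ∧ ∀ R : ℝ, 0 ≤ R →
    volume (AS r n c R) ≤ K * ENNReal.ofReal R ^ (r * (2*n + 1 - r)) := by
  intro r
  induction r with
  | zero =>
    intro n _ c
    refine ⟨1, ENNReal.one_ne_top, fun R _ => ?_⟩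
    rw [zero_mul, pow_zero, mul_one]
    refine (measure_mono (Set.subset_univ _)).trans ?_
    rw [volume_pi, Measure.pi_of_empty]
    simp
  | succ r ih =>
    intro n hn c
    obtain ⟨n, rfl⟩ : ∃ m, n = m + 1 := ⟨n - 1, by omega⟩
    obtain ⟨K, hK, hKb⟩ := ih n (by omega) (3*c)
    refine ⟨((r+1) * (n+1) * 2 : ℕ) * (2 ^ (2*(n+1)) * (ENNReal.ofReal (4 * c) ^ r *
      (K * 2 ^ (r * (2*n+1-r))))), ?_, fun R hR => ?_⟩
    · refine ENNReal.mul_ne_top (ENNReal.natCast_ne_top _) (ENNReal.mul_ne_top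
        (ENNReal.pow_ne_top (by simp)) (ENNReal.mul_ne_top (ENNReal.pow_ne_top ENNReal.ofReal_ne_top)
        (ENNReal.mul_ne_top hK (ENNReal.pow_ne_top (by simp)))))
    · refine (AS_step c R).trans ?_
      have h2 := hKb (2*R) (by linarith)
      have h3 : ENNReal.ofReal (2*R) = 2 * ENNReal.ofReal R := by
        rw [ENNReal.ofReal_mul (by norm_num)]; simp
      rw [h3] at h2 ⊢
      have e : (r+1) * (2*(n+1)+1-(r+1)) = 2*(n+1) + r * (2*n+1-r) := by
        obtain ⟨t, rfl⟩ : ∃ t, n = r + t := ⟨n - r, by omega⟩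
        have e1 : 2*(r+t+1)+1-(r+1) = r + 2*t + 2 := by omega
        have e2 : 2*(r+t)+1-r = r + 2*t+1 := by omega
        rw [e1, e2]; ring
      rw [e, pow_add]
      calc _ ≤ ((r+1) * (n+1) * 2 : ℕ) * ((2 * ENNReal.ofReal R) ^ (2*(n+1)) *
            (ENNReal.ofReal (4 * c) ^ r * (K * (2 * ENNReal.ofReal R) ^ (r * (2*n+1-r))))) := by
            gcongr
        _ = _ := by
            rw [mul_pow, mul_pow]; ring

def spl (n : ℕ) : Fin n ⊕ Fin n ≃ Fin (2*n) := finSumFinEquiv.trans (finCongr (two_mul n).symm)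

lemma spl_inl {n : ℕ} (i : Fin n) : (spl n (Sum.inl i) : ℕ) = i := rfl
lemma spl_inr {n : ℕ} (i : Fin n) : (spl n (Sum.inr i) : ℕ) = n + i := rfl

def psw {n : ℕ} (v : Fin (2*n) → ℝ) : WW n := fun i => (v (spl n (Sum.inl i)), v (spl n (Sum.inr i)))

lemma psw_mp (n : ℕ) : MeasurePreserving (psw (n := n)) := by
  have h1 := (volume_measurePreserving_piCongrLeft (fun _ : Fin (2*n) => ℝ) (spl n)).symm
  have h2 := volume_measurePreserving_sumPiEquivProdPi (fun _ : Fin n ⊕ Fin n => ℝ)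
  have h3 := (volume_measurePreserving_arrowProdEquivProdArrow ℝ ℝ (Fin n)).symm
  exact (h3.comp h2).comp h1

lemma symp_eq {n : ℕ} (v w : Fin (2*n) → ℝ) : symp n v w = om (psw v) (psw w) := by
  have hl : ∀ i : Fin n, (Jmat n).mulVec w (spl n (Sum.inl i)) = w (spl n (Sum.inr i)) := by
    intro i
    simp only [Matrix.mulVec, dotProduct]
    rw [Finset.sum_eq_single (spl n (Sum.inr i))]
    · have : Jmat n (spl n (Sum.inl i)) (spl n (Sum.inr i)) = 1 := by
        unfold Jmat
        rw [if_pos (by rw [spl_inl, spl_inr]; omega)]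
      rw [this, one_mul]
    · intro j _ hj
      have : Jmat n (spl n (Sum.inl i)) j = 0 := by
        unfold Jmat
        rw [if_neg, if_neg]
        · rw [spl_inl]; omega
        · intro h
          apply hj
          apply Fin.ext
          rw [spl_inr, ← h, spl_inl]; omega
      rw [this, zero_mul]
    · simp
  have hr : ∀ i : Fin n, (Jmat n).mulVec w (spl n (Sum.inr i)) = - w (spl n (Sum.inl i)) := by
    intro i
    simp only [Matrix.mulVec, dotProduct]
    rw [Finset.sum_eq_single (spl n (Sum.inl i))]
    · have : Jmat n (spl n (Sum.inr i)) (spl n (Sum.inl i)) = -1 := by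
        unfold Jmat
        rw [if_neg (by rw [spl_inl, spl_inr]; omega), if_pos (by rw [spl_inl, spl_inr]; omega)]
      rw [this, neg_one_mul]
    · intro j _ hj
      have : Jmat n (spl n (Sum.inr i)) j = 0 := by
        unfold Jmat
        rw [if_neg, if_neg]
        · intro h
          apply hj
          apply Fin.ext
          rw [spl_inr] at h
          rw [spl_inl]; omega
        · rw [spl_inr]; omega
      rw [this, zero_mul]
    · simp
  unfold symp om dotProduct
  rw [← (spl n).sum_comp, Fintype.sum_sum_type, ← Finset.sum_add_distrib]
  refine Finset.sum_congr rfl fun i _ => ?_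
  rw [hl, hr]
  simp only [psw]
  ring

def AT (n r : ℕ) (c R : ℝ) : Set (Tup (2*n) r) :=
  (fun (y : Tup (2*n) r) (i : Fin r) => psw (y i)) ⁻¹' AS r n c R

lemma pswT_mp (n r : ℕ) : MeasurePreserving (fun (y : Tup (2*n) r) (i : Fin r) => psw (y i)) :=
  volume_preserving_pi fun _ => psw_mp n

lemma measurableSet_AT (n r : ℕ) (c R : ℝ) : MeasurableSet (AT n r c R) :=
  (pswT_mp n r).measurable (measurableSet_AS _ _ _ _)

lemma vol_AT (n r : ℕ) (c R : ℝ) : volume (AT n r c R) = volume (AS r n c R) :=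
  (pswT_mp n r).measure_preimage (measurableSet_AS _ _ _ _).nullMeasurableSet

lemma continuous_symp (n : ℕ) : Continuous (fun p : (Fin (2*n) → ℝ) × (Fin (2*n) → ℝ) => symp n p.1 p.2) := by
  unfold symp
  fun_prop

lemma measurableSet_EgT (n k : ℕ) (g : SLR (2*n)) (a b : Pairs k → ℝ) (T : ℝ) :
    MeasurableSet (EgT n k g a b T) := by
  apply MeasurableSet.inter
  · show MeasurableSet {v : Tup (2*n) k | ∀ p : Pairs k, symp n (v p.1.1) (v p.1.2) ∈ Set.Ioo (a p) (b p)}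
    rw [Set.ofPred_forall]
    refine MeasurableSet.iInter fun p => ?_
    have h : Measurable (fun v : Tup (2*n) k => symp n (v p.1.1) (v p.1.2)) :=
      (continuous_symp n).measurable.comp (g := fun p : (Fin (2*n) → ℝ) × (Fin (2*n) → ℝ) => symp n p.1 p.2)
        (f := fun v : Tup (2*n) k => (v p.1.1, v p.1.2))
        ((measurable_pi_apply p.1.1).prodMk (measurable_pi_apply p.1.2))
    exact h measurableSet_Ioo
  · show MeasurableSet {v : Tup (2*n) k | ∀ l, enorm2 (g.1.mulVec (v l)) < T}
    rw [Set.ofPred_forall]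
    refine MeasurableSet.iInter fun l => ?_
    have h : Continuous (fun v : Tup (2*n) k => enorm2 (g.1.mulVec (v l))) := by
      unfold enorm2
      have h2 : Continuous (fun v : Tup (2*n) k => g.1.mulVec (v l)) := by fun_prop
      refine Real.continuous_sqrt.comp (continuous_finsetSum _ fun i _ => ?_)
      exact ((continuous_apply i).comp h2).pow 2
    exact measurableSet_lt h.measurable measurable_const

def Cg {d : ℕ} (g : SLR d) : ℝ := ∑ i, ∑ j, |(g⁻¹).1 i j|

lemma Cg_nonneg {d : ℕ} (g : SLR d) : 0 ≤ Cg g :=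
  Finset.sum_nonneg fun _ _ => Finset.sum_nonneg fun _ _ => abs_nonneg _

lemma Cg_bound {d : ℕ} (g : SLR d) {x : Fin d → ℝ} {T : ℝ} (h : enorm2 (g.1.mulVec x) < T) (i : Fin d) :
    |x i| ≤ Cg g * T := by
  have hT : 0 ≤ T := (Real.sqrt_nonneg _).trans h.le
  have hc : ∀ j, |g.1.mulVec x j| ≤ T := by
    intro j
    refine le_trans ?_ h.le
    refine Real.abs_le_sqrt ?_
    exact Finset.single_le_sum (f := fun j => (g.1.mulVec x j)^2) (fun _ _ => sq_nonneg _) (Finset.mem_univ j)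
  have h1 : x i = ∑ j, (g⁻¹).1 i j * g.1.mulVec x j := by
    conv_lhs => rw [← SL_inv_mulVec g x]
    rfl
  rw [h1]
  refine (Finset.abs_sum_le_sum_abs _ _).trans ?_
  have h2 : ∑ j, |(g⁻¹).1 i j * g.1.mulVec x j| ≤ (∑ j, |(g⁻¹).1 i j|) * T := by
    rw [Finset.sum_mul]
    refine Finset.sum_le_sum fun j _ => ?_
    rw [abs_mul]
    exact mul_le_mul_of_nonneg_left (hc j) (abs_nonneg _)
  refine h2.trans (mul_le_mul_of_nonneg_right ?_ hT)
  exact Finset.single_le_sum (f := fun i => ∑ j, |(g⁻¹).1 i j|)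
    (fun _ _ => Finset.sum_nonneg fun _ _ => abs_nonneg _) (Finset.mem_univ i)

lemma symp_bound {n k : ℕ} {g : SLR (2*n)} {a b : Pairs k → ℝ} {T : ℝ} {y : Tup (2*n) k}
    (hy : y ∈ EgT n k g a b T) (i j : Fin k) :
    |symp n (y i) (y j)| ≤ ∑ p, (|a p| + |b p|) := by
  have hlt : ∀ i j : Fin k, i < j → |symp n (y i) (y j)| ≤ ∑ p, (|a p| + |b p|) := by
    intro i j hij
    have h1 := hy.1 ⟨(i, j), hij⟩
    have h2 := Finset.single_le_sum (f := fun p : Pairs k => |a p| + |b p|)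
      (fun _ _ => by positivity) (Finset.mem_univ (⟨(i, j), hij⟩ : Pairs k))
    refine le_trans ?_ h2
    have h3 := neg_abs_le (a ⟨(i, j), hij⟩)
    have h4 := le_abs_self (b ⟨(i, j), hij⟩)
    have h5 := abs_nonneg (a ⟨(i, j), hij⟩)
    have h6 := abs_nonneg (b ⟨(i, j), hij⟩)
    have h7 := h1.1
    have h8 := h1.2
    simp only at h7 h8 ⊢
    rw [abs_le]
    constructor <;> linarith
  rcases lt_trichotomy i j with h | h | h
  · exact hlt i j h
  · subst h
    have : symp n (y i) (y i) = 0 := by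
      have := om_anti (psw (y i)) (psw (y i))
      rw [symp_eq]; linarith
    rw [this, abs_zero]
    exact Finset.sum_nonneg fun _ _ => by positivity
  · rw [symp_eq, om_anti, abs_neg, ← symp_eq]
    exact hlt j i h

lemma EgT_AT {n k : ℕ} {g : SLR (2*n)} {a b : Pairs k → ℝ} {T : ℝ} {y : Tup (2*n) k}
    (hy : y ∈ EgT n k g a b T) (r : ℕ) (I : Fin r → Fin k) :
    (fun i => y (I i)) ∈ AT n r (∑ p, (|a p| + |b p|)) (Cg g * T) := by
  refine ⟨fun i j => ?_, fun i j => ⟨?_, ?_⟩⟩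
  · show |om (psw (y (I i))) (psw (y (I j)))| ≤ _
    rw [← symp_eq]
    exact symp_bound hy _ _
  · exact Cg_bound g (hy.2 (I i)) _
  · exact Cg_bound g (hy.2 (I i)) _

lemma EgT_box {n k : ℕ} {g : SLR (2*n)} {a b : Pairs k → ℝ} {T : ℝ} :
    EgT n k g a b T ⊆ box (2*n) k (Cg g * T) := fun _ hy i l => Cg_bound g (hy.2 i) l

lemma sieg_card {d k : ℕ} (S : Set (ZTup d k)) (E : Set (Tup d k)) (h : SLR d) :
    (sieg S (E.indicator 1) h).toReal = (Nat.card {v : ZTup d k | v ∈ S ∧ act h (zc v) ∈ E} : ℝ) := by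
  have h1 : sieg S (E.indicator 1) h
      = ∑' v : ZTup d k, ({v : ZTup d k | v ∈ S ∧ act h (zc v) ∈ E}).indicator (fun _ => (1 : ENNReal)) v := by
    unfold sieg
    rw [tsum_subtype S (fun v => (E.indicator 1 (act h (zc v)) : ENNReal))]
    refine tsum_congr fun v => ?_
    by_cases hv : v ∈ S <;> by_cases hE : act h (zc v) ∈ E <;> simp [Set.indicator, hv, hE]
  rw [h1, ← tsum_subtype, ENNReal.tsum_set_one, Nat.card_coe_set_eq, Set.ncard]
  cases hc : Set.encard {v : ZTup d k | v ∈ S ∧ act h (zc v) ∈ E} <;> simp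

lemma dep_part {n k : ℕ} (hk : 1 ≤ k) (hkn : k ≤ n + 1) (hd : k + 2 ≤ 2*n) (a b : Pairs k → ℝ) (g : SLR (2*n))
    {μ : Measure (Xspace (2*n))} [IsProbabilityMeasure μ] (hμ : XInv μ) :
    ∃ C : ENNReal, C ≠ ⊤ ∧ ∀ T : ℝ, 1 ≤ T →
      mS μ (PV (2*n) k ∩ (LIS (2*n) k)ᶜ) (EgT n k g a b T)
        ≤ C * ENNReal.ofReal T ^ ((k-1) * (2*n+2-k)) := by
  obtain ⟨C, hC, hCb⟩ := Dep_bound (k := k) hd hμ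
  set c := ∑ p, (|a p| + |b p|) with hc
  have hK : ∀ r, ∃ K : ENNReal, K ≠ ⊤ ∧ (r ≤ n → ∀ R : ℝ, 0 ≤ R →
      volume (AS r n c R) ≤ K * ENNReal.ofReal R ^ (r * (2*n + 1 - r))) := by
    intro r
    by_cases hr : r ≤ n
    · obtain ⟨K, h1, h2⟩ := AS_vol r n hr c
      exact ⟨K, h1, fun _ => h2⟩
    · exact ⟨0, by simp, fun h => absurd h hr⟩
  choose K hK1 hK2 using hK
  refine ⟨∑ r ∈ Finset.Ico 1 k, C r * (K r * ENNReal.ofReal (Cg g) ^ (r * (2*n+1-r))), ?_, ?_⟩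
  · refine (ENNReal.sum_lt_top.2 fun r _ => ?_).ne
    exact (ENNReal.mul_ne_top (hC r) (ENNReal.mul_ne_top (hK1 r)
      (ENNReal.pow_ne_top ENNReal.ofReal_ne_top))).lt_top
  · intro T hT
    refine (hCb 1 _ (GInv_inter (PV_inv _ _) (LISc_inv _ _)) ?_ _ (fun r => AT n r c (Cg g * T))
      (measurableSet_EgT _ _ _ _ _ _) (fun r => measurableSet_AT _ _ _ _)
      (fun y hy r I _ => EgT_AT hy r I)).trans ?_
    · rintro v ⟨hv1, hv2⟩
      refine ⟨hv2, Or.inr ⟨rfl, ?_⟩⟩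
      rintro rfl
      exact (hv1 ⟨0, hk⟩).1 rfl
    · rw [Finset.sum_mul]
      refine Finset.sum_le_sum fun r hr => ?_
      obtain ⟨hr1, hr2⟩ := Finset.mem_Ico.1 hr
      rw [mul_assoc]
      refine mul_le_mul_right ?_ (C r)
      rw [vol_AT]
      refine (hK2 r (by omega) _ (mul_nonneg (Cg_nonneg g) (by linarith))).trans ?_
      rw [mul_assoc, ENNReal.ofReal_mul (Cg_nonneg g), mul_pow]
      have he : r * (2*n+1-r) ≤ (k-1) * (2*n+2-k) := by
        obtain ⟨s, rfl⟩ : ∃ s, k = r + 1 + s := ⟨k - r - 1, by omega⟩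
        obtain ⟨t, rfl⟩ : ∃ t, n = r + s + t := ⟨n - r - s, by omega⟩
        have e1 : r + 1 + s - 1 = r + s := by omega
        have e2 : 2*(r+s+t)+2-(r+1+s) = r + s + 2*t+1 := by omega
        have e3 : 2*(r+s+t)+1-r = r + 2*s+2*t+1 := by omega
        rw [e1, e2, e3]
        nlinarith [Nat.zero_le (s*t), Nat.zero_le (s*s), Nat.zero_le s]
      have hT1 : 1 ≤ ENNReal.ofReal T := by
        rw [← ENNReal.ofReal_one]; exact ENNReal.ofReal_le_ofReal hT
      exact mul_le_mul_right (mul_le_mul_right (pow_le_pow_right₀ hT1 he) _) _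

/-- Proposition 5.3 (mean of the rank-`k` primitive Siegel transform): for
`2n ≥ (k/2)² + 3`,
`∫ χ̂_{E_{g,T}} dμ = ζ(2n)^{-k} vol_{2nk}(E_{g,T}) + O_g(T^{2n(k-1) - (k-1)(k-2)})`. -/
theorem stmt10 (n k : ℕ) (hk : 1 ≤ k) (hn : 1 ≤ n)
    (hnk : ((k : ℝ)/2)^2 + 3 ≤ (2*n : ℝ))
    (a b : Pairs k → ℝ) (hab : ∀ p, a p < b p) (g : SLR (2*n)) :
    ∀ μ : Measure (Xspace (2*n)), IsProbabilityMeasure μ →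
      (∀ γ : SLR (2*n), Measure.map (fun x => γ • x) μ = μ) →
      ∃ C > (0:ℝ), ∃ T0 > (0:ℝ), ∀ T ≥ T0,
        ∀ Φ : Xspace (2*n) → ℝ,
          (∀ h : SLR (2*n), Φ (QuotientGroup.mk h) =
            (Nat.card {v : Fin k → (Fin (2*n) → ℤ) |
              (∀ l, IsPrimitiveVec (v l)) ∧
              (fun i => (h : Matrix (Fin (2*n)) (Fin (2*n)) ℝ).mulVec
                (fun j => ((v i j : ℤ) : ℝ))) ∈ EgT n k g a b T} : ℝ)) →
          |(∫ x, Φ x ∂μ) - (1 / zetaval (2*n) ^ k) * (volume (EgT n k g a b T)).toReal|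
            ≤ C * T ^ (((2*n*(k-1) : ℕ) : ℝ) - (((k-1)*(k-2) : ℕ) : ℝ)) := by
  intro μ hprob hinv
  have hμ : XInv μ := hinv
  have hkn : k ≤ n + 1 := by
    have h1 : (k : ℝ) ≤ n + 1 := by nlinarith [sq_nonneg ((k : ℝ) - 4)]
    exact_mod_cast h1
  have hd : k + 2 ≤ 2 * n := by
    have h1 : (k : ℝ) + 2 ≤ 2 * n := by nlinarith [sq_nonneg ((k : ℝ) - 2)]
    exact_mod_cast h1
  obtain ⟨C, hC, hCb⟩ := dep_part hk hkn hd a b g hμ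
  refine ⟨C.toReal + 1, by positivity, 1, one_pos, fun T hT Φ hΦ => ?_⟩
  set E := EgT n k g a b T with hE
  have hEm : MeasurableSet E := measurableSet_EgT _ _ _ _ _ _
  have hEv : volume E ≠ ⊤ := ((measure_mono EgT_box).trans_lt (vol_box_lt _ _ _)).ne
  have hz : 0 < zetaval (2*n) := (zeta_pos (by omega)).1
  have hΦ' : Φ = fun x => (sieg (PV (2*n) k) (E.indicator 1) (Quotient.out x)).toReal := by
    funext x
    rw [sieg_card]
    have h1 := hΦ (Quotient.out x)
    have h2 : (QuotientGroup.mk (Quotient.out x) : Xspace (2*n)) = x := Quotient.out_eq x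
    rw [h2] at h1
    exact h1
  have hsplit : mS μ (PV (2*n) k) E = mS μ (PPS (2*n) k) E
      + mS μ (PV (2*n) k ∩ (LIS (2*n) k)ᶜ) E := by
    rw [← mS_union μ (PPS_inv _ _) (GInv_inter (PV_inv _ _) (LISc_inv _ _)) _ hEm]
    · congr 1
      apply congrArg
      apply Set.ext
      intro v
      constructor
      · intro h
        by_cases hv : v ∈ LIS (2*n) k
        · exact Or.inl ⟨hv, h⟩
        · exact Or.inr ⟨h, hv⟩
      · rintro (h | h)
        · exact h.2
        · exact h.1
    · exact Set.disjoint_left.2 fun v h1 h2 => h2.2 h1.1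
  have hP : mS μ (PPS (2*n) k) E = (ENNReal.ofReal (zetaval (2*n)) ^ k)⁻¹ * volume E := by
    rw [PPS_vol hk hd hμ]; rfl
  have hPt : mS μ (PPS (2*n) k) E ≠ ⊤ := by
    rw [hP]
    refine ENNReal.mul_ne_top (ENNReal.inv_ne_top.2 (pow_ne_zero _ ?_)) hEv
    exact (ENNReal.ofReal_pos.2 hz).ne'
  have hDb := hCb T hT
  rw [← hE] at hDb
  have hrt : C * ENNReal.ofReal T ^ ((k-1) * (2*n+2-k)) ≠ ⊤ :=
    ENNReal.mul_ne_top hC (ENNReal.pow_ne_top ENNReal.ofReal_ne_top)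
  have hDt : mS μ (PV (2*n) k ∩ (LIS (2*n) k)ᶜ) E ≠ ⊤ := ne_top_of_le_ne_top hrt hDb
  have hms := mS_apply μ (PV_inv (2*n) k) hEm
  have hmeas := measurable_sieg_out (PV_inv (2*n) k) ((measurable_one (α := ENNReal)).indicator hEm)
  have hfin : ∫⁻ x, sieg (PV (2*n) k) (E.indicator 1) (Quotient.out x) ∂μ ≠ ⊤ := by
    rw [← hms, hsplit]
    exact ENNReal.add_ne_top.2 ⟨hPt, hDt⟩
  have hint : ∫ x, Φ x ∂μ = (mS μ (PV (2*n) k) E).toReal := by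
    rw [hΦ', hms]
    exact integral_toReal hmeas.aemeasurable (ae_lt_top hmeas hfin)
  have hPr : (mS μ (PPS (2*n) k) E).toReal = (1 / zetaval (2*n) ^ k) * (volume E).toReal := by
    rw [hP, ENNReal.toReal_mul, ENNReal.toReal_inv, ENNReal.toReal_pow, ENNReal.toReal_ofReal hz.le,
      one_div]
  have hexp : (((2*n*(k-1) : ℕ) : ℝ) - (((k-1)*(k-2) : ℕ) : ℝ)) = (((k-1) * (2*n+2-k) : ℕ) : ℝ) := by
    have : 2*n*(k-1) = (k-1) * (2*n+2-k) + (k-1)*(k-2) := by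
      rcases Nat.lt_or_ge k 2 with h | h
      · have : k = 1 := by omega
        subst this; simp
      · have : 2 * n = (2*n+2-k) + (k-2) := by omega
        conv_lhs => rw [this]
        ring
    rw [this]
    push_cast
    ring
  rw [hint, hsplit, ENNReal.toReal_add hPt hDt, hPr, add_sub_cancel_left, abs_of_nonneg ENNReal.toReal_nonneg,
    hexp, Real.rpow_natCast]
  have hT0 : (0:ℝ) ≤ T := by linarith
  have hD2 := ENNReal.toReal_mono hrt hDb
  rw [ENNReal.toReal_mul, ENNReal.toReal_pow, ENNReal.toReal_ofReal hT0] at hD2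
  refine hD2.trans (mul_le_mul_of_nonneg_right (by linarith) (by positivity))
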